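/- Let N ∈ ℕ, (t₀,x₀) ∈ ℝ^{n+1} and s ≥ 0. If u is a tempered distribution on ℝ^{2n+1} belonging to H^{−N}(ℝ^{2n+1}) and there exists an open neighborhood U of (t₀,x₀) in ℝ^{n+1} such that φ(t,x)·Pu ∈ H^s(ℝ^{2n+1}) for every φ ∈ C_0^∞(U), then there exist an integer k ≥ 1 and an open neighborhood V of (t₀,x₀) in ℝ^{n+1} such that φ(t,x)·⟨v⟩^{−k}u ∈ H^{s+2σ/(2σ+1)}(ℝ^{2n+1}) for every φ ∈ C_0^∞(V), where ⟨v⟩ = (1+|v|²)^{1/2}. -/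

import Mathlib

open MeasureTheory
open scoped ENNReal Real

noncomputable section

/-- `ℝ^n` with the Euclidean norm. -/
abbrev E (n : ℕ) : Type := EuclideanSpace ℝ (Fin n)
/-- `ℝ^{2n+1} = ℝ_t × ℝ^n_x × ℝ^n_v` with the Euclidean norm. -/
abbrev Z (n : ℕ) : Type := EuclideanSpace ℝ (Unit ⊕ Fin n ⊕ Fin n)

variable {n : ℕ}

/-- the `t` (resp. dual `τ`) coordinate -/
def tC (ζ : Z n) : ℝ := ζ (Sum.inl ())
/-- the `x` (resp. dual `ξ`) coordinates -/
def xC (ζ : Z n) : E n := WithLp.toLp 2 (fun i => ζ (Sum.inr (Sum.inl i)))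
/-- the `v` (resp. dual `η`) coordinates -/
def vC (ζ : Z n) : E n := WithLp.toLp 2 (fun i => ζ (Sum.inr (Sum.inr i)))

/-- the unit vector in the `t` direction -/
def eT : Z n := EuclideanSpace.single (Sum.inl ()) 1
/-- the unit vector in the `xᵢ` direction -/
def eX (i : Fin n) : Z n := EuclideanSpace.single (Sum.inr (Sum.inl i)) 1

/-- the symbol `F(η) = |η|^{2σ} w(η) + |η|² (1 - w(η))` -/
def Fsym (σ : ℝ) (w : E n → ℝ) (η : E n) : ℝ :=
  ‖η‖ ^ (2 * σ) * w η + ‖η‖ ^ 2 * (1 - w η)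

/-- A tempered distribution `u` with function Fourier transform `h = 𝓕u` is
encoded through the pairing `⟨u, ψ⟩ = ∫ h(ζ) (𝓕⁻¹ψ)(ζ) dζ` with test
functions `ψ` (bilinear Parseval formula). -/
def pairing (h : Z n → ℂ) (ψ : Z n → ℂ) : ℂ :=
  ∫ ζ : Z n, h ζ * FourierTransformInv.fourierInv ψ ζ

/-- the Fourier multiplier with symbol `F(-η)` (the transpose of `(-Δ̃_v)^σ`
for the bilinear pairing) -/
def fracLapNeg (σ : ℝ) (w : E n → ℝ) (g : Z n → ℂ) : Z n → ℂ :=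
  FourierTransformInv.fourierInv
    (fun ζ : Z n => (Fsym σ w (-vC ζ) : ℂ) * FourierTransform.fourier g ζ)

/-- the transpose `P^t ψ = -∂_tψ - v·∂_xψ + (-Δ̃_v)^{σ,t}(a ψ)` of the operator
`P = ∂_t + v·∂_x + a(t,x,v)(-Δ̃_v)^σ`, so that `⟨Pu, ψ⟩ = ⟨u, P^tψ⟩` -/
def Ptrans (σ : ℝ) (w : E n → ℝ) (a : Z n → ℝ) (ψ : Z n → ℂ) (z : Z n) : ℂ :=
  -fderiv ℝ ψ z eT - ∑ i : Fin n, (vC z i : ℂ) * fderiv ℝ ψ z (eX i)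
    + fracLapNeg σ w (fun z' => (a z' : ℂ) * ψ z') z

/-- the tempered distribution with Fourier transform `h` belongs to `H^r`:
its Fourier transform is a function `G` with `⟨ζ⟩^r G ∈ L²`.  Here the
distribution is described by its pairings `L ψ` against Schwartz functions. -/
def IsHr (r : ℝ) (L : (Z n → ℂ) → ℂ) : Prop :=
  ∃ G : Z n → ℂ,
    MemLp (fun ζ => (((1 + ‖ζ‖ ^ 2) ^ (r / 2) : ℝ) : ℂ) * G ζ) 2 volume ∧
    ∀ ψ : SchwartzMap (Z n) ℂ, L ⇑ψ = pairing G ⇑ψ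

namespace HE

/-! ### coordinates -/

lemma normsq (ζ : Z n) : ‖ζ‖ ^ 2 = tC ζ ^ 2 + ‖xC ζ‖ ^ 2 + ‖vC ζ‖ ^ 2 := by
  simp [EuclideanSpace.norm_sq_eq, tC, xC, vC, Fintype.sum_sum_type, add_assoc]

lemma tC_add (a b : Z n) : tC (a + b) = tC a + tC b := rfl
lemma tC_sub (a b : Z n) : tC (a - b) = tC a - tC b := rfl
lemma xC_sub (a b : Z n) : xC (a - b) = xC a - xC b := rfl
lemma vC_sub (a b : Z n) : vC (a - b) = vC a - vC b := rfl
lemma vC_neg (a : Z n) : vC (-a) = - vC a := rfl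
lemma xC_neg (a : Z n) : xC (-a) = - xC a := rfl
lemma tC_neg (a : Z n) : tC (-a) = - tC a := rfl

/-- linear versions -/
def vL : Z n →L[ℝ] E n := LinearMap.toContinuousLinearMap
  { toFun := vC, map_add' := fun _ _ => rfl, map_smul' := fun _ _ => rfl }
def xL : Z n →L[ℝ] E n := LinearMap.toContinuousLinearMap
  { toFun := xC, map_add' := fun _ _ => rfl, map_smul' := fun _ _ => rfl }
def tL : Z n →L[ℝ] ℝ := LinearMap.toContinuousLinearMap
  { toFun := tC, map_add' := fun _ _ => rfl, map_smul' := fun _ _ => rfl }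
@[simp] lemma vL_apply (ζ : Z n) : vL ζ = vC ζ := rfl
@[simp] lemma xL_apply (ζ : Z n) : xL ζ = xC ζ := rfl
@[simp] lemma tL_apply (ζ : Z n) : tL ζ = tC ζ := rfl
lemma vC_cont : Continuous (vC : Z n → E n) := vL.continuous
lemma xC_cont : Continuous (xC : Z n → E n) := xL.continuous
lemma tC_cont : Continuous (tC : Z n → ℝ) := tL.continuous

lemma norm_vC_le (ζ : Z n) : ‖vC ζ‖ ≤ ‖ζ‖ := by
  have := normsq ζ
  apply (sq_le_sq₀ (norm_nonneg _) (norm_nonneg _)).1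
  nlinarith [sq_nonneg (tC ζ), sq_nonneg ‖xC ζ‖]
lemma norm_xC_le (ζ : Z n) : ‖xC ζ‖ ≤ ‖ζ‖ := by
  have := normsq ζ
  apply (sq_le_sq₀ (norm_nonneg _) (norm_nonneg _)).1
  nlinarith [sq_nonneg (tC ζ), sq_nonneg ‖vC ζ‖]
lemma norm_tC_le (ζ : Z n) : |tC ζ| ≤ ‖ζ‖ := by
  have := normsq ζ
  apply abs_le_of_sq_le_sq _ (norm_nonneg _)
  nlinarith [sq_nonneg ‖xC ζ‖, sq_nonneg ‖vC ζ‖]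

lemma le_of_sq_le_sq' {x y : ℝ} (hy : 0 ≤ y) (h : x ^ 2 ≤ y ^ 2) : x ≤ y :=
  (le_abs_self x).trans (abs_le_of_sq_le_sq h hy)

/-! ### brackets -/
/-- `⟨ζ⟩` -/
def jb (ζ : Z n) : ℝ := √(1 + ‖ζ‖ ^ 2)
/-- `⟨η⟩` -/
def je (ζ : Z n) : ℝ := √(1 + ‖vC ζ‖ ^ 2)
/-- `⟨(ξ,η)⟩` -/
def jm (ζ : Z n) : ℝ := √(1 + ‖xC ζ‖ ^ 2 + ‖vC ζ‖ ^ 2)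

lemma jb_sq (ζ : Z n) : jb ζ ^ 2 = 1 + ‖ζ‖ ^ 2 := Real.sq_sqrt (by positivity)
lemma je_sq (ζ : Z n) : je ζ ^ 2 = 1 + ‖vC ζ‖ ^ 2 := Real.sq_sqrt (by positivity)
lemma jm_sq (ζ : Z n) : jm ζ ^ 2 = 1 + ‖xC ζ‖ ^ 2 + ‖vC ζ‖ ^ 2 := Real.sq_sqrt (by positivity)
lemma one_le_je (ζ : Z n) : 1 ≤ je ζ := Real.one_le_sqrt.2 (by nlinarith [sq_nonneg ‖vC ζ‖])
lemma je_le_jm (ζ : Z n) : je ζ ≤ jm ζ := Real.sqrt_le_sqrt (by nlinarith [sq_nonneg ‖xC ζ‖])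
lemma jm_le_jb (ζ : Z n) : jm ζ ≤ jb ζ :=
  Real.sqrt_le_sqrt (by nlinarith [sq_nonneg (tC ζ), normsq ζ])
lemma one_le_jm (ζ : Z n) : 1 ≤ jm ζ := (one_le_je ζ).trans (je_le_jm ζ)
lemma one_le_jb (ζ : Z n) : 1 ≤ jb ζ := (one_le_jm ζ).trans (jm_le_jb ζ)
lemma je_pos (ζ : Z n) : 0 < je ζ := zero_lt_one.trans_le (one_le_je ζ)
lemma jm_pos (ζ : Z n) : 0 < jm ζ := zero_lt_one.trans_le (one_le_jm ζ)
lemma jb_pos (ζ : Z n) : 0 < jb ζ := zero_lt_one.trans_le (one_le_jb ζ)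
lemma norm_le_jb (ζ : Z n) : ‖ζ‖ ≤ jb ζ := Real.le_sqrt_of_sq_le (by linarith)
lemma norm_vC_le_je (ζ : Z n) : ‖vC ζ‖ ≤ je ζ := Real.le_sqrt_of_sq_le (by linarith)
lemma norm_xC_le_jm (ζ : Z n) : ‖xC ζ‖ ≤ jm ζ :=
  Real.le_sqrt_of_sq_le (by nlinarith [sq_nonneg ‖vC ζ‖])
lemma jb_cont : Continuous (jb : Z n → ℝ) := by unfold jb; fun_prop
lemma je_cont : Continuous (je : Z n → ℝ) := by
  unfold je; have := vC_cont (n := n); fun_prop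
lemma jm_cont : Continuous (jm : Z n → ℝ) := by
  unfold jm; have := vC_cont (n := n); have := xC_cont (n := n); fun_prop
@[simp] lemma jb_neg (ζ : Z n) : jb (-ζ) = jb ζ := by simp [jb]
lemma jb_sub_comm (a b : Z n) : jb (a - b) = jb (b - a) := by simp [jb, norm_sub_rev]
lemma jb_zero : jb (0 : Z n) = 1 := by simp [jb]
lemma jb_le (ζ : Z n) : jb ζ ≤ 1 + ‖ζ‖ := by
  apply Real.sqrt_le_iff.2 ⟨by positivity, by nlinarith [norm_nonneg ζ]⟩

lemma sqrt_lip (x y : ℝ) : |√(1 + x ^ 2) - √(1 + y ^ 2)| ≤ |x - y| := by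
  apply sq_le_sq.1
  have h1 : √(1 + x ^ 2) ^ 2 = 1 + x ^ 2 := Real.sq_sqrt (by positivity)
  have h2 : √(1 + y ^ 2) ^ 2 = 1 + y ^ 2 := Real.sq_sqrt (by positivity)
  have : 1 + x * y ≤ √(1 + x ^ 2) * √(1 + y ^ 2) := by
    apply le_of_sq_le_sq' (by positivity)
    rw [mul_pow, h1, h2]; nlinarith [sq_nonneg (x - y)]
  nlinarith

lemma jb_lip (a b : Z n) : |jb a - jb b| ≤ jb (a - b) :=
  (sqrt_lip _ _).trans ((abs_norm_sub_norm_le a b).trans (norm_le_jb _))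
lemma je_lip (a b : Z n) : |je a - je b| ≤ jb (a - b) :=
  (sqrt_lip _ _).trans ((abs_norm_sub_norm_le _ _).trans
    ((norm_vC_le (a - b)).trans (norm_le_jb _)))
lemma jm_lip (a b : Z n) : |jm a - jm b| ≤ jb (a - b) := by
  let B : Z n → WithLp 2 (E n × E n) := fun ζ => WithLp.toLp 2 (xC ζ, vC ζ)
  have hB : ∀ ζ, ‖B ζ‖ ^ 2 = ‖xC ζ‖ ^ 2 + ‖vC ζ‖ ^ 2 := fun ζ => by
    simp [B, WithLp.prod_norm_sq_eq_of_L2]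
  have hB2 : ∀ ζ, jm ζ = √(1 + ‖B ζ‖ ^ 2) := fun ζ => by rw [hB, jm, add_assoc]
  have h1 : ‖B a - B b‖ ≤ ‖a - b‖ := by
    apply (sq_le_sq₀ (norm_nonneg _) (norm_nonneg _)).1
    have : B a - B b = B (a - b) := rfl
    rw [this, hB, normsq]; nlinarith [sq_nonneg (tC (a - b))]
  rw [hB2, hB2]
  exact (sqrt_lip _ _).trans ((abs_norm_sub_norm_le _ _).trans (h1.trans (norm_le_jb _)))

lemma jb_peetre (a b : Z n) : jb a ≤ 2 * jb (a - b) * jb b := by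
  have := abs_le.1 (jb_lip a b)
  nlinarith [one_le_jb (a - b), one_le_jb b]

end HE

namespace HE

/-! ### slowly varying families of weights -/
/-- slowly varying families -/
def SV {ι : Type*} (p : ι → Z n → ℝ) : Prop :=
  (∀ i ζ, 0 < p i ζ) ∧ ∃ C : ℝ, ∃ M : ℕ, 0 ≤ C ∧
    ∀ i ζ ζ', |p i ζ - p i ζ'| ≤ C * jb (ζ - ζ') ^ M * (p i ζ' / je ζ')

/-- moderate families -/
def Md {ι : Type*} (p : ι → Z n → ℝ) : Prop :=
  (∀ i ζ, 0 < p i ζ) ∧ ∃ C : ℝ, ∃ M : ℕ, 0 ≤ C ∧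
    ∀ i ζ ζ', p i ζ ≤ C * jb (ζ - ζ') ^ M * p i ζ'

variable {ι : Type*} {p q : ι → Z n → ℝ}

lemma one_le_jbpow (ζ : Z n) (M : ℕ) : 1 ≤ jb ζ ^ M := one_le_pow₀ (one_le_jb ζ)

lemma SV.md' {C : ℝ} {M : ℕ} (hp : ∀ i ζ, 0 < p i ζ) (hC : 0 ≤ C)
    (h : ∀ i ζ ζ', |p i ζ - p i ζ'| ≤ C * jb (ζ - ζ') ^ M * (p i ζ' / je ζ')) (i : ι) (ζ ζ' : Z n) :
    p i ζ ≤ (C + 1) * jb (ζ - ζ') ^ M * p i ζ' := by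
  have h1 := (abs_le.1 (h i ζ ζ')).2
  have h2 : p i ζ' / je ζ' ≤ p i ζ' := div_le_self (hp i ζ').le (one_le_je ζ')
  have h3 := one_le_jbpow (ζ - ζ') M
  have h4 := hp i ζ'
  have h5 : C * jb (ζ - ζ') ^ M * (p i ζ' / je ζ') ≤ C * jb (ζ - ζ') ^ M * p i ζ' := by gcongr
  nlinarith

lemma SV.md (h : SV p) : Md p := by
  obtain ⟨hp, C, M, hC, h⟩ := h
  exact ⟨hp, C + 1, M, by linarith, SV.md' hp hC h⟩

lemma Md.mul (hp : Md p) (hq : Md q) : Md (fun i ζ => p i ζ * q i ζ) := by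
  obtain ⟨hp0, C, M, hC, hp⟩ := hp
  obtain ⟨hq0, D, K, hD, hq⟩ := hq
  refine ⟨fun i ζ => mul_pos (hp0 i ζ) (hq0 i ζ), C * D, M + K, by positivity, fun i ζ ζ' => ?_⟩
  have := hp i ζ ζ'; have := hq i ζ ζ'
  have hJ0 := jb_pos (ζ - ζ')
  have h1 := hp0 i ζ; have h2 := hq0 i ζ; have h3 := hp0 i ζ'; have h4 := hq0 i ζ'
  calc p i ζ * q i ζ ≤ (C * jb (ζ - ζ') ^ M * p i ζ') * (D * jb (ζ - ζ') ^ K * q i ζ') := by gcongr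
    _ = _ := by ring

lemma Md.rpow (hp : Md p) (θ : ℝ) : Md (fun i ζ => p i ζ ^ θ) := by
  obtain ⟨hp0, C, M, hC, hp⟩ := hp
  obtain ⟨m, hm⟩ := exists_nat_ge |θ|
  refine ⟨fun i ζ => Real.rpow_pos_of_pos (hp0 i ζ) _, (C + 1) ^ m, M * m, by positivity,
    fun i ζ ζ' => ?_⟩
  have key : ∀ A a b : ℝ, 1 ≤ A → 0 < a → 0 < b → a ≤ A * b → b ≤ A * a → a ^ θ ≤ A ^ m * b ^ θ := by
    intro A a b hA ha hb h1 h2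
    rcases le_total 0 θ with h0 | h0
    · calc a ^ θ ≤ (A * b) ^ θ := by gcongr
        _ = A ^ θ * b ^ θ := by rw [Real.mul_rpow (by linarith) hb.le]
        _ ≤ A ^ m * b ^ θ := by
          gcongr
          rw [← Real.rpow_natCast]
          exact Real.rpow_le_rpow_of_exponent_le hA ((le_abs_self θ).trans hm)
    · have : b ^ (-θ) ≤ A ^ m * a ^ (-θ) := by
        calc b ^ (-θ) ≤ (A * a) ^ (-θ) := by
              apply Real.rpow_le_rpow hb.le h2; linarith
          _ = A ^ (-θ) * a ^ (-θ) := by rw [Real.mul_rpow (by linarith) ha.le]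
          _ ≤ A ^ m * a ^ (-θ) := by
            gcongr
            rw [← Real.rpow_natCast]
            exact Real.rpow_le_rpow_of_exponent_le hA ((neg_le_abs θ).trans hm)
      rw [Real.rpow_neg ha.le, Real.rpow_neg hb.le] at this
      have ha' := Real.rpow_pos_of_pos ha θ
      have hb' := Real.rpow_pos_of_pos hb θ
      rw [← div_eq_mul_inv, inv_eq_one_div, div_le_div_iff₀ hb' ha'] at this
      linarith
  have hJ := one_le_jbpow (ζ - ζ') M
  have h3 := hp0 i ζ; have h4 := hp0 i ζ'
  have := key ((C + 1) * jb (ζ - ζ') ^ M) _ _ (by nlinarith) h3 h4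
    ((hp i ζ ζ').trans (by gcongr; linarith))
    ((hp i ζ' ζ).trans (by rw [jb_sub_comm ζ' ζ]; gcongr; linarith))
  simpa [mul_pow, pow_mul] using this

lemma SV.add (hp : SV p) (hq : SV q) : SV (fun i ζ => p i ζ + q i ζ) := by
  obtain ⟨hp0, C, M, hC, hp⟩ := hp
  obtain ⟨hq0, D, K, hD, hq⟩ := hq
  refine ⟨fun i ζ => add_pos (hp0 i ζ) (hq0 i ζ), C + D, M + K, by positivity, fun i ζ ζ' => ?_⟩
  have h1 := hp i ζ ζ'; have h2 := hq i ζ ζ'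
  have h3 := hp0 i ζ'; have h4 := hq0 i ζ'
  have hJ := one_le_jb (ζ - ζ')
  have e1 : jb (ζ - ζ') ^ M ≤ jb (ζ - ζ') ^ (M + K) := pow_le_pow_right₀ hJ (by omega)
  have e2 : jb (ζ - ζ') ^ K ≤ jb (ζ - ζ') ^ (M + K) := pow_le_pow_right₀ hJ (by omega)
  have hj := je_pos ζ'
  calc |p i ζ + q i ζ - (p i ζ' + q i ζ')| ≤ |p i ζ - p i ζ'| + |q i ζ - q i ζ'| := by
        rw [add_sub_add_comm]; exact abs_add_le _ _
    _ ≤ C * jb (ζ - ζ') ^ M * (p i ζ' / je ζ') + D * jb (ζ - ζ') ^ K * (q i ζ' / je ζ') := by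
        gcongr
    _ ≤ C * jb (ζ - ζ') ^ (M + K) * (p i ζ' / je ζ')
        + D * jb (ζ - ζ') ^ (M + K) * (q i ζ' / je ζ') := by gcongr
    _ ≤ (C + D) * jb (ζ - ζ') ^ (M + K) * ((p i ζ' + q i ζ') / je ζ') := by
        have : 0 ≤ jb (ζ - ζ') ^ (M + K) := by linarith [one_le_jbpow (ζ - ζ') (M + K)]
        rw [add_div]
        have a1 : 0 ≤ D * jb (ζ - ζ') ^ (M + K) * (p i ζ' / je ζ') := by positivity
        have a2 : 0 ≤ C * jb (ζ - ζ') ^ (M + K) * (q i ζ' / je ζ') := by positivity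
        nlinarith

lemma SV.mul (hp : SV p) (hq : SV q) : SV (fun i ζ => p i ζ * q i ζ) := by
  obtain ⟨hp0, C, M, hC, hp⟩ := hp
  obtain ⟨hq0, D, K, hD, hq⟩ := hq
  refine ⟨fun i ζ => mul_pos (hp0 i ζ) (hq0 i ζ), C * (D + 1) + D, M + K, by positivity,
    fun i ζ ζ' => ?_⟩
  have h1 := hp i ζ ζ'; have h2 := hq i ζ ζ'
  have h5 := SV.md' hq0 hD hq i ζ ζ'
  have h3 := hp0 i ζ'; have h4 := hq0 i ζ'; have h6 := hq0 i ζ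
  have hJ := one_le_jb (ζ - ζ')
  have e2 : jb (ζ - ζ') ^ K ≤ jb (ζ - ζ') ^ (M + K) := pow_le_pow_right₀ hJ (by omega)
  have hj := je_pos ζ'
  have hJ0 := jb_pos (ζ - ζ')
  calc |p i ζ * q i ζ - p i ζ' * q i ζ'|
      = |(p i ζ - p i ζ') * q i ζ + p i ζ' * (q i ζ - q i ζ')| := by ring_nf
    _ ≤ |p i ζ - p i ζ'| * q i ζ + p i ζ' * |q i ζ - q i ζ'| := by
        refine (abs_add_le _ _).trans ?_
        rw [abs_mul, abs_mul, abs_of_pos h6, abs_of_pos h3]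
    _ ≤ (C * jb (ζ - ζ') ^ M * (p i ζ' / je ζ')) * ((D + 1) * jb (ζ - ζ') ^ K * q i ζ')
        + p i ζ' * (D * jb (ζ - ζ') ^ (M + K) * (q i ζ' / je ζ')) := by
        gcongr
        exact h2.trans (by gcongr)
    _ = _ := by field_simp; ring

lemma rpow_mvt (θ : ℝ) (m : ℕ) (hm : |θ - 1| ≤ m) (A t : ℝ) (hA : 1 ≤ A) (ht : 0 < t)
    (h1 : t ≤ A) (h2 : 1 ≤ A * t) : |t ^ θ - 1| ≤ |θ| * A ^ m * |t - 1| := by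
  have hA0 : 0 < A := by linarith
  have key : ∀ x ∈ Set.Icc A⁻¹ A, ‖deriv (fun x : ℝ => x ^ θ) x‖ ≤ |θ| * A ^ m := by
    intro x hx
    have hx0 : 0 < x := lt_of_lt_of_le (by positivity) hx.1
    rw [Real.deriv_rpow_const, norm_mul, Real.norm_eq_abs, Real.norm_eq_abs,
      abs_of_pos (Real.rpow_pos_of_pos hx0 _)]
    gcongr
    rw [← Real.rpow_natCast]
    rcases le_total 0 (θ - 1) with h0 | h0
    · exact (Real.rpow_le_rpow hx0.le hx.2 h0).trans
        (Real.rpow_le_rpow_of_exponent_le hA ((le_abs_self _).trans hm))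
    · refine (Real.rpow_le_rpow_of_nonpos (by positivity) hx.1 h0).trans ?_
      rw [Real.inv_rpow hA0.le, ← Real.rpow_neg hA0.le]
      exact Real.rpow_le_rpow_of_exponent_le hA ((neg_le_abs _).trans hm)
  have := (convex_Icc A⁻¹ A).norm_image_sub_le_of_norm_deriv_le (f := fun x : ℝ => x ^ θ)
    (x := 1) (y := t) (fun x hx => by
      have hx0 : 0 < x := lt_of_lt_of_le (by positivity) hx.1
      exact (Real.hasDerivAt_rpow_const (Or.inl hx0.ne')).differentiableAt) key
    ⟨inv_le_one_of_one_le₀ hA, hA⟩ ⟨by rw [inv_le_iff_one_le_mul₀ hA0]; linarith, h1⟩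
  simpa using this

lemma SV.rpow (hp : SV p) (θ : ℝ) : SV (fun i ζ => p i ζ ^ θ) := by
  obtain ⟨hp0, C, M, hC, hp⟩ := hp
  obtain ⟨m, hm⟩ := exists_nat_ge |θ - 1|
  refine ⟨fun i ζ => Real.rpow_pos_of_pos (hp0 i ζ) _, |θ| * (C + 1) ^ m * C, M * m + M,
    by positivity, fun i ζ ζ' => ?_⟩
  have h1 := hp i ζ ζ'
  have h3 := hp0 i ζ; have h4 := hp0 i ζ'
  have hJ := one_le_jbpow (ζ - ζ') M
  have m1 := SV.md' hp0 hC hp i ζ ζ'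
  have m2 := SV.md' hp0 hC hp i ζ' ζ
  rw [jb_sub_comm ζ' ζ] at m2
  have hj := je_pos ζ'
  have hJ0 := jb_pos (ζ - ζ')
  have := rpow_mvt θ m hm ((C + 1) * jb (ζ - ζ') ^ M) (p i ζ / p i ζ') (by nlinarith)
    (by positivity) (by rwa [div_le_iff₀ h4]) (by rwa [← mul_div_assoc, le_div_iff₀ h4, one_mul])
  have e1 : p i ζ ^ θ = (p i ζ / p i ζ') ^ θ * p i ζ' ^ θ := by
    rw [← Real.mul_rpow (by positivity) h4.le, div_mul_cancel₀ _ h4.ne']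
  have hq := Real.rpow_pos_of_pos h4 θ
  have e2 : |p i ζ / p i ζ' - 1| ≤ C * jb (ζ - ζ') ^ M / je ζ' := by
    rw [div_sub_one h4.ne', abs_div, abs_of_pos h4, div_le_iff₀ h4]
    refine h1.trans (le_of_eq (by field_simp))
  calc |p i ζ ^ θ - p i ζ' ^ θ| = |(p i ζ / p i ζ') ^ θ - 1| * p i ζ' ^ θ := by
        rw [e1, ← sub_one_mul, abs_mul, abs_of_pos hq]
    _ ≤ (|θ| * ((C + 1) * jb (ζ - ζ') ^ M) ^ m * (C * jb (ζ - ζ') ^ M / je ζ')) * p i ζ' ^ θ := by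
        refine mul_le_mul_of_nonneg_right (this.trans ?_) hq.le
        gcongr
    _ = _ := by
      rw [mul_pow, pow_add, pow_mul]; field_simp

lemma SV.comp {κ : Type*} (hp : SV p) (f : κ → ι) : SV (fun i => p (f i)) := by
  obtain ⟨hp0, C, M, hC, hp⟩ := hp
  exact ⟨fun i => hp0 _, C, M, hC, fun i => hp _⟩
lemma Md.comp {κ : Type*} (hp : Md p) (f : κ → ι) : Md (fun i => p (f i)) := by
  obtain ⟨hp0, C, M, hC, hp⟩ := hp
  exact ⟨fun i => hp0 _, C, M, hC, fun i => hp _⟩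

lemma sv_of_lip (p : Z n → ℝ) (h0 : ∀ ζ, je ζ ≤ p ζ)
    (h : ∀ ζ ζ', |p ζ - p ζ'| ≤ jb (ζ - ζ')) : SV (fun (_ : ι) => p) := by
  refine ⟨fun i ζ => (je_pos ζ).trans_le (h0 ζ), 1, 1, by norm_num, fun i ζ ζ' => ?_⟩
  have := (one_le_div (je_pos ζ')).2 (h0 ζ')
  have := jb_pos (ζ - ζ')
  have := h ζ ζ'
  rw [one_mul, pow_one]
  nlinarith

lemma sv_jb : SV (fun (_ : ι) => (jb : Z n → ℝ)) :=
  sv_of_lip _ (fun ζ => (je_le_jm ζ).trans (jm_le_jb ζ)) jb_lip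
lemma sv_jm : SV (fun (_ : ι) => (jm : Z n → ℝ)) := sv_of_lip _ je_le_jm jm_lip
lemma sv_je : SV (fun (_ : ι) => (je : Z n → ℝ)) := sv_of_lip _ (fun _ => le_rfl) je_lip

lemma sv_eps : SV (fun (ε : Set.Ioi (0:ℝ)) (ζ : Z n) => 1 + ε.1 * jb ζ ^ 2) := by
  refine ⟨fun ε ζ => by have := ε.2.out; positivity, 3, 2, by norm_num, fun ε ζ ζ' => ?_⟩
  have hε := ε.2.out
  have hJ := one_le_jb (ζ - ζ'); have hb := one_le_jb ζ'
  have hj := je_pos ζ'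
  have hje := (je_le_jm ζ').trans (jm_le_jb ζ')
  have hl := jb_lip ζ ζ'
  have hz : jb ζ ≤ jb (ζ - ζ') + jb ζ' := by linarith [(abs_le.1 hl).2]
  have hz0 := jb_pos ζ
  rw [mul_div_assoc', le_div_iff₀ hj]
  have e1 : |1 + ε.1 * jb ζ ^ 2 - (1 + ε.1 * jb ζ' ^ 2)|
      = ε.1 * (|jb ζ - jb ζ'| * (jb ζ + jb ζ')) := by
    rw [← abs_of_pos (show 0 < jb ζ + jb ζ' by positivity), ← abs_mul, ← abs_of_pos hε, ← abs_mul,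
      abs_of_pos hε]
    congr 1; ring
  rw [e1]
  have e2 : |jb ζ - jb ζ'| * (jb ζ + jb ζ') ≤ jb (ζ - ζ') * (3 * jb (ζ - ζ') * jb ζ') := by
    gcongr
    nlinarith
  calc ε.1 * (|jb ζ - jb ζ'| * (jb ζ + jb ζ')) * je ζ'
      ≤ ε.1 * (jb (ζ - ζ') * (3 * jb (ζ - ζ') * jb ζ')) * jb ζ' := by gcongr
    _ = 3 * jb (ζ - ζ') ^ 2 * (ε.1 * jb ζ' ^ 2) := by ring
    _ ≤ _ := by gcongr; linarith

/-! ### the hypoelliptic weight -/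
/-- `r = (1+|ξ|²+⟨η⟩^{2β})^{1/(2β)}`, `β=2σ+1` -/
def rw0 (σ : ℝ) (ζ : Z n) : ℝ := 1 + ‖xC ζ‖ ^ 2 + je ζ ^ (2 * (2 * σ + 1))
def rr (σ : ℝ) (ζ : Z n) : ℝ := rw0 σ ζ ^ (1 / (2 * (2 * σ + 1)))

lemma rw0_pos (σ : ℝ) (ζ : Z n) : 0 < rw0 σ ζ := by
  have := Real.rpow_pos_of_pos (je_pos ζ) (2 * (2 * σ + 1)); unfold rw0; positivity
lemma rr_pos (σ : ℝ) (ζ : Z n) : 0 < rr σ ζ := Real.rpow_pos_of_pos (rw0_pos σ ζ) _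
lemma rr_cont (σ : ℝ) : Continuous (rr σ : Z n → ℝ) := by
  unfold rr
  refine Continuous.rpow_const ?_ (fun ζ => Or.inl (rw0_pos σ ζ).ne')
  unfold rw0
  have := xC_cont (n := n)
  have := (je_cont (n := n)).rpow_const (p := 2 * (2 * σ + 1)) (fun ζ => Or.inl (je_pos ζ).ne')
  fun_prop

lemma rr_pow {σ : ℝ} (hσ : 0 < σ) (ζ : Z n) : rr σ ζ ^ (2 * (2 * σ + 1)) = rw0 σ ζ := by
  rw [rr, ← Real.rpow_mul (rw0_pos σ ζ).le, one_div, inv_mul_cancel₀ (by positivity), Real.rpow_one]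
lemma je_le_rr {σ : ℝ} (hσ : 0 < σ) (ζ : Z n) : je ζ ≤ rr σ ζ := by
  have h : (0:ℝ) < 2 * (2 * σ + 1) := by positivity
  rw [← Real.rpow_le_rpow_iff (je_pos ζ).le (rr_pos σ ζ).le h, rr_pow hσ, rw0]
  nlinarith [sq_nonneg ‖xC ζ‖]
lemma one_le_rr {σ : ℝ} (hσ : 0 < σ) (ζ : Z n) : 1 ≤ rr σ ζ := (one_le_je ζ).trans (je_le_rr hσ ζ)

lemma rrb_sq {σ : ℝ} (hσ : 0 < σ) (ζ : Z n) : (rr σ ζ ^ (2 * σ + 1)) ^ 2 = rw0 σ ζ := by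
  rw [← rr_pow hσ, ← Real.rpow_natCast, ← Real.rpow_mul (rr_pos σ ζ).le]; congr 1; push_cast; ring

lemma xC_le_rr {σ : ℝ} (hσ : 0 < σ) (ζ : Z n) : ‖xC ζ‖ ≤ rr σ ζ ^ (2 * σ + 1) := by
  apply le_of_sq_le_sq' (Real.rpow_nonneg (rr_pos σ ζ).le _)
  rw [rrb_sq hσ, rw0]
  have := Real.rpow_pos_of_pos (je_pos ζ) (2 * (2 * σ + 1))
  linarith

lemma jm_le_rr {σ : ℝ} (hσ : 0 < σ) (ζ : Z n) : jm ζ ≤ rr σ ζ ^ (2 * σ + 1) := by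
  apply le_of_sq_le_sq' (Real.rpow_nonneg (rr_pos σ ζ).le _)
  rw [rrb_sq hσ, rw0, jm_sq]
  have : je ζ ^ 2 ≤ je ζ ^ (2 * (2 * σ + 1)) := by
    rw [← Real.rpow_natCast]
    exact Real.rpow_le_rpow_of_exponent_le (one_le_je ζ) (by push_cast; linarith)
  rw [je_sq] at this
  linarith

lemma sv_rw0 {σ : ℝ} (hσ : 0 < σ) : SV (fun (_ : ι) => (rw0 σ : Z n → ℝ)) := by
  obtain ⟨-, C, M, hC, h⟩ := (sv_je (ι := Unit) (n := n)).rpow (2 * (2 * σ + 1))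
  refine ⟨fun _ => rw0_pos σ, C + 2, M + 2, by positivity, fun _ ζ ζ' => ?_⟩
  have h1 := h () ζ ζ'
  have hj := je_pos ζ'
  have hJ := one_le_jb (ζ - ζ')
  have e0 : |‖xC ζ‖ - ‖xC ζ'‖| ≤ jb (ζ - ζ') :=
    (abs_norm_sub_norm_le _ _).trans ((norm_xC_le (ζ - ζ')).trans (norm_le_jb _))
  have x0 := norm_nonneg (xC ζ); have x1 := norm_nonneg (xC ζ')
  have e1 : |‖xC ζ‖ ^ 2 - ‖xC ζ'‖ ^ 2| ≤ 2 * jb (ζ - ζ') ^ 2 * (1 + ‖xC ζ'‖) := by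
    rw [sq_sub_sq, abs_mul, abs_of_nonneg (by positivity)]
    have := (abs_le.1 e0).2
    calc (‖xC ζ‖ + ‖xC ζ'‖) * |‖xC ζ‖ - ‖xC ζ'‖|
        ≤ (2 * jb (ζ - ζ') * (1 + ‖xC ζ'‖)) * jb (ζ - ζ') := by
          gcongr
          nlinarith
      _ = _ := by ring
  have e2 : (1 + ‖xC ζ'‖) ≤ rw0 σ ζ' / je ζ' := by
    rw [le_div_iff₀ hj]
    have : je ζ' ^ 2 ≤ je ζ' ^ (2 * (2 * σ + 1)) := by
      rw [← Real.rpow_natCast]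
      exact Real.rpow_le_rpow_of_exponent_le (one_le_je ζ') (by push_cast; linarith)
    unfold rw0
    nlinarith [sq_nonneg (1 - je ζ'), sq_nonneg (‖xC ζ'‖ - je ζ'), one_le_je ζ']
  have e3 : je ζ' ^ (2 * (2 * σ + 1)) ≤ rw0 σ ζ' := by
    unfold rw0; nlinarith [sq_nonneg ‖xC ζ'‖]
  have f1 : jb (ζ - ζ') ^ M ≤ jb (ζ - ζ') ^ (M + 2) := pow_le_pow_right₀ hJ (by omega)
  have f2 : jb (ζ - ζ') ^ 2 ≤ jb (ζ - ζ') ^ (M + 2) := pow_le_pow_right₀ hJ (by omega)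
  have hr := rw0_pos σ ζ'
  have hJ0 := jb_pos (ζ - ζ')
  have e5 : rw0 σ ζ - rw0 σ ζ' = (‖xC ζ‖ ^ 2 - ‖xC ζ'‖ ^ 2)
      + (je ζ ^ (2 * (2 * σ + 1)) - je ζ' ^ (2 * (2 * σ + 1))) := by unfold rw0; ring
  rw [e5]
  refine (abs_add_le _ _).trans ?_
  calc _ ≤ 2 * jb (ζ - ζ') ^ (M + 2) * (rw0 σ ζ' / je ζ')
        + C * jb (ζ - ζ') ^ (M + 2) * (rw0 σ ζ' / je ζ') := by
        refine add_le_add (e1.trans ?_) (h1.trans ?_)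
        · gcongr
        · gcongr
    _ = _ := by ring

lemma sv_rr {σ : ℝ} (hσ : 0 < σ) : SV (fun (_ : ι) => (rr σ : Z n → ℝ)) := (sv_rw0 hσ).rpow _

/-- `ξ·η` -/
def xe (ζ : Z n) : ℝ := ∑ i, xC ζ i * vC ζ i
lemma xe_eq (ζ : Z n) : xe ζ = inner ℝ (xC ζ) (vC ζ) := by
  simp [xe, PiLp.inner_apply, mul_comm]
lemma abs_xe (ζ : Z n) : |xe ζ| ≤ ‖xC ζ‖ * ‖vC ζ‖ := by
  rw [xe_eq]; exact abs_real_inner_le_norm _ _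
/-- `g = ξ·η / r^{2σ+2}` -/
def gg (σ : ℝ) (ζ : Z n) : ℝ := xe ζ * rr σ ζ ^ (-(2 * σ + 2))
lemma xe_le_rr {σ : ℝ} (hσ : 0 < σ) (ζ : Z n) : |xe ζ| ≤ rr σ ζ ^ (2 * σ + 2) := by
  refine (abs_xe ζ).trans ?_
  rw [show 2 * σ + 2 = (2 * σ + 1) + 1 by ring, Real.rpow_add (rr_pos σ ζ), Real.rpow_one]
  exact mul_le_mul (xC_le_rr hσ ζ) ((norm_vC_le_je ζ).trans (je_le_rr hσ ζ)) (norm_nonneg _)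
    (Real.rpow_nonneg (rr_pos σ ζ).le _)
lemma abs_gg {σ : ℝ} (hσ : 0 < σ) (ζ : Z n) : |gg σ ζ| ≤ 1 := by
  have h := Real.rpow_pos_of_pos (rr_pos σ ζ) (-(2 * σ + 2))
  rw [gg, abs_mul, abs_of_pos h]
  calc _ ≤ rr σ ζ ^ (2 * σ + 2) * rr σ ζ ^ (-(2 * σ + 2)) := by gcongr; exact xe_le_rr hσ ζ
    _ = 1 := by rw [← Real.rpow_add (rr_pos σ ζ)]; simp
lemma xe_cont : Continuous (xe : Z n → ℝ) := by
  have : (xe : Z n → ℝ) = fun ζ => inner ℝ (xC ζ) (vC ζ) := funext xe_eq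
  rw [this]; exact xC_cont.inner vC_cont
lemma gg_cont (σ : ℝ) : Continuous (gg σ : Z n → ℝ) := by
  unfold gg
  exact xe_cont.mul ((rr_cont σ).rpow_const (fun ζ => Or.inl (rr_pos σ ζ).ne'))

lemma sv_gg {σ κ : ℝ} (hσ : 0 < σ) (hκ : 0 ≤ κ) (hκ' : κ ≤ 1 / 2) :
    SV (fun (_ : ι) (ζ : Z n) => 1 + κ * gg σ ζ) := by
  have hpos : ∀ ζ : Z n, 1 / 2 ≤ 1 + κ * gg σ ζ := fun ζ => by
    have := abs_le.1 (abs_gg hσ ζ); nlinarith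
  obtain ⟨-, C, M, hC, h⟩ := (sv_rr (ι := Unit) (n := n) hσ).rpow (-(2 * σ + 2))
  refine ⟨fun _ ζ => by linarith [hpos ζ], 3 * (C + 1) + C, M + 2, by positivity, fun _ ζ ζ' => ?_⟩
  have h1 := h () ζ ζ'
  have h2 := SV.md' (fun _ ζ => Real.rpow_pos_of_pos (rr_pos σ ζ) _) hC h () ζ ζ'
  simp only at h1 h2
  set R := rr σ ζ ^ (-(2 * σ + 2)) with hR
  set R' := rr σ ζ' ^ (-(2 * σ + 2)) with hR'
  have hR0 : 0 < R := Real.rpow_pos_of_pos (rr_pos σ ζ) _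
  have hR0' : 0 < R' := Real.rpow_pos_of_pos (rr_pos σ ζ') _
  have hj := je_pos ζ'
  have hJ := one_le_jb (ζ - ζ')
  have hJ0 := jb_pos (ζ - ζ')
  have hx : ‖xC ζ - xC ζ'‖ ≤ jb (ζ - ζ') := (norm_xC_le (ζ - ζ')).trans (norm_le_jb _)
  have hv : ‖vC ζ - vC ζ'‖ ≤ jb (ζ - ζ') := (norm_vC_le (ζ - ζ')).trans (norm_le_jb _)
  set B := rr σ ζ' ^ (2 * σ + 1) with hB
  have hB1 : 1 ≤ B := Real.one_le_rpow (one_le_rr hσ ζ') (by linarith)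
  have hxB : ‖xC ζ'‖ ≤ B := xC_le_rr hσ ζ'
  have hvB : ‖vC ζ'‖ ≤ B := (norm_vC_le_je ζ').trans ((je_le_jm ζ').trans (jm_le_rr hσ ζ'))
  have hv2 : ‖vC ζ‖ ≤ jb (ζ - ζ') + B := by
    have := norm_add_le (vC ζ - vC ζ') (vC ζ'); rw [sub_add_cancel] at this; linarith
  have e1 : |xe ζ - xe ζ'| ≤ 3 * jb (ζ - ζ') ^ 2 * B := by
    have : xe ζ - xe ζ' = inner ℝ (xC ζ - xC ζ') (vC ζ) + inner ℝ (xC ζ') (vC ζ - vC ζ') := by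
      rw [xe_eq, xe_eq, inner_sub_left, inner_sub_right]; ring
    rw [this]
    refine (abs_add_le _ _).trans ?_
    have a1 := abs_real_inner_le_norm (xC ζ - xC ζ') (vC ζ)
    have a2 := abs_real_inner_le_norm (xC ζ') (vC ζ - vC ζ')
    calc _ ≤ jb (ζ - ζ') * (jb (ζ - ζ') + B) + B * jb (ζ - ζ') := by
          refine add_le_add (a1.trans ?_) (a2.trans ?_) <;> gcongr
      _ ≤ _ := by nlinarith [mul_nonneg (sub_nonneg.2 hJ) (sub_nonneg.2 hB1),
                    mul_nonneg (mul_nonneg (sub_nonneg.2 hJ) (sub_nonneg.2 hB1)) hJ0.le, sq_nonneg (jb (ζ - ζ'))]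
  have e2 : B * R' ≤ 1 / je ζ' := by
    rw [hB, hR', ← Real.rpow_add (rr_pos σ ζ'), show 2 * σ + 1 + -(2 * σ + 2) = -1 by ring,
      Real.rpow_neg_one, one_div]
    exact inv_anti₀ hj (je_le_rr hσ ζ')
  have e3 : |xe ζ'| * R' ≤ 1 := by
    have := abs_gg hσ ζ'; rwa [gg, abs_mul, abs_of_pos hR0'] at this
  have f1 : jb (ζ - ζ') ^ M ≤ jb (ζ - ζ') ^ (M + 2) := pow_le_pow_right₀ hJ (by omega)
  have main : |gg σ ζ - gg σ ζ'| ≤ (3 * (C + 1) + C) * jb (ζ - ζ') ^ (M + 2) * (1 / je ζ') := by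
    have : gg σ ζ - gg σ ζ' = (xe ζ - xe ζ') * R + xe ζ' * (R - R') := by unfold gg; ring
    rw [this]
    refine (abs_add_le _ _).trans ?_
    rw [abs_mul, abs_mul, abs_of_pos hR0]
    calc _ ≤ (3 * jb (ζ - ζ') ^ 2 * B) * ((C + 1) * jb (ζ - ζ') ^ M * R')
          + |xe ζ'| * (C * jb (ζ - ζ') ^ M * (R' / je ζ')) := by gcongr
      _ = 3 * (C + 1) * jb (ζ - ζ') ^ (M + 2) * (B * R')
          + (C * jb (ζ - ζ') ^ M * (1 / je ζ')) * (|xe ζ'| * R') := by ring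
      _ ≤ 3 * (C + 1) * jb (ζ - ζ') ^ (M + 2) * (1 / je ζ')
          + (C * jb (ζ - ζ') ^ (M + 2) * (1 / je ζ')) * 1 := by gcongr
      _ = _ := by ring
  have hg : κ / je ζ' ≤ (1 + κ * gg σ ζ') / je ζ' := by
    gcongr; linarith [hpos ζ']
  calc |1 + κ * gg σ ζ - (1 + κ * gg σ ζ')| = κ * |gg σ ζ - gg σ ζ'| := by
        rw [add_sub_add_left_eq_sub, ← mul_sub, abs_mul, abs_of_nonneg hκ]
    _ ≤ κ * ((3 * (C + 1) + C) * jb (ζ - ζ') ^ (M + 2) * (1 / je ζ')) := by gcongr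
    _ = (3 * (C + 1) + C) * jb (ζ - ζ') ^ (M + 2) * (κ / je ζ') := by ring
    _ ≤ _ := by gcongr

end HE

namespace HE

/-! ### derivatives of the weights in the `η` directions -/

/-- the regularised weight -/
def th (ρ p M ε : ℝ) (ζ : Z n) : ℝ := jb ζ ^ ρ * jm ζ ^ p * (1 + ε * jb ζ ^ 2) ^ (-M)
/-- the multiplier `q` -/
def qq (ρ p M σ κ ε : ℝ) (ζ : Z n) : ℝ := th ρ p M ε ζ ^ 2 * (1 + κ * gg σ ζ)


lemma hasD_normsq {e ζ : Z n} (_ : tC e = 0) (_ : xC e = 0) : HasDerivAt (fun s : ℝ => ‖vC (ζ + s • e)‖ ^ 2)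
    (2 * inner ℝ (vC ζ) (vC e)) 0 := by
  have h : HasDerivAt (fun s : ℝ => vC ζ + s • vC e) (vC e) 0 := by
    simpa using ((hasDerivAt_id (0:ℝ)).smul_const (vC e)).const_add (vC ζ)
  have := h.norm_sq
  rw [zero_smul, add_zero] at this
  exact this

lemma z0 (ζ e : Z n) : ζ + (0:ℝ) • e = ζ := by simp
lemma xC_line {e ζ : Z n} (_ : tC e = 0) (hx : xC e = 0) (s : ℝ) : xC (ζ + s • e) = xC ζ := by
  have : xC (ζ + s • e) = xC ζ + s • xC e := rfl
  rw [this, hx, smul_zero, add_zero]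
lemma tC_line {e ζ : Z n} (ht : tC e = 0) (_ : xC e = 0) (s : ℝ) : tC (ζ + s • e) = tC ζ := by
  have : tC (ζ + s • e) = tC ζ + s * tC e := rfl
  rw [this, ht, mul_zero, add_zero]

lemma hasD_je {e ζ : Z n} (ht : tC e = 0) (hx : xC e = 0) : HasDerivAt (fun s : ℝ => je (ζ + s • e)) (inner ℝ (vC ζ) (vC e) / je ζ) 0 := by
  have h := ((hasD_normsq ht hx (ζ := ζ)).const_add 1).sqrt (by positivity)
  refine HasDerivAt.congr_deriv (h) ?_
  symm
  rw [z0, ← je]; field_simp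

lemma hasD_jm {e ζ : Z n} (ht : tC e = 0) (hx : xC e = 0) : HasDerivAt (fun s : ℝ => jm (ζ + s • e)) (inner ℝ (vC ζ) (vC e) / jm ζ) 0 := by
  have h := ((hasD_normsq ht hx (ζ := ζ)).const_add (1 + ‖xC ζ‖ ^ 2)).sqrt (by positivity)
  have e1 : (fun s : ℝ => jm (ζ + s • e)) = fun s => √(1 + ‖xC ζ‖ ^ 2 + ‖vC (ζ + s • e)‖ ^ 2) := by
    funext s; rw [jm, xC_line ht hx]
  rw [e1]
  refine HasDerivAt.congr_deriv (h) ?_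
  symm
  rw [z0, ← jm]; field_simp

lemma hasD_jb {e ζ : Z n} (ht : tC e = 0) (hx : xC e = 0) : HasDerivAt (fun s : ℝ => jb (ζ + s • e)) (inner ℝ (vC ζ) (vC e) / jb ζ) 0 := by
  have h := ((hasD_normsq ht hx (ζ := ζ)).const_add (1 + (tC ζ ^ 2 + ‖xC ζ‖ ^ 2))).sqrt
    (by positivity)
  have e1 : (fun s : ℝ => jb (ζ + s • e))
      = fun s => √(1 + (tC ζ ^ 2 + ‖xC ζ‖ ^ 2) + ‖vC (ζ + s • e)‖ ^ 2) := by
    funext s; rw [jb, normsq, xC_line ht hx, tC_line ht hx]; congr 1; ring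
  rw [e1]
  refine HasDerivAt.congr_deriv (h) ?_
  symm
  rw [z0, jb, normsq, ← add_assoc 1, ← add_assoc 1]; field_simp

lemma hasD_xe {e ζ : Z n} (ht : tC e = 0) (hx : xC e = 0) : HasDerivAt (fun s : ℝ => xe (ζ + s • e)) (inner ℝ (xC ζ) (vC e)) 0 := by
  have e1 : (fun s : ℝ => xe (ζ + s • e)) = fun s => xe ζ + s * inner ℝ (xC ζ) (vC e) := by
    funext s
    have : vC (ζ + s • e) = vC ζ + s • vC e := rfl
    rw [xe_eq, xe_eq, xC_line ht hx, this, inner_add_right, inner_smul_right]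
  rw [e1]
  simpa using ((hasDerivAt_id (0:ℝ)).mul_const (inner ℝ (xC ζ) (vC e))).const_add (xe ζ)

lemma hasD_th {e ζ : Z n} (ht : tC e = 0) (hx : xC e = 0) (ρ p M : ℝ) {ε : ℝ} (hε : 0 < ε) :
    HasDerivAt (fun s : ℝ => th ρ p M ε (ζ + s • e)) (th ρ p M ε ζ * inner ℝ (vC ζ) (vC e) *
      (ρ / jb ζ ^ 2 + p / jm ζ ^ 2 - 2 * M * ε / (1 + ε * jb ζ ^ 2))) 0 := by
  have hb := jb_pos ζ; have hm := jm_pos ζ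
  have hE : 0 < 1 + ε * jb ζ ^ 2 := by positivity
  have h1 := (hasD_jb ht hx (ζ := ζ)).rpow_const (p := ρ) (Or.inl (by simpa using hb.ne'))
  have h2 := (hasD_jm ht hx (ζ := ζ)).rpow_const (p := p) (Or.inl (by simpa using hm.ne'))
  have h3 := ((((hasD_jb ht hx (ζ := ζ)).pow 2).const_mul ε).const_add 1).rpow_const (p := -M)
    (Or.inl (by simpa using hE.ne'))
  refine HasDerivAt.congr_deriv ((h1.mul h2).mul h3) ?_
  symm
  simp only [zero_smul, add_zero, th, Pi.mul_apply, Pi.pow_apply]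
  rw [Real.rpow_sub_one hb.ne', Real.rpow_sub_one hm.ne', Real.rpow_sub_one hE.ne']
  field_simp
  push_cast
  ring

lemma hasD_gg {e ζ : Z n} (ht : tC e = 0) (hx : xC e = 0) {σ : ℝ} (hσ : 0 < σ) :
    HasDerivAt (fun s : ℝ => gg σ (ζ + s • e))
      (inner ℝ (xC ζ) (vC e) * rr σ ζ ^ (-(2 * σ + 2))
        - 2 * (σ + 1) * xe ζ * inner ℝ (vC ζ) (vC e) * rr σ ζ ^ (-(2 * σ + 2)) / rw0 σ ζ
          * je ζ ^ (4 * σ)) 0 := by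
  have hj := je_pos ζ; have hr := rw0_pos σ ζ
  have h1 := (hasD_je ht hx (ζ := ζ)).rpow_const (p := 2 * (2 * σ + 1))
    (Or.inl (by simpa using hj.ne'))
  have h2 := h1.const_add (1 + ‖xC ζ‖ ^ 2)
  have e1 : ∀ s : ℝ, gg σ (ζ + s • e) = xe (ζ + s • e) *
      (1 + ‖xC ζ‖ ^ 2 + je (ζ + s • e) ^ (2 * (2 * σ + 1))) ^ (-(σ + 1) / (2 * σ + 1)) := by
    intro s
    rw [gg, rr, ← Real.rpow_mul (rw0_pos _ _).le, rw0, xC_line ht hx]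
    congr 2; field_simp
  have e2 : rr σ ζ ^ (-(2 * σ + 2)) = rw0 σ ζ ^ (-(σ + 1) / (2 * σ + 1)) := by
    rw [rr, ← Real.rpow_mul (rw0_pos _ _).le]
    congr 1; field_simp
  have h3 := h2.rpow_const (p := -(σ + 1) / (2 * σ + 1))
    (Or.inl (by simpa [rw0] using hr.ne'))
  have h4 := (hasD_xe ht hx (ζ := ζ)).mul h3
  rw [show (fun s : ℝ => gg σ (ζ + s • e)) = _ from funext e1]
  refine HasDerivAt.congr_deriv (h4) ?_
  symm
  simp only [zero_smul, add_zero]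
  change _ = inner ℝ (xC ζ) (vC e) * rw0 σ ζ ^ (-(σ + 1) / (2 * σ + 1)) +
    xe ζ * (_ * _ * (rw0 σ ζ) ^ (-(σ + 1) / (2 * σ + 1) - 1))
  rw [e2, Real.rpow_sub_one hr.ne', show 2 * (2 * σ + 1) - 1 = 4 * σ + 1 by ring,
    Real.rpow_add_one hj.ne']
  have : 2 * σ + 1 ≠ 0 := by positivity
  field_simp
  ring

/-- derivative of `gg` -/
def dgg (σ : ℝ) (ζ e : Z n) : ℝ := inner ℝ (xC ζ) (vC e) * rr σ ζ ^ (-(2 * σ + 2))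
        - 2 * (σ + 1) * xe ζ * inner ℝ (vC ζ) (vC e) * rr σ ζ ^ (-(2 * σ + 2)) / rw0 σ ζ
          * je ζ ^ (4 * σ)
/-- logarithmic derivative of `th` -/
def lth (ρ p M ε : ℝ) (ζ e : Z n) : ℝ := inner ℝ (vC ζ) (vC e) *
      (ρ / jb ζ ^ 2 + p / jm ζ ^ 2 - 2 * M * ε / (1 + ε * jb ζ ^ 2))

lemma hasD_qq {e ζ : Z n} (ht : tC e = 0) (hx : xC e = 0) (ρ p M κ : ℝ) {ε σ : ℝ} (hσ : 0 < σ) (hε : 0 < ε) :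
    HasDerivAt (fun s : ℝ => qq ρ p M σ κ ε (ζ + s • e))
      (th ρ p M ε ζ ^ 2 * (2 * lth ρ p M ε ζ e * (1 + κ * gg σ ζ) + κ * dgg σ ζ e)) 0 := by
  have h1 := (hasD_th ht hx (ζ := ζ) ρ p M hε).pow 2
  have h2 := ((hasD_gg ht hx (ζ := ζ) hσ).const_mul κ).const_add 1
  refine HasDerivAt.congr_deriv (h1.mul h2) ?_
  symm
  simp only [zero_smul, add_zero, lth, dgg, Pi.mul_apply, Pi.pow_apply]
  push_cast
  ring

/-- unit vectors -/
def eV (i : Fin n) : Z n := EuclideanSpace.single (Sum.inr (Sum.inr i)) 1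
/-- the field `ξ·∂_η` -/
def dv (ζ : Z n) : Z n := ∑ i, xC ζ i • eV i
lemma tC_eV (i : Fin n) : tC (eV i : Z n) = 0 := by simp [tC, eV]
lemma xC_eV (i : Fin n) : xC (eV i : Z n) = 0 := by ext j; simp [xC, eV]
lemma vC_eV (i : Fin n) : vC (eV i : Z n) = EuclideanSpace.single i 1 := by
  ext j; simp [vC, eV, Pi.single_apply]
lemma norm_eV (i : Fin n) : ‖(eV i : Z n)‖ = 1 := by simp [eV]
lemma tC_dv (ζ : Z n) : tC (dv ζ) = 0 := by
  rw [← tL_apply, dv, map_sum]; simp [tC_eV]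
lemma xC_dv (ζ : Z n) : xC (dv ζ) = 0 := by
  rw [← xL_apply, dv, map_sum]; simp [xC_eV]
lemma vC_dv (ζ : Z n) : vC (dv ζ) = xC ζ := by
  rw [← vL_apply, dv, map_sum]
  ext j
  simp [vC_eV, Pi.single_apply]

lemma th_pos (ρ p M : ℝ) {ε : ℝ} (hε : 0 < ε) (ζ : Z n) : 0 < th ρ p M ε ζ := by
  have hb := jb_pos ζ; have hm := jm_pos ζ
  have hE : 0 < 1 + ε * jb ζ ^ 2 := by positivity
  unfold th; positivity

lemma jb_diff : Differentiable ℝ (jb : Z n → ℝ) := by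
  intro ζ
  unfold jb
  exact ((differentiableAt_id.norm_sq ℝ).const_add 1).sqrt (by positivity)
lemma nv_diff : Differentiable ℝ (fun ζ : Z n => ‖vC ζ‖ ^ 2) := fun ζ =>
  ((vL (n := n)).differentiableAt (x := ζ)).norm_sq ℝ
lemma nx_diff : Differentiable ℝ (fun ζ : Z n => ‖xC ζ‖ ^ 2) := fun ζ =>
  ((xL (n := n)).differentiableAt (x := ζ)).norm_sq ℝ
lemma je_diff : Differentiable ℝ (je : Z n → ℝ) := fun ζ =>
  ((nv_diff ζ).const_add 1).sqrt (by positivity)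
lemma jm_diff : Differentiable ℝ (jm : Z n → ℝ) := fun ζ =>
  (((nx_diff ζ).const_add 1).add (nv_diff ζ)).sqrt
    (by have : 0 < 1 + ‖xC ζ‖ ^ 2 + ‖vC ζ‖ ^ 2 := by positivity
        exact this.ne')
lemma xe_diff : Differentiable ℝ (xe : Z n → ℝ) := by
  have : (xe : Z n → ℝ) = fun ζ => inner ℝ (xL ζ) (vL ζ) := funext xe_eq
  rw [this]; exact xL.differentiable.inner ℝ vL.differentiable
lemma th_diff (ρ p M : ℝ) {ε : ℝ} (hε : 0 < ε) : Differentiable ℝ (th ρ p M ε : Z n → ℝ) := by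
  intro ζ
  have hE : 0 < 1 + ε * jb ζ ^ 2 := by positivity
  exact (((jb_diff ζ).rpow_const (Or.inl (jb_pos ζ).ne')).mul
    ((jm_diff ζ).rpow_const (Or.inl (jm_pos ζ).ne'))).mul
    (((((jb_diff ζ).pow 2).const_mul ε).const_add 1).rpow_const (Or.inl hE.ne'))
lemma gg_diff (σ : ℝ) : Differentiable ℝ (gg σ : Z n → ℝ) := by
  intro ζ
  have h1 : DifferentiableAt ℝ (rw0 σ) ζ :=
    ((nx_diff ζ).const_add 1).add ((je_diff ζ).rpow_const (Or.inl (je_pos ζ).ne'))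
  exact (xe_diff ζ).mul ((h1.rpow_const (Or.inl (rw0_pos σ ζ).ne')).rpow_const
    (Or.inl (rr_pos σ ζ).ne'))
lemma qq_diff (ρ p M σ κ : ℝ) {ε : ℝ} (hε : 0 < ε) :
    Differentiable ℝ (qq ρ p M σ κ ε : Z n → ℝ) := fun ζ =>
  ((th_diff ρ p M hε ζ).pow 2).mul (((gg_diff σ ζ).const_mul κ).const_add 1)

lemma fderiv_qq (ρ p M κ : ℝ) {ε σ : ℝ} (hσ : 0 < σ) (hε : 0 < ε) (ζ e : Z n) (ht : tC e = 0)
    (hx : xC e = 0) : fderiv ℝ (qq ρ p M σ κ ε) ζ e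
      = th ρ p M ε ζ ^ 2 * (2 * lth ρ p M ε ζ e * (1 + κ * gg σ ζ) + κ * dgg σ ζ e) := by
  rw [← (qq_diff ρ p M σ κ hε ζ).lineDeriv_eq_fderiv]
  exact (hasD_qq ht hx ρ p M κ hσ hε).deriv

lemma abs_lth (ρ p M : ℝ) {ε : ℝ} (hε : 0 < ε) (ζ e : Z n) (A : ℝ)
    (hA : |inner ℝ (vC ζ) (vC e)| ≤ A * jm ζ ^ 2) : 
    |lth ρ p M ε ζ e| ≤ A * (|ρ| + |p| + 2 * |M|) := by
  have hb := jb_pos ζ; have hm := jm_pos ζ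
  have hE : 0 < 1 + ε * jb ζ ^ 2 := by positivity
  have hmb : jm ζ ^ 2 ≤ jb ζ ^ 2 := by gcongr; exact jm_le_jb ζ
  rw [lth, abs_mul]
  have hA0 : 0 ≤ A := by
    have := (abs_nonneg _).trans hA
    by_contra hh; push Not at hh
    nlinarith [sq_pos_of_pos hm]
  have : |ρ / jb ζ ^ 2 + p / jm ζ ^ 2 - 2 * M * ε / (1 + ε * jb ζ ^ 2)|
      ≤ (|ρ| + |p| + 2 * |M|) / jm ζ ^ 2 := by
    refine (abs_sub _ _).trans ?_
    refine (add_le_add_left (abs_add_le _ _) _).trans ?_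
    rw [abs_div, abs_div, abs_div, abs_of_pos hE, abs_of_pos (show 0 < jb ζ ^ 2 by positivity),
      abs_of_pos (show 0 < jm ζ ^ 2 by positivity), abs_mul, abs_mul, abs_of_pos hε, add_div, add_div]
    gcongr ?_ + _ + ?_
    · gcongr
    · rw [div_le_div_iff₀ hE (by positivity)]
      norm_num
      nlinarith [abs_nonneg M, mul_nonneg (abs_nonneg M) (sub_nonneg.2 hmb),
        mul_nonneg (mul_nonneg (abs_nonneg M) (sub_nonneg.2 hmb)) hε.le]
  calc _ ≤ (A * jm ζ ^ 2) * ((|ρ| + |p| + 2 * |M|) / jm ζ ^ 2) := by gcongr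
    _ = _ := by field_simp

lemma abs_lth_dv (ρ p M : ℝ) {ε : ℝ} (hε : 0 < ε) (ζ : Z n) :
    |lth ρ p M ε ζ (dv ζ)| ≤ |ρ| + |p| + 2 * |M| := by
  have := abs_lth ρ p M hε ζ (dv ζ) 1 (by
    rw [vC_dv]
    refine (abs_real_inner_le_norm _ _).trans ?_
    rw [jm_sq]
    nlinarith [sq_nonneg (‖vC ζ‖ - ‖xC ζ‖)])
  simpa using this

lemma dgg_dv {σ : ℝ} (hσ : 0 < σ) (hσ1 : σ < 1) (ζ : Z n) :
    rr σ ζ ^ (2 * σ) - 6 * je ζ ^ (2 * σ) ≤ dgg σ ζ (dv ζ) := by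
  have hr := rr_pos σ ζ; have hj := je_pos ζ; have hR := rw0_pos σ ζ
  have hjr := je_le_rr hσ ζ
  rw [dgg, vC_dv, real_inner_self_eq_norm_sq]
  set Q := rr σ ζ ^ (-(2 * σ + 2)) with hQ
  have hQ0 : 0 < Q := Real.rpow_pos_of_pos hr _
  have hQj : Q ≤ je ζ ^ (-(2 * σ + 2)) := Real.rpow_le_rpow_of_nonpos hj hjr (by linarith)
  have e1 : rw0 σ ζ * Q = rr σ ζ ^ (2 * σ) := by
    rw [← rr_pow hσ, hQ, ← Real.rpow_add hr]; congr 1; ring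
  have e2 : je ζ ^ (2 * (2 * σ + 1)) * Q ≤ je ζ ^ (2 * σ) := by
    calc _ ≤ je ζ ^ (2 * (2 * σ + 1)) * je ζ ^ (-(2 * σ + 2)) := by gcongr
      _ = _ := by rw [← Real.rpow_add hj]; congr 1; ring
  have e3 : Q ≤ je ζ ^ (2 * σ) := by
    refine hQj.trans (Real.rpow_le_rpow_of_exponent_le (one_le_je ζ) (by linarith))
  have e4 : ‖xC ζ‖ ^ 2 * Q ≥ rr σ ζ ^ (2 * σ) - 2 * je ζ ^ (2 * σ) := by
    have : ‖xC ζ‖ ^ 2 = rw0 σ ζ - 1 - je ζ ^ (2 * (2 * σ + 1)) := by unfold rw0; ring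
    rw [this]; nlinarith
  have e5 : inner ℝ (vC ζ) (xC ζ) = xe ζ := by rw [xe_eq, real_inner_comm]
  rw [e5]
  have e6 : xe ζ * xe ζ ≤ rw0 σ ζ * je ζ ^ 2 := by
    have a := abs_xe ζ
    have b : xe ζ * xe ζ ≤ (‖xC ζ‖ * ‖vC ζ‖) ^ 2 := by
      rw [← sq, ← sq_abs]; gcongr
    refine b.trans ?_
    rw [mul_pow]
    have c1 : ‖xC ζ‖ ^ 2 ≤ rw0 σ ζ := by
      unfold rw0; have := Real.rpow_pos_of_pos hj (2 * (2 * σ + 1)); linarith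
    have c2 : ‖vC ζ‖ ^ 2 ≤ je ζ ^ 2 := by rw [je_sq]; linarith
    gcongr
  have e7 : je ζ ^ 2 * Q * je ζ ^ (4 * σ) ≤ je ζ ^ (2 * σ) := by
    calc je ζ ^ 2 * Q * je ζ ^ (4 * σ) ≤ je ζ ^ 2 * je ζ ^ (-(2 * σ + 2)) * je ζ ^ (4 * σ) := by
          gcongr
      _ = _ := by
        rw [← Real.rpow_natCast, ← Real.rpow_add hj, ← Real.rpow_add hj]; congr 1; push_cast; ring
  have e8 : 2 * (σ + 1) * xe ζ * xe ζ * Q / rw0 σ ζ * je ζ ^ (4 * σ) ≤ 4 * je ζ ^ (2 * σ) := by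
    have h4 : 0 < je ζ ^ (4 * σ) := Real.rpow_pos_of_pos hj _
    calc 2 * (σ + 1) * xe ζ * xe ζ * Q / rw0 σ ζ * je ζ ^ (4 * σ)
        = 2 * (σ + 1) * ((xe ζ * xe ζ) / rw0 σ ζ * Q * je ζ ^ (4 * σ)) := by ring
      _ ≤ 2 * (σ + 1) * (je ζ ^ 2 * Q * je ζ ^ (4 * σ)) := by
          gcongr
          rw [div_le_iff₀ hR]; linarith
      _ ≤ 4 * je ζ ^ (2 * σ) := by
          gcongr; linarith
  linarith

/-- rough bound on partial derivatives -/
lemma abs_dgg_eV {σ : ℝ} (hσ : 0 < σ) (hσ1 : σ < 1) (ζ : Z n) (i : Fin n) :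
    |dgg σ ζ (eV i)| ≤ 5 * jb ζ ^ 3 := by
  have hr := rr_pos σ ζ; have hj := je_pos ζ; have hR := rw0_pos σ ζ
  have hn : ‖vC (eV i : Z n)‖ ≤ 1 := (norm_vC_le _).trans (norm_eV i).le
  have hb := one_le_jb ζ
  have a1 : |inner ℝ (xC ζ) (vC (eV i : Z n))| ≤ jb ζ := by
    refine (abs_real_inner_le_norm _ _).trans ?_
    have := (norm_xC_le ζ).trans (norm_le_jb ζ)
    nlinarith [norm_nonneg (xC ζ)]
  have a2 : |inner ℝ (vC ζ) (vC (eV i : Z n))| ≤ jb ζ := by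
    refine (abs_real_inner_le_norm _ _).trans ?_
    have := (norm_vC_le ζ).trans (norm_le_jb ζ)
    nlinarith [norm_nonneg (vC ζ)]
  have a3 : |xe ζ| ≤ jb ζ ^ 2 := by
    refine (abs_xe ζ).trans ?_
    have := (norm_vC_le ζ).trans (norm_le_jb ζ)
    have := (norm_xC_le ζ).trans (norm_le_jb ζ)
    rw [sq]; gcongr
  have hQ0 : 0 < rr σ ζ ^ (-(2 * σ + 2)) := Real.rpow_pos_of_pos hr _
  have hQ1 : rr σ ζ ^ (-(2 * σ + 2)) ≤ 1 :=
    Real.rpow_le_one_of_one_le_of_nonpos (one_le_rr hσ ζ) (by linarith)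
  have h4 : 0 < je ζ ^ (4 * σ) := Real.rpow_pos_of_pos hj _
  have h5 : je ζ ^ (4 * σ) / rw0 σ ζ ≤ 1 := by
    rw [div_le_one hR]
    have : je ζ ^ (4 * σ) ≤ je ζ ^ (2 * (2 * σ + 1)) :=
      Real.rpow_le_rpow_of_exponent_le (one_le_je ζ) (by linarith)
    unfold rw0; nlinarith [sq_nonneg ‖xC ζ‖]
  rw [dgg]
  refine (abs_sub _ _).trans ?_
  have b1 : |inner ℝ (xC ζ) (vC (eV i : Z n)) * rr σ ζ ^ (-(2 * σ + 2))| ≤ jb ζ := by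
    rw [abs_mul, abs_of_pos hQ0]
    nlinarith [abs_nonneg (inner ℝ (xC ζ) (vC (eV i : Z n)))]
  have b2 : |2 * (σ + 1) * xe ζ * inner ℝ (vC ζ) (vC (eV i : Z n)) * rr σ ζ ^ (-(2 * σ + 2)) / rw0 σ ζ
          * je ζ ^ (4 * σ)| ≤ 4 * jb ζ ^ 3 := by
    have : 2 * (σ + 1) * xe ζ * inner ℝ (vC ζ) (vC (eV i : Z n)) * rr σ ζ ^ (-(2 * σ + 2)) / rw0 σ ζ
          * je ζ ^ (4 * σ) = (2 * (σ + 1)) * (xe ζ * (inner ℝ (vC ζ) (vC (eV i : Z n)) *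
          (rr σ ζ ^ (-(2 * σ + 2)) * (je ζ ^ (4 * σ) / rw0 σ ζ)))) := by ring
    rw [this, abs_mul (2 * (σ + 1)), abs_mul (xe ζ), abs_mul (inner ℝ (vC ζ) (vC (eV i : Z n))),
      abs_of_pos (show 0 < 2 * (σ + 1) by linarith),
      abs_of_nonneg (show 0 ≤ rr σ ζ ^ (-(2 * σ + 2)) * (je ζ ^ (4 * σ) / rw0 σ ζ) by positivity)]
    calc _ ≤ 4 * (jb ζ ^ 2 * (jb ζ * (1 * 1))) := by
          gcongr; linarith
      _ = _ := by ring
  nlinarith [pow_le_pow_right₀ hb (show 1 ≤ 3 by norm_num)]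

end HE

namespace HE

/-! ### weighted symbol classes -/
section classes
variable {V F G : Type*} [NormedAddCommGroup V] [NormedSpace ℝ V] [NormedAddCommGroup F]
  [NormedSpace ℝ F] [NormedAddCommGroup G] [NormedSpace ℝ G]

def Wc (p : V → ℝ) (c : V → F) : Prop :=
  ContDiff ℝ ((⊤ : ℕ∞) : WithTop ℕ∞) c ∧ ∀ j : ℕ, ∃ C : ℝ, ∀ z, ‖iteratedFDeriv ℝ j c z‖ ≤ C * p z

lemma nle (j : ℕ) : (j : WithTop ℕ∞) ≤ ((⊤ : ℕ∞) : WithTop ℕ∞) := by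
  exact_mod_cast (le_top : (j : ℕ∞) ≤ ⊤)

lemma Wc.cont {p : V → ℝ} {c : V → F} (h : Wc p c) : Continuous c := h.1.continuous

lemma Wc.bd {p : V → ℝ} {c : V → F} (h : Wc p c) (h0 : ∀ z, 0 ≤ p z) (j : ℕ) :
    ∃ C : ℝ, 0 ≤ C ∧ ∀ z, ‖iteratedFDeriv ℝ j c z‖ ≤ C * p z := by
  obtain ⟨C, hC⟩ := h.2 j
  exact ⟨|C|, abs_nonneg _, fun z => (hC z).trans (mul_le_mul_of_nonneg_right (le_abs_self _) (h0 z))⟩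

lemma Wc.bd0 {p : V → ℝ} {c : V → F} (h : Wc p c) (h0 : ∀ z, 0 ≤ p z) :
    ∃ C : ℝ, 0 ≤ C ∧ ∀ z, ‖c z‖ ≤ C * p z := by
  simpa using h.bd h0 0

lemma Wc.mono {p q : V → ℝ} {c : V → F} (h : Wc p c) (h0 : ∀ z, 0 ≤ p z) (K : ℝ)
    (hK : ∀ z, p z ≤ K * q z) : Wc q c := by
  refine ⟨h.1, fun j => ?_⟩
  obtain ⟨C, hC, hb⟩ := h.bd h0 j
  exact ⟨C * K, fun z => (hb z).trans (by rw [mul_assoc]; exact mul_le_mul_of_nonneg_left (hK z) hC)⟩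

lemma Wc.add {p : V → ℝ} {c d : V → F} (h : Wc p c) (h' : Wc p d) : Wc p (fun z => c z + d z) := by
  refine ⟨h.1.add h'.1, fun j => ?_⟩
  obtain ⟨C, hC⟩ := h.2 j
  obtain ⟨D, hD⟩ := h'.2 j
  refine ⟨C + D, fun z => ?_⟩
  have := iteratedFDeriv_add_apply (x := z) (i := j) ((h.1.of_le (nle j)).contDiffAt)
    ((h'.1.of_le (nle j)).contDiffAt)
  change ‖iteratedFDeriv ℝ j (c + d) z‖ ≤ _
  rw [this, add_mul]
  exact (norm_add_le _ _).trans (add_le_add (hC z) (hD z))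

lemma Wc.zero {p : V → ℝ} : Wc p (fun _ : V => (0 : F)) :=
  ⟨contDiff_const, fun j => ⟨0, fun z => by
    have : iteratedFDeriv ℝ j (fun _ : V => (0 : F)) = 0 := iteratedFDeriv_fun_zero
    rw [this]; simp⟩⟩

lemma Wc.sum {p : V → ℝ} {ι : Type*} (s : Finset ι) {c : ι → V → F} (h : ∀ i ∈ s, Wc p (c i)) :
    Wc p (fun z => ∑ i ∈ s, c i z) := by
  classical
  induction s using Finset.induction_on with
  | empty => simpa using Wc.zero
  | insert a s ha ih =>
    simp only [Finset.sum_insert ha]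
    exact (h a (Finset.mem_insert_self _ _)).add (ih fun i hi => h i (Finset.mem_insert_of_mem hi))

lemma Wc.clm {p : V → ℝ} {c : V → F} (L : F →L[ℝ] G) (h : Wc p c) : Wc p (fun z => L (c z)) := by
  refine ⟨L.contDiff.comp h.1, fun j => ?_⟩
  obtain ⟨C, hC⟩ := h.2 j
  refine ⟨‖L‖ * C, fun z => ?_⟩
  refine (L.norm_iteratedFDeriv_comp_left h.1.contDiffAt (nle j)).trans ?_
  rw [mul_assoc]; exact mul_le_mul_of_nonneg_left (hC z) (norm_nonneg _)

lemma Wc.fd {p : V → ℝ} {c : V → F} (h : Wc p c) : Wc p (fderiv ℝ c) := by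
  refine ⟨h.1.fderiv_right (m := ((⊤ : ℕ∞) : WithTop ℕ∞)) (by norm_cast), fun j => ?_⟩
  obtain ⟨C, hC⟩ := h.2 (j + 1)
  exact ⟨C, fun z => by rw [norm_iteratedFDeriv_fderiv]; exact hC z⟩

lemma Wc.dir {p : V → ℝ} {c : V → F} (h : Wc p c) (e : V) : Wc p (fun z => fderiv ℝ c z e) :=
  h.fd.clm (ContinuousLinearMap.apply ℝ F e)

lemma Wc.bil {A : Type*} [NormedRing A] [NormedAlgebra ℝ A] {p q : V → ℝ} {c d : V → A}
    (h : Wc p c) (h' : Wc q d) : Wc (fun z => p z * q z) (fun z => c z * d z) := by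
  refine ⟨h.1.mul h'.1, fun j => ?_⟩
  choose C hC using h.2
  choose D hD using h'.2
  refine ⟨∑ i ∈ Finset.range (j + 1), (j.choose i : ℝ) * C i * D (j - i), fun z => ?_⟩
  refine (norm_iteratedFDeriv_mul_le h.1 h'.1 z (nle j)).trans ?_
  rw [Finset.sum_mul]
  refine Finset.sum_le_sum fun i _ => ?_
  have h1 := mul_le_mul (hC i z) (hD (j - i) z) (norm_nonneg _) ((norm_nonneg _).trans (hC i z))
  have h2 := mul_le_mul_of_nonneg_left h1 (Nat.cast_nonneg (α := ℝ) (j.choose i))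
  calc _ = (j.choose i : ℝ) * (‖iteratedFDeriv ℝ i c z‖ * ‖iteratedFDeriv ℝ (j - i) d z‖) := by ring
    _ ≤ _ := h2
    _ = _ := by ring

lemma Wc.const {c : F} : Wc (fun _ : V => 1) (fun _ : V => c) := by
  refine ⟨contDiff_const, fun j => ?_⟩
  rcases Nat.eq_zero_or_pos j with rfl | hj
  · exact ⟨‖c‖, fun z => by simp⟩
  · exact ⟨0, fun z => by rw [iteratedFDeriv_const_of_ne hj.ne']; simp⟩

lemma Wc.cmul {p : V → ℝ} {c : V → ℂ} (h : Wc p c) (a : ℂ) : Wc p (fun z => a * c z) := by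
  have := Wc.bil (Wc.const (V := V) (c := a)) h
  simpa using this

lemma Wc.ofReal {p : V → ℝ} {c : V → ℝ} (h : Wc p c) : Wc p (fun z => (c z : ℂ)) :=
  h.clm Complex.ofRealCLM

lemma Wc.comp {W : Type*} [NormedAddCommGroup W] [NormedSpace ℝ W] {p : V → ℝ} {c : V → F}
    (h : Wc p c) (L : W →L[ℝ] V) : Wc (fun z => p (L z)) (fun z => c (L z)) := by
  refine ⟨h.1.comp L.contDiff, fun j => ?_⟩
  obtain ⟨C, hC⟩ := h.2 j
  refine ⟨C * ‖L‖ ^ j, fun z => ?_⟩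
  change ‖iteratedFDeriv ℝ j (c ∘ L) z‖ ≤ _
  rw [L.iteratedFDeriv_comp_right h.1 z (nle j)]
  refine (ContinuousMultilinearMap.norm_compContinuousLinearMap_le _ _).trans ?_
  simp only [Finset.prod_const, Finset.card_univ, Fintype.card_fin]
  calc _ ≤ (C * p (L z)) * ‖L‖ ^ j := by gcongr; exact hC _
    _ = _ := by ring

lemma Wc.id_clm (L : V →L[ℝ] F) : Wc (fun z : V => 1 + ‖z‖) (fun z => L z) := by
  refine ⟨L.contDiff, fun j => ?_⟩
  match j with
  | 0 => exact ⟨‖L‖, fun z => by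
      simp only [norm_iteratedFDeriv_zero]
      refine (L.le_opNorm z).trans (mul_le_mul_of_nonneg_left (by linarith) (norm_nonneg _))⟩
  | j + 1 =>
    have : fderiv ℝ (fun z => L z) = fun _ => L := by ext1 z; exact L.fderiv
    rcases Nat.eq_zero_or_pos j with rfl | hj
    · exact ⟨‖L‖, fun z => by
        rw [← norm_iteratedFDeriv_fderiv, this]
        simp only [norm_iteratedFDeriv_zero]
        nlinarith [norm_nonneg L, norm_nonneg z]⟩
    · exact ⟨0, fun z => by
        rw [← norm_iteratedFDeriv_fderiv, this, iteratedFDeriv_const_of_ne hj.ne']; simp⟩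

lemma Wc.temperate {p : V → ℝ} {c : V → F} (h : Wc p c) (h0 : ∀ z, 0 ≤ p z) (k : ℕ) (K : ℝ)
    (hK : ∀ z, p z ≤ K * (1 + ‖z‖) ^ k) : c.HasTemperateGrowth := by
  refine ⟨h.1, fun j => ?_⟩
  obtain ⟨C, hC⟩ := (h.mono h0 K hK).2 j
  exact ⟨k, C, hC⟩

lemma cs_bd {c : V → F} (hc : HasCompactSupport c)
    (h : ContDiff ℝ ((⊤ : ℕ∞) : WithTop ℕ∞) c) : Wc (fun _ => 1) c := by
  refine ⟨h, fun j => ?_⟩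
  obtain ⟨C, hC⟩ := (hc.iteratedFDeriv (𝕜 := ℝ) j).exists_bound_of_continuous
    (h.continuous_iteratedFDeriv (nle j))
  exact ⟨C, fun z => by simpa using hC z⟩

end classes

/-! ### powers -/
section powers
variable {V : Type*} [NormedAddCommGroup V] [InnerProductSpace ℝ V]

lemma inner_bd {S : Set V} (hS : IsOpen S) {c : ℝ} (hc : 0 ≤ c) (h1 : ∀ η ∈ S, 1 ≤ c + ‖η‖ ^ 2)
    (m : ℕ) : ∀ η ∈ S, ‖iteratedFDerivWithin ℝ m (fun η : V => innerSL ℝ η) S η‖ ≤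
      (c + ‖η‖ ^ 2) ^ (1 / 2 : ℝ) := by
  intro η hη
  have hp := h1 η hη
  have hone : 1 ≤ (c + ‖η‖ ^ 2) ^ (1 / 2 : ℝ) := Real.one_le_rpow hp (by norm_num)
  match m with
  | 0 =>
    simp only [norm_iteratedFDerivWithin_zero, innerSL_apply_norm]
    rw [← Real.sqrt_eq_rpow]; exact Real.le_sqrt_of_sq_le (by linarith)
  | m + 1 =>
    rw [← norm_iteratedFDerivWithin_fderivWithin hS.uniqueDiffOn hη]
    have : Set.EqOn (fderivWithin ℝ (fun η : V => innerSL ℝ η) S) (fun _ => innerSL ℝ) S := by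
      intro z hz
      exact (innerSL ℝ (E := V)).fderivWithin (hS.uniqueDiffOn z hz)
    rw [iteratedFDerivWithin_congr this hη]
    rcases Nat.eq_zero_or_pos m with rfl | hm
    · simp only [norm_iteratedFDerivWithin_zero]
      exact (norm_innerSL_le ℝ).trans hone
    · rw [iteratedFDerivWithin_const_of_ne hm.ne']
      simp only [Pi.zero_apply, norm_zero]; linarith

lemma pow_cd {S : Set V} {c : ℝ} (h1 : ∀ η ∈ S, 1 ≤ c + ‖η‖ ^ 2) (r : ℝ) :
    ContDiffOn ℝ ((⊤ : ℕ∞) : WithTop ℕ∞) (fun η : V => (c + ‖η‖ ^ 2) ^ r) S := by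
  intro η hη
  refine ContDiffWithinAt.rpow_const_of_ne ?_ (by have := h1 η hη; linarith)
  exact (contDiff_const.add (contDiff_norm_sq ℝ)).contDiffWithinAt

lemma pow_fd {S : Set V} (hS : IsOpen S) {c : ℝ} (h1 : ∀ η ∈ S, 1 ≤ c + ‖η‖ ^ 2) (r : ℝ) :
    Set.EqOn (fderivWithin ℝ (fun η : V => (c + ‖η‖ ^ 2) ^ r) S)
      (fun η => ((c + ‖η‖ ^ 2) ^ (r - 1)) • ((2 * r) • innerSL ℝ η)) S := by
  intro η hη
  have h2 : HasFDerivAt (fun η : V => c + ‖η‖ ^ 2) (2 • innerSL ℝ η) η :=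
    ((hasStrictFDerivAt_norm_sq η).hasFDerivAt).const_add c
  have h3 := h2.rpow_const (p := r) (Or.inl (by have := h1 η hη; linarith))
  rw [h3.hasFDerivWithinAt.fderivWithin (hS.uniqueDiffOn η hη)]
  ext v
  simp
  ring

lemma pow_bd {S : Set V} (hS : IsOpen S) {c : ℝ} (hc : 0 ≤ c) (h1 : ∀ η ∈ S, 1 ≤ c + ‖η‖ ^ 2)
    (j : ℕ) : ∀ r : ℝ, ∃ C : ℝ, 0 ≤ C ∧ ∀ η ∈ S,
      ‖iteratedFDerivWithin ℝ j (fun η : V => (c + ‖η‖ ^ 2) ^ r) S η‖ ≤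
        C * (c + ‖η‖ ^ 2) ^ (if j = 0 then r else r - 1 / 2) := by
  induction j using Nat.strong_induction_on with
  | _ j ih =>
  intro r
  match j with
  | 0 =>
    refine ⟨1, zero_le_one, fun η hη => ?_⟩
    have hp := h1 η hη
    simp only [norm_iteratedFDerivWithin_zero, if_true]
    rw [Real.norm_of_nonneg (Real.rpow_nonneg (by linarith) _), one_mul]
  | j + 1 =>
    have ih' : ∀ i : ℕ, ∃ C : ℝ, 0 ≤ C ∧ (i ≤ j → ∀ η ∈ S,
      ‖iteratedFDerivWithin ℝ i (fun η : V => (c + ‖η‖ ^ 2) ^ (r - 1)) S η‖ ≤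
        C * (c + ‖η‖ ^ 2) ^ (r - 1)) := by
      intro i
      by_cases hi : i ≤ j
      · obtain ⟨C, hC, h⟩ := ih i (Nat.lt_succ_of_le hi) (r - 1)
        refine ⟨C, hC, fun _ η hη => (h η hη).trans ?_⟩
        refine mul_le_mul_of_nonneg_left ?_ hC
        refine Real.rpow_le_rpow_of_exponent_le (h1 η hη) ?_
        split_ifs <;> linarith
      · exact ⟨0, le_rfl, fun h => absurd h hi⟩
    choose C hC0 hC using ih'
    refine ⟨∑ i ∈ Finset.range (j + 1), (j.choose i : ℝ) * C i * |2 * r|,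
      Finset.sum_nonneg fun i _ => by have := hC0 i; positivity, fun η hη => ?_⟩
    have hp := h1 η hη
    rw [← norm_iteratedFDerivWithin_fderivWithin hS.uniqueDiffOn hη,
      iteratedFDerivWithin_congr (pow_fd hS h1 r) hη]
    have hcd : ContDiffOn ℝ ((⊤ : ℕ∞) : WithTop ℕ∞) (fun η : V => (2 * r) • innerSL ℝ η) S :=
      ((innerSL ℝ (E := V)).contDiff.const_smul (2 * r)).contDiffOn
    refine (norm_iteratedFDerivWithin_smul_le (pow_cd h1 (r - 1)) hcd hS.uniqueDiffOn hη (nle j)).trans ?_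
    rw [Finset.sum_mul]
    refine Finset.sum_le_sum fun i hi => ?_
    have hij : i ≤ j := Nat.lt_succ_iff.1 (Finset.mem_range.1 hi)
    have e1 := hC i hij η hη
    have e2 : ‖iteratedFDerivWithin ℝ (j - i) (fun η : V => (2 * r) • innerSL ℝ η) S η‖ ≤
        |2 * r| * (c + ‖η‖ ^ 2) ^ (1 / 2 : ℝ) := by
      have : iteratedFDerivWithin ℝ (j - i) (fun η : V => (2 * r) • innerSL ℝ η) S η =
          (2 * r) • iteratedFDerivWithin ℝ (j - i) (fun η : V => innerSL ℝ η) S η :=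
        iteratedFDerivWithin_const_smul_apply (a := 2 * r) (f := fun η : V => innerSL ℝ η)
          (((innerSL ℝ (E := V)).contDiff).contDiffWithinAt) hS.uniqueDiffOn hη
      rw [this, norm_smul, Real.norm_eq_abs]
      exact mul_le_mul_of_nonneg_left (inner_bd hS hc h1 _ η hη) (abs_nonneg _)
    have e3 := mul_le_mul e1 e2 (norm_nonneg _) ((norm_nonneg _).trans e1)
    have e4 := mul_le_mul_of_nonneg_left e3 (Nat.cast_nonneg (α := ℝ) (j.choose i))
    rw [mul_assoc]
    refine e4.trans (le_of_eq ?_)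
    rw [if_neg (Nat.succ_ne_zero j), show r - 1 / 2 = (r - 1) + 1 / 2 by ring,
      Real.rpow_add (by linarith)]
    ring

lemma pow_wc (r : ℝ) : Wc (fun z : V => (1 + ‖z‖ ^ 2) ^ r) (fun z : V => (1 + ‖z‖ ^ 2) ^ r) := by
  have h1 : ∀ η ∈ (Set.univ : Set V), 1 ≤ 1 + ‖η‖ ^ 2 := fun η _ => by nlinarith [sq_nonneg ‖η‖]
  refine ⟨contDiffOn_univ.1 (pow_cd h1 r), fun j => ?_⟩
  obtain ⟨C, hC, h⟩ := pow_bd isOpen_univ zero_le_one h1 j r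
  refine ⟨C, fun z => ?_⟩
  have := h z (Set.mem_univ _)
  rw [iteratedFDerivWithin_univ] at this
  refine this.trans (mul_le_mul_of_nonneg_left ?_ hC)
  refine Real.rpow_le_rpow_of_exponent_le (h1 z (Set.mem_univ _)) ?_
  split_ifs <;> linarith

end powers

end HE

namespace HE

/-! ### the symbol F -/
section Fs
variable {σ : ℝ} {w : E n → ℝ}

lemma Fsym_cd (hσ0 : 0 < σ) (hw : ContDiff ℝ ((⊤ : ℕ∞) : WithTop ℕ∞) w)
    (hwin : ∀ η : E n, ‖η‖ ≤ 1 → w η = 0) : ContDiff ℝ ((⊤ : ℕ∞) : WithTop ℕ∞) (Fsym σ w) := by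
  rw [contDiff_iff_contDiffAt]
  intro η
  by_cases h : η = 0
  · have : Fsym σ w =ᶠ[nhds η] fun η => ‖η‖ ^ 2 := by
      have : Metric.ball (0 : E n) 1 ∈ nhds η := by rw [h]; exact Metric.ball_mem_nhds _ one_pos
      filter_upwards [this] with z hz
      have : w z = 0 := hwin z (by simpa using (mem_ball_zero_iff.1 hz).le)
      simp [Fsym, this]
    exact ((contDiff_norm_sq ℝ).contDiffAt).congr_of_eventuallyEq this
  · unfold Fsym
    have h1 : ContDiffAt ℝ ((⊤ : ℕ∞) : WithTop ℕ∞) (fun η : E n => ‖η‖ ^ (2 * σ)) η :=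
      (contDiffAt_norm ℝ h).rpow_const_of_ne (norm_ne_zero_iff.2 h)
    exact (h1.mul hw.contDiffAt).add
      (((contDiff_norm_sq ℝ).contDiffAt).mul (contDiffAt_const.sub hw.contDiffAt))

lemma Fsym_out (hwout : ∀ η : E n, 2 ≤ ‖η‖ → w η = 1) {η : E n} (h : 2 ≤ ‖η‖) :
    Fsym σ w η = (0 + ‖η‖ ^ 2) ^ σ := by
  simp only [Fsym, hwout η h, zero_add, mul_one, sub_self, mul_zero, add_zero]
  rw [← Real.rpow_natCast, ← Real.rpow_mul (norm_nonneg _)]; norm_num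

lemma Fsym_bd (hσ0 : 0 < σ) (hw : ContDiff ℝ ((⊤ : ℕ∞) : WithTop ℕ∞) w)
    (hwout : ∀ η : E n, 2 ≤ ‖η‖ → w η = 1)
    (hwin : ∀ η : E n, ‖η‖ ≤ 1 → w η = 0) :
    Wc (fun η : E n => (1 + ‖η‖ ^ 2) ^ ((max (2 * σ - 1) 0) / 2)) (fderiv ℝ (Fsym σ w)) := by
  have hcd := Fsym_cd hσ0 hw hwin
  refine ⟨hcd.fderiv_right (m := ((⊤ : ℕ∞) : WithTop ℕ∞)) (by norm_cast), fun j => ?_⟩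
  set S : Set (E n) := {η | 2 < ‖η‖} with hSdef
  have hS : IsOpen S := isOpen_lt continuous_const continuous_norm
  have h1 : ∀ η ∈ S, 1 ≤ 0 + ‖η‖ ^ 2 := fun η hη => by
    have : 2 < ‖η‖ := hη
    nlinarith
  obtain ⟨C, hC, hb⟩ := pow_bd hS le_rfl h1 (j + 1) σ
  obtain ⟨D, hD⟩ := (isCompact_closedBall (0 : E n) 2).exists_bound_of_continuousOn
    (hcd.continuous_iteratedFDeriv (nle (j + 1))).continuousOn
  refine ⟨max C D, fun η => ?_⟩
  rw [norm_iteratedFDeriv_fderiv]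
  have hbase : (1:ℝ) ≤ 1 + ‖η‖ ^ 2 := by nlinarith [sq_nonneg ‖η‖]
  have hge : (1:ℝ) ≤ (1 + ‖η‖ ^ 2) ^ ((max (2 * σ - 1) 0) / 2) :=
    Real.one_le_rpow hbase (by positivity)
  by_cases hη : 2 < ‖η‖
  · have e1 := hb η hη
    rw [← iteratedFDerivWithin_of_isOpen (j + 1) hS hη]
    have : Set.EqOn (Fsym σ w) (fun η => (0 + ‖η‖ ^ 2) ^ σ) S := fun z hz => by
      have : 2 < ‖z‖ := hz
      exact Fsym_out hwout this.le
    rw [iteratedFDerivWithin_congr this hη]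
    refine e1.trans ?_
    rw [if_neg (Nat.succ_ne_zero j)]
    refine mul_le_mul (le_max_left _ _) ?_ (Real.rpow_nonneg (by positivity) _)
      (hC.trans (le_max_left _ _))
    have e2 := h1 η hη
    calc (0 + ‖η‖ ^ 2) ^ (σ - 1 / 2) ≤ (0 + ‖η‖ ^ 2) ^ ((max (2 * σ - 1) 0) / 2) :=
          Real.rpow_le_rpow_of_exponent_le e2 (by have := le_max_left (2 * σ - 1) 0; linarith)
      _ ≤ _ := Real.rpow_le_rpow (by linarith) (by linarith) (by positivity)
  · push Not at hη
    have := hD η (by simpa using hη)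
    calc _ ≤ D := this
      _ ≤ max C D := le_max_right _ _
      _ = max C D * 1 := by ring
      _ ≤ _ := mul_le_mul_of_nonneg_left hge (hC.trans (le_max_left _ _))

lemma Fsym_diff (hσ0 : 0 < σ) (hσ1 : σ < 1) (hw : ContDiff ℝ ((⊤ : ℕ∞) : WithTop ℕ∞) w)
    (hwout : ∀ η : E n, 2 ≤ ‖η‖ → w η = 1)
    (hwin : ∀ η : E n, ‖η‖ ≤ 1 → w η = 0) :
    ∃ C : ℝ, 0 ≤ C ∧ ∀ η : E n, |Fsym σ w η - (1 + ‖η‖ ^ 2) ^ σ| ≤ C := by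
  have hcd := Fsym_cd hσ0 hw hwin
  have hc2 : Continuous fun η : E n => (1 + ‖η‖ ^ 2) ^ σ :=
    Continuous.rpow_const (by fun_prop) (fun η => Or.inl (by positivity))
  obtain ⟨D, hD⟩ := (isCompact_closedBall (0 : E n) 2).exists_bound_of_continuousOn
    (hcd.continuous.sub hc2).continuousOn
  refine ⟨max D 1, by positivity, fun η => ?_⟩
  by_cases hη : 2 < ‖η‖
  · rw [Fsym_out hwout hη.le, zero_add]
    have h2 : ‖η‖ ^ 2 ≤ 1 + ‖η‖ ^ 2 := by linarith
    have e1 : (‖η‖ ^ 2) ^ σ ≤ (1 + ‖η‖ ^ 2) ^ σ := Real.rpow_le_rpow (by positivity) h2 hσ0.le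
    have e2 : (1 + ‖η‖ ^ 2) ^ σ ≤ 1 ^ σ + (‖η‖ ^ 2) ^ σ :=
      Real.rpow_add_le_add_rpow zero_le_one (by positivity) hσ0.le hσ1.le
    rw [Real.one_rpow] at e2
    rw [abs_sub_comm, abs_of_nonneg (by linarith)]
    exact le_trans (by linarith) (le_max_right _ _)
  · push Not at hη
    exact (hD η (by simpa using hη)).trans (le_max_left _ _)

lemma je_rpow (ζ : Z n) (r : ℝ) : (1 + ‖vC ζ‖ ^ 2) ^ (r / 2) = je ζ ^ r := by
  rw [← je_sq, ← Real.rpow_natCast, ← Real.rpow_mul (je_pos ζ).le]; congr 1; push_cast; ring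
lemma jb_rpow (ζ : Z n) (r : ℝ) : (1 + ‖ζ‖ ^ 2) ^ (r / 2) = jb ζ ^ r := by
  rw [← jb_sq, ← Real.rpow_natCast, ← Real.rpow_mul (jb_pos ζ).le]; congr 1; push_cast; ring

def k0 (σ : ℝ) : ℝ := max (2 * σ - 1) 0
def Fz (σ : ℝ) (w : E n → ℝ) (ζ : Z n) : ℂ := (Fsym σ w (vC ζ) : ℂ)

lemma Fz_cd (hσ0 : 0 < σ) (hw : ContDiff ℝ ((⊤ : ℕ∞) : WithTop ℕ∞) w)
    (hwin : ∀ η : E n, ‖η‖ ≤ 1 → w η = 0) : ContDiff ℝ ((⊤ : ℕ∞) : WithTop ℕ∞) (Fz σ w) :=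
  Complex.ofRealCLM.contDiff.comp ((Fsym_cd hσ0 hw hwin).comp (vL (n := n)).contDiff)

lemma Fz_dir (hσ0 : 0 < σ) (hw : ContDiff ℝ ((⊤ : ℕ∞) : WithTop ℕ∞) w)
    (hwout : ∀ η : E n, 2 ≤ ‖η‖ → w η = 1)
    (hwin : ∀ η : E n, ‖η‖ ≤ 1 → w η = 0) (e : Z n) :
    Wc (fun ζ => je ζ ^ (k0 σ)) (fun ζ => fderiv ℝ (Fz σ w) ζ e) := by
  have h1 := ((Fsym_bd hσ0 hw hwout hwin).comp (vL (n := n))).clm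
    (ContinuousLinearMap.apply ℝ ℝ (vL e))
  have h2 := h1.ofReal
  have : (fun ζ => fderiv ℝ (Fz σ w) ζ e) = fun z => (((ContinuousLinearMap.apply ℝ ℝ (vL e))
      (fderiv ℝ (Fsym σ w) (vL z)) : ℝ) : ℂ) := by
    ext z
    have hd : HasFDerivAt (Fsym σ w) (fderiv ℝ (Fsym σ w) (vL z)) (vL z) :=
      (((Fsym_cd hσ0 hw hwin).differentiable (by simp)) _).hasFDerivAt
    have h3 : HasFDerivAt (Fz σ w) (Complex.ofRealCLM.comp ((fderiv ℝ (Fsym σ w) (vL z)).comp vL)) z :=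
      Complex.ofRealCLM.hasFDerivAt.comp z (hd.comp z vL.hasFDerivAt)
    rw [h3.fderiv]; rfl
  rw [this]
  simpa only [vL_apply, je_rpow, k0] using h2

lemma Fz_diff (hσ0 : 0 < σ) (hσ1 : σ < 1) (hw : ContDiff ℝ ((⊤ : ℕ∞) : WithTop ℕ∞) w)
    (hwout : ∀ η : E n, 2 ≤ ‖η‖ → w η = 1)
    (hwin : ∀ η : E n, ‖η‖ ≤ 1 → w η = 0) :
    ∃ C : ℝ, 0 ≤ C ∧ ∀ ζ : Z n, ‖Fz σ w ζ - ((je ζ ^ (2 * σ) : ℝ) : ℂ)‖ ≤ C := by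
  obtain ⟨C, hC, h⟩ := Fsym_diff hσ0 hσ1 hw hwout hwin
  refine ⟨C, hC, fun ζ => ?_⟩
  have := h (vC ζ)
  rw [show σ = (2 * σ) / 2 by ring, je_rpow] at this
  rw [Fz, ← Complex.ofReal_sub, Complex.norm_real, Real.norm_eq_abs]
  simpa using this

end Fs

/-! ### the coefficient classes -/
def Bk (k : ℝ) (c : Z n → ℂ) : Prop := Wc (fun z => jb z ^ (-k)) c
def Cl (U : Set (ℝ × E n)) (k : ℝ) (c : Z n → ℂ) : Prop :=
  Bk k c ∧ ∃ K : Set (ℝ × E n), IsCompact K ∧ K ⊆ U ∧ ∀ z, c z ≠ 0 → (tC z, xC z) ∈ K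

lemma jbr_pos (z : Z n) (k : ℝ) : 0 < jb z ^ k := Real.rpow_pos_of_pos (jb_pos z) _
lemma jer_pos (z : Z n) (k : ℝ) : 0 < je z ^ k := Real.rpow_pos_of_pos (je_pos z) _

lemma Bk.mono {k l : ℝ} {c : Z n → ℂ} (h : Bk l c) (hkl : k ≤ l) : Bk k c :=
  Wc.mono h (fun z => (jbr_pos z _).le) 1 fun z => by
    rw [one_mul]; exact Real.rpow_le_rpow_of_exponent_le (one_le_jb z) (by linarith)
lemma Bk.mul {k l : ℝ} {c d : Z n → ℂ} (h : Bk k c) (h' : Bk l d) :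
    Bk (k + l) (fun z => c z * d z) := by
  have := Wc.bil h h'
  refine Wc.mono this (fun z => (mul_pos (jbr_pos z _) (jbr_pos z _)).le) 1 fun z => ?_
  rw [← Real.rpow_add (jb_pos z), one_mul, neg_add]
lemma Bk.dir {k : ℝ} {c : Z n → ℂ} (h : Bk k c) (e : Z n) : Bk k (fun z => fderiv ℝ c z e) :=
  Wc.dir h e
lemma Bk.add {k : ℝ} {c d : Z n → ℂ} (h : Bk k c) (h' : Bk k d) : Bk k (fun z => c z + d z) :=
  Wc.add h h'
lemma Bk.sum {k : ℝ} {ι : Type*} (s : Finset ι) {c : ι → Z n → ℂ} (h : ∀ i ∈ s, Bk k (c i)) :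
    Bk k (fun z => ∑ i ∈ s, c i z) := Wc.sum s h
lemma Bk.cmul {k : ℝ} {c : Z n → ℂ} (h : Bk k c) (a : ℂ) : Bk k (fun z => a * c z) := Wc.cmul h a
lemma Bk.const (a : ℂ) : Bk 0 (fun _ : Z n => a) := by
  have := Wc.const (V := Z n) (c := a)
  unfold Bk; simpa using this
lemma Bk.pow (r : ℝ) : Bk (-(2 * r)) (fun z : Z n => (((1 + ‖z‖ ^ 2) ^ r : ℝ) : ℂ)) := by
  have := (pow_wc (V := Z n) r).ofReal
  unfold Bk
  have h2 : (fun z : Z n => jb z ^ (- -(2 * r))) = fun z => (1 + ‖z‖ ^ 2) ^ r := by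
    ext z; rw [← jb_rpow]; congr 1; ring
  rw [h2]; exact this
lemma Bk.coord (L : Z n →L[ℝ] ℝ) : Bk (-1) (fun z : Z n => ((L z : ℝ) : ℂ)) := by
  have := (Wc.id_clm L).ofReal
  refine Wc.mono this (fun z => by positivity) 2 fun z => ?_
  rw [neg_neg, Real.rpow_one]
  linarith [norm_le_jb z, one_le_jb z]
lemma Bk.temp {k : ℝ} {c : Z n → ℂ} (h : Bk k c) : c.HasTemperateGrowth := by
  obtain ⟨m, hm⟩ := exists_nat_ge (-k)
  refine Wc.temperate h (fun z => (jbr_pos z _).le) m 1 fun z => ?_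
  rw [one_mul]
  calc jb z ^ (-k) ≤ jb z ^ (m : ℝ) := Real.rpow_le_rpow_of_exponent_le (one_le_jb z) hm
    _ = jb z ^ m := Real.rpow_natCast _ _
    _ ≤ _ := pow_le_pow_left₀ (jb_pos z).le (jb_le z) m
lemma Bk.cont {k : ℝ} {c : Z n → ℂ} (h : Bk k c) : Continuous c := h.1.continuous
lemma Bk.bd {k : ℝ} {c : Z n → ℂ} (h : Bk k c) : ∃ C : ℝ, 0 ≤ C ∧ ∀ z, ‖c z‖ ≤ C * jb z ^ (-k) :=
  Wc.bd0 h (fun z => (jbr_pos z _).le)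
lemma Bk.diff {k : ℝ} {c : Z n → ℂ} (h : Bk k c) : Differentiable ℝ c := h.1.differentiable (by simp)

lemma Cl.mul {U : Set (ℝ × E n)} {k l : ℝ} {c d : Z n → ℂ} (h : Cl U k c) (h' : Bk l d) :
    Cl U (k + l) (fun z => c z * d z) := by
  obtain ⟨h1, K, hK, hKU, h2⟩ := h
  exact ⟨h1.mul h', K, hK, hKU, fun z hz => h2 z (left_ne_zero_of_mul hz)⟩
lemma Cl.mono {U : Set (ℝ × E n)} {k l : ℝ} {c : Z n → ℂ} (h : Cl U l c) (hkl : k ≤ l) :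
    Cl U k c := ⟨h.1.mono hkl, h.2⟩
lemma Cl.dir {U : Set (ℝ × E n)} {k : ℝ} {c : Z n → ℂ} (h : Cl U k c) (e : Z n) :
    Cl U k (fun z => fderiv ℝ c z e) := by
  obtain ⟨h1, K, hK, hKU, h2⟩ := h
  refine ⟨h1.dir e, K, hK, hKU, fun z hz => ?_⟩
  have hz' : fderiv ℝ c z ≠ 0 := fun h0 => hz (by simp [h0])
  have hz2 : z ∈ tsupport c := support_fderiv_subset ℝ hz'
  have hcl : IsClosed ((fun z : Z n => (tC z, xC z)) ⁻¹' K) :=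
    hK.isClosed.preimage (tC_cont.prodMk xC_cont)
  exact closure_minimal (fun z hz => h2 z hz) hcl hz2
lemma Cl.add {U : Set (ℝ × E n)} {k : ℝ} {c d : Z n → ℂ} (h : Cl U k c) (h' : Cl U k d) :
    Cl U k (fun z => c z + d z) := by
  obtain ⟨h1, K, hK, hKU, h2⟩ := h
  obtain ⟨h1', K', hK', hKU', h2'⟩ := h'
  refine ⟨h1.add h1', K ∪ K', hK.union hK', Set.union_subset hKU hKU', fun z hz => ?_⟩
  by_contra hn
  simp only [Set.mem_union, not_or] at hn
  exact hz (by simp [not_imp_comm.1 (h2 z) hn.1, not_imp_comm.1 (h2' z) hn.2])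
lemma Cl.zero {U : Set (ℝ × E n)} {k : ℝ} : Cl U k (fun _ : Z n => 0) :=
  ⟨Wc.zero, ∅, isCompact_empty, Set.empty_subset _, fun z hz => absurd rfl hz⟩
lemma Cl.sum {U : Set (ℝ × E n)} {k : ℝ} {ι : Type*} (s : Finset ι) {c : ι → Z n → ℂ}
    (h : ∀ i ∈ s, Cl U k (c i)) : Cl U k (fun z => ∑ i ∈ s, c i z) := by
  classical
  induction s using Finset.induction_on with
  | empty => simpa using Cl.zero
  | insert a s ha ih =>
    simp only [Finset.sum_insert ha]
    exact (h a (Finset.mem_insert_self _ _)).add (ih fun i hi => h i (Finset.mem_insert_of_mem hi))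

/-- lift of a function of `(t,x)` -/
def txL : Z n →L[ℝ] ℝ × E n := tL.prod xL
def lift (φ : ℝ × E n → ℝ) (z : Z n) : ℂ := ((φ (tC z, xC z) : ℝ) : ℂ)

lemma lift_cl {U : Set (ℝ × E n)} {φ : ℝ × E n → ℝ} (h : ContDiff ℝ ((⊤ : ℕ∞) : WithTop ℕ∞) φ)
    (hc : HasCompactSupport φ) (hU : tsupport φ ⊆ U) : Cl U 0 (lift φ) := by
  refine ⟨?_, tsupport φ, hc, hU, fun z hz => subset_tsupport _ ?_⟩
  · have := ((cs_bd hc h).comp (txL (n := n))).ofReal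
    have h2 : Wc (fun _ : Z n => (1:ℝ)) (lift φ) := this
    unfold Bk
    simpa using h2
  · simpa [lift] using hz

lemma lift_v_cl {U : Set (ℝ × E n)} {φ : ℝ × E n → ℝ} (h : ContDiff ℝ ((⊤ : ℕ∞) : WithTop ℕ∞) φ)
    (hc : HasCompactSupport φ) (hU : tsupport φ ⊆ U) {k : ℝ} (hk : 0 ≤ k) :
    Cl U k (fun z => ((φ (tC z, xC z) * (1 + ‖vC z‖ ^ 2) ^ (-k / 2) : ℝ) : ℂ)) := by
  refine ⟨?_, tsupport φ, hc, hU, fun z hz => subset_tsupport _ ?_⟩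
  · have h1 : Wc (fun y : ℝ × E n => (1 + ‖y‖ ^ 2) ^ (-k / 2)) φ := by
      refine ⟨h, fun j => ?_⟩
      have hcs := hc.iteratedFDeriv (𝕜 := ℝ) j
      obtain ⟨R, hR0, hR⟩ := hcs.isCompact.isBounded.exists_pos_norm_le
      obtain ⟨C, hC⟩ := hcs.exists_bound_of_continuous (h.continuous_iteratedFDeriv (nle j))
      have hC0 : 0 ≤ C := (norm_nonneg _).trans (hC 0)
      refine ⟨C * (1 + R ^ 2) ^ (k / 2), fun y => ?_⟩
      by_cases hy : y ∈ tsupport (iteratedFDeriv ℝ j φ)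
      · have h3 := hR y hy
        have h4 : (1 + ‖y‖ ^ 2) ^ (k / 2) ≤ (1 + R ^ 2) ^ (k / 2) :=
          Real.rpow_le_rpow (by positivity) (by gcongr) (by positivity)
        have h5 : (1 + ‖y‖ ^ 2) ^ (k / 2) * (1 + ‖y‖ ^ 2) ^ (-k / 2) = 1 := by
          rw [← Real.rpow_add (by positivity)]; simp [neg_div]
        calc _ ≤ C * 1 := by simpa using hC y
          _ = C * ((1 + ‖y‖ ^ 2) ^ (k / 2) * (1 + ‖y‖ ^ 2) ^ (-k / 2)) := by rw [h5]
          _ ≤ C * ((1 + R ^ 2) ^ (k / 2) * (1 + ‖y‖ ^ 2) ^ (-k / 2)) := by gcongr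
          _ = _ := by ring
      · rw [image_eq_zero_of_notMem_tsupport hy, norm_zero]; positivity
    have h2 := ((h1.comp (txL (n := n))).bil ((pow_wc (V := E n) (-k / 2)).comp (vL (n := n)))).ofReal
    refine Wc.mono h2 (fun z => by positivity) (2 ^ (k / 2)) fun z => ?_
    have e1 : (1 + ‖z‖ ^ 2) / 2 ≤ (1 + ‖(txL z)‖ ^ 2) * (1 + ‖vL z‖ ^ 2) := by
      rw [normsq]
      have t1 : |tC z| ≤ ‖txL z‖ := norm_fst_le (txL z)
      have t2 : ‖xC z‖ ≤ ‖txL z‖ := norm_snd_le (txL z)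
      have t3 : tC z ^ 2 ≤ ‖txL z‖ ^ 2 := by rw [← sq_abs]; gcongr
      have t4 : ‖xC z‖ ^ 2 ≤ ‖txL z‖ ^ 2 := by gcongr
      rw [vL_apply]
      nlinarith [mul_nonneg (sq_nonneg ‖txL z‖) (sq_nonneg ‖vC z‖), sq_nonneg ‖vC z‖, sq_nonneg ‖txL z‖]
    rw [← Real.mul_rpow (by positivity) (by positivity), ← jb_rpow]
    calc _ ≤ ((1 + ‖z‖ ^ 2) / 2) ^ (-k / 2) :=
          Real.rpow_le_rpow_of_nonpos (by positivity) e1 (by linarith)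
      _ = _ := by
        rw [Real.div_rpow (by positivity) (by positivity), div_eq_mul_inv, ← Real.rpow_neg (by positivity)]
        rw [show -(-k / 2) = k / 2 by ring]; ring
  · intro h0; simp [h0] at hz

lemma Bk.a {a : Z n → ℝ} (ha : ContDiff ℝ ((⊤ : ℕ∞) : WithTop ℕ∞) a)
    (haB : ∀ k : ℕ, ∃ C : ℝ, ∀ z, ‖iteratedFDeriv ℝ k a z‖ ≤ C) : Bk 0 (fun z => (a z : ℂ)) := by
  have : Wc (fun _ => 1) a := ⟨ha, fun j => by simpa using haB j⟩
  unfold Bk; simpa using this.ofReal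

end HE

namespace HE
open scoped FourierTransform

/-! ### integrability of brackets and Fourier decay -/

lemma finrank_Z : (Module.finrank ℝ (Z n) : ℝ) = 2 * n + 1 := by
  simp [Z]; ring

lemma jb_int {r : ℝ} (hr : 2 * (n:ℝ) + 2 ≤ r) : Integrable (fun z : Z n => jb z ^ (-r)) := by
  have h := integrable_rpow_neg_one_add_norm_sq (E := Z n) (μ := volume) (r := r)
    (by rw [finrank_Z]; linarith)
  simpa only [jb_rpow] using h

lemma jbr_cont (r : ℝ) : Continuous (fun z : Z n => jb z ^ r) :=
  jb_cont.rpow_const fun z => Or.inl (jb_pos z).ne'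
lemma jer_cont (r : ℝ) : Continuous (fun z : Z n => je z ^ r) :=
  je_cont.rpow_const fun z => Or.inl (je_pos z).ne'
lemma jmr_cont (r : ℝ) : Continuous (fun z : Z n => jm z ^ r) :=
  jm_cont.rpow_const fun z => Or.inl (jm_pos z).ne'

lemma Bk.int' {k : ℝ} {c : Z n → ℂ} (h : Bk k c) (p j : ℕ) (hk : 2 * (n:ℝ) + 2 + p ≤ k) :
    Integrable (fun z => ‖z‖ ^ p * ‖iteratedFDeriv ℝ j c z‖) := by
  obtain ⟨C, hC, hb⟩ := Wc.bd h (fun z => (jbr_pos z _).le) j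
  refine Integrable.mono' ((jb_int (n := n) (r := k - p) (by linarith)).const_mul C) ?_ ?_
  · exact ((continuous_norm.pow p).mul (h.1.continuous_iteratedFDeriv (nle j)).norm).aestronglyMeasurable
  · refine Filter.Eventually.of_forall fun z => ?_
    rw [Real.norm_of_nonneg (by positivity)]
    calc _ ≤ jb z ^ p * (C * jb z ^ (-k)) := by
          have := norm_le_jb z; have := (jb_pos z).le
          gcongr; exact hb z
      _ = C * (jb z ^ (p : ℝ) * jb z ^ (-k)) := by rw [Real.rpow_natCast]; ring
      _ = _ := by rw [← Real.rpow_add (jb_pos z)]; congr 2; ring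

lemma Bk.int {k : ℝ} {c : Z n → ℂ} (h : Bk k c) (hk : 2 * (n:ℝ) + 2 ≤ k) : Integrable c := by
  have := h.int' 0 0 (by simpa using hk)
  simp only [pow_zero, norm_iteratedFDeriv_zero, one_mul] at this
  exact (integrable_norm_iff h.cont.aestronglyMeasurable).1 this

lemma decay_of_pow {f : Z n → ℝ} (hf : ∀ z, 0 ≤ f z)
    (h : ∀ m : ℕ, ∃ C : ℝ, ∀ z, ‖z‖ ^ m * f z ≤ C) (L : ℝ) :
    ∃ C : ℝ, 0 ≤ C ∧ ∀ z, f z ≤ C * jb z ^ (-L) := by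
  obtain ⟨m, hm⟩ := exists_nat_ge L
  obtain ⟨C0, hC0⟩ := h 0
  obtain ⟨C1, hC1⟩ := h m
  have hC0' : 0 ≤ C0 := (by have := hf 0; positivity : 0 ≤ ‖(0:Z n)‖ ^ 0 * f 0).trans (hC0 0)
  have hC1' : 0 ≤ C1 := (by have := hf 0; positivity : 0 ≤ ‖(0:Z n)‖ ^ m * f 0).trans (hC1 0)
  refine ⟨2 ^ m * (C0 + C1), by positivity, fun z => ?_⟩
  have e1 : jb z ^ m ≤ 2 ^ m * (1 + ‖z‖ ^ m) := by
    have : jb z ≤ 2 * max 1 ‖z‖ := (jb_le z).trans (by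
      have := le_max_left 1 ‖z‖; have := le_max_right 1 ‖z‖; linarith)
    calc jb z ^ m ≤ (2 * max 1 ‖z‖) ^ m := pow_le_pow_left₀ (jb_pos z).le this m
      _ = 2 ^ m * (max 1 ‖z‖) ^ m := by rw [mul_pow]
      _ ≤ _ := by
        gcongr
        rcases max_cases 1 ‖z‖ with h | h <;> rw [h.1] <;> simp
  have e2 : jb z ^ m * f z ≤ 2 ^ m * (C0 + C1) := by
    calc _ ≤ (2 ^ m * (1 + ‖z‖ ^ m)) * f z := mul_le_mul_of_nonneg_right e1 (hf z)
      _ = 2 ^ m * (‖z‖ ^ 0 * f z + ‖z‖ ^ m * f z) := by rw [pow_zero]; ring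
      _ ≤ _ := by gcongr; exacts [hC0 z, hC1 z]
  have e3 : jb z ^ L ≤ jb z ^ m := by
    rw [← Real.rpow_natCast]; exact Real.rpow_le_rpow_of_exponent_le (one_le_jb z) hm
  rw [Real.rpow_neg (jb_pos z).le, ← div_eq_mul_inv, le_div_iff₀ (jbr_pos z L)]
  calc _ ≤ f z * jb z ^ m := mul_le_mul_of_nonneg_left e3 (hf z)
    _ = jb z ^ m * f z := by ring
    _ ≤ _ := e2

lemma Bk.decay {k : ℝ} {c : Z n → ℂ} (h : Bk k c) (hk : 2 * (n:ℝ) + 2 ≤ k) (L : ℝ) :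
    ∃ C : ℝ, 0 ≤ C ∧ ∀ z, ‖𝓕 c z‖ ≤ C * jb z ^ (-L) := by
  refine decay_of_pow (fun z => norm_nonneg _) (fun m => ?_) L
  have := Real.pow_mul_norm_iteratedFDeriv_fourier_le (f := c) (K := 0) (N := ⊤) h.1
    (fun p j hp _ => h.int' p j (by
      have : p = 0 := by simpa using hp
      subst this; simpa using hk)) (k := 0) (n := m) le_rfl le_top
  simp only [norm_iteratedFDeriv_zero] at this
  exact ⟨_, this⟩

lemma Bk.ddecay {k : ℝ} {c : Z n → ℂ} (h : Bk k c) (hk : 2 * (n:ℝ) + 3 ≤ k) (L : ℝ) :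
    ∃ C : ℝ, 0 ≤ C ∧ ∀ z, ‖fderiv ℝ (𝓕 c) z‖ ≤ C * jb z ^ (-L) := by
  refine decay_of_pow (fun z => norm_nonneg _) (fun m => ?_) L
  have := Real.pow_mul_norm_iteratedFDeriv_fourier_le (f := c) (K := 1) (N := ⊤) h.1
    (fun p j hp _ => h.int' p j (by
      have : p ≤ 1 := by exact_mod_cast hp
      have : (p:ℝ) ≤ 1 := by exact_mod_cast this
      linarith)) (k := 1) (n := m) le_rfl le_top
  simp only [norm_iteratedFDeriv_one] at this
  exact ⟨_, this⟩

lemma Bk.fcont {k : ℝ} {c : Z n → ℂ} (h : Bk k c) (hk : 2 * (n:ℝ) + 2 ≤ k) : Continuous (𝓕 c) :=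
  VectorFourier.fourierIntegral_continuous Real.continuous_fourierChar
    (by exact continuous_inner) (h.int hk)

lemma Bk.fdiff {k : ℝ} {c : Z n → ℂ} (h : Bk k c) (hk : 2 * (n:ℝ) + 3 ≤ k) (z : Z n) :
    HasFDerivAt (𝓕 c) (fderiv ℝ (𝓕 c) z) z ∧
    ∀ e, fderiv ℝ (𝓕 c) z e = 𝓕 (fun y => (-(2 * π * Complex.I) * ((inner ℝ e y : ℝ) : ℂ)) * c y) z := by
  have h1 := h.int (by linarith)
  have h2 : Integrable (fun v => ‖v‖ * ‖c v‖) := by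
    simpa using h.int' 1 0 (by push_cast; linarith)
  have h3 := Real.hasFDerivAt_fourier h1 h2 z
  refine ⟨h3.differentiableAt.hasFDerivAt, fun e => ?_⟩
  rw [h3.fderiv, Real.fourier_continuousLinearMap_apply]
  · refine congrArg (fun f : Z n → ℂ => 𝓕 f z) (funext fun y => ?_)
    have : (innerSL ℝ y) e = inner ℝ e y := by rw [innerSL_apply_apply, real_inner_comm]
    simp [VectorFourier.fourierSMulRight_apply, this]
    ring
  · refine Integrable.mono' ((h2.const_mul (2 * π * ‖innerSL ℝ (E := Z n)‖))) ?_ ?_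
    · exact h.cont.aestronglyMeasurable.fourierSMulRight
    · refine Filter.Eventually.of_forall fun v => ?_
      have := VectorFourier.norm_fourierSMulRight_le (innerSL ℝ (E := Z n)) c v
      calc _ ≤ _ := this
        _ = _ := by ring

/-! ### tempered functions -/

def GI (Y : Z n → ℂ) : Prop :=
  AEStronglyMeasurable Y ∧ ∃ L : ℕ, Integrable (fun ζ => jb ζ ^ (-(L:ℝ)) * ‖Y ζ‖)

lemma peetre_neg (L : ℕ) (a b : Z n) :
    jb (a - b) ^ (-(L:ℝ)) ≤ 2 ^ L * jb a ^ (L:ℝ) * jb b ^ (-(L:ℝ)) := by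
  have h := jb_peetre b a
  rw [jb_sub_comm] at h
  rw [Real.rpow_neg (jb_pos _).le, Real.rpow_neg (jb_pos _).le, ← div_eq_mul_inv,
    le_div_iff₀ (jbr_pos _ _), inv_mul_le_iff₀ (jbr_pos _ _)]
  simp only [Real.rpow_natCast]
  calc jb b ^ L ≤ (2 * jb (a - b) * jb a) ^ L := pow_le_pow_left₀ (jb_pos b).le h L
    _ = _ := by rw [mul_pow, mul_pow]; ring

def Cv (c : Z n → ℂ) (Y : Z n → ℂ) (ζ : Z n) : ℂ := ∫ ζ', 𝓕 c (ζ - ζ') * Y ζ'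

lemma cv_meas {k : ℝ} {c : Z n → ℂ} (h : Bk k c) (hk : 2 * (n:ℝ) + 2 ≤ k) {Y : Z n → ℂ}
    (hY : AEStronglyMeasurable Y) (ζ : Z n) : AEStronglyMeasurable (fun ζ' => 𝓕 c (ζ - ζ') * Y ζ') :=
  (((h.fcont hk).comp (continuous_const.sub continuous_id)).aestronglyMeasurable).mul hY

lemma cv_int {k : ℝ} {c : Z n → ℂ} (h : Bk k c) (hk : 2 * (n:ℝ) + 2 ≤ k) {Y : Z n → ℂ}
    (hY : GI Y) (ζ : Z n) : Integrable (fun ζ' => 𝓕 c (ζ - ζ') * Y ζ') := by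
  obtain ⟨hm, L, hL⟩ := hY
  obtain ⟨C, hC, hb⟩ := h.decay hk L
  refine Integrable.mono' (hL.const_mul (C * (2 ^ L * jb ζ ^ (L:ℝ)))) (cv_meas h hk hm ζ)
    (Filter.Eventually.of_forall fun y => ?_)
  rw [norm_mul]
  calc _ ≤ (C * (2 ^ L * jb ζ ^ (L:ℝ) * jb y ^ (-(L:ℝ)))) * ‖Y y‖ := by
        gcongr; exact (hb _).trans (mul_le_mul_of_nonneg_left (peetre_neg L ζ y) hC)
    _ = _ := by ring

lemma cv_bd {k : ℝ} {c : Z n → ℂ} (h : Bk k c) (hk : 2 * (n:ℝ) + 2 ≤ k) {Y : Z n → ℂ}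
    (hY : GI Y) : ∃ (C : ℝ) (L : ℕ), 0 ≤ C ∧ ∀ ζ, ‖Cv c Y ζ‖ ≤ C * jb ζ ^ (L:ℝ) := by
  obtain ⟨hm, L, hL⟩ := hY
  obtain ⟨C, hC, hb⟩ := h.decay hk L
  have hI : 0 ≤ ∫ ζ, jb ζ ^ (-(L:ℝ)) * ‖Y ζ‖ :=
    integral_nonneg fun ζ => mul_nonneg (jbr_pos _ _).le (norm_nonneg _)
  refine ⟨C * 2 ^ L * ∫ ζ, jb ζ ^ (-(L:ℝ)) * ‖Y ζ‖, L, by positivity, fun ζ => ?_⟩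
  calc ‖Cv c Y ζ‖ ≤ ∫ y, (C * (2 ^ L * jb ζ ^ (L:ℝ))) * (jb y ^ (-(L:ℝ)) * ‖Y y‖) := by
        refine norm_integral_le_of_norm_le (hL.const_mul _) (Filter.Eventually.of_forall fun y => ?_)
        rw [norm_mul]
        calc _ ≤ (C * (2 ^ L * jb ζ ^ (L:ℝ) * jb y ^ (-(L:ℝ)))) * ‖Y y‖ := by
              gcongr; exact (hb _).trans (mul_le_mul_of_nonneg_left (peetre_neg L ζ y) hC)
          _ = _ := by ring
    _ = _ := by rw [integral_const_mul]; ring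

lemma cv_fd {k : ℝ} {c : Z n → ℂ} (h : Bk k c) (hk : 2 * (n:ℝ) + 3 ≤ k) {Y : Z n → ℂ}
    (hY : GI Y) (ζ : Z n) : DifferentiableAt ℝ (Cv c Y) ζ ∧
    ∀ e, fderiv ℝ (Cv c Y) ζ e =
      Cv (fun y => (-(2 * π * Complex.I) * ((inner ℝ e y : ℝ) : ℂ)) * c y) Y ζ := by
  have hk2 : 2 * (n:ℝ) + 2 ≤ k := by linarith
  have hY' := hY
  obtain ⟨hm, L, hL⟩ := hY
  obtain ⟨C, hC, hb⟩ := h.ddecay hk L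
  have hfc : Continuous (fderiv ℝ (𝓕 c)) := by
    have : ContDiff ℝ 1 (𝓕 c) := by
      refine Real.contDiff_fourier (N := 1) fun p hp => ?_
      have : p ≤ 1 := by exact_mod_cast hp
      have h2 : (p:ℝ) ≤ 1 := by exact_mod_cast this
      simpa using h.int' p 0 (by linarith)
    exact this.continuous_fderiv (by simp)
  set F' : Z n → Z n → (Z n →L[ℝ] ℂ) := fun x y =>
    Y y • fderiv ℝ (𝓕 c) (x - y) with hF'
  have key : HasFDerivAt (Cv c Y) (∫ y, F' ζ y) ζ := by
    refine hasFDerivAt_integral_of_dominated_of_fderiv_le (F := fun x y => 𝓕 c (x - y) * Y y)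
      (F' := F') (bound := fun y => (C * (2 ^ L * (2 * 2 * jb ζ) ^ (L:ℝ))) * (jb y ^ (-(L:ℝ)) * ‖Y y‖))
      (Metric.ball_mem_nhds ζ one_pos) (Filter.Eventually.of_forall fun x => cv_meas h hk2 hm x)
      (cv_int h hk2 hY' ζ) ?_ ?_ (hL.const_mul _) ?_
    · exact hm.smul ((hfc.comp (continuous_const.sub continuous_id)).aestronglyMeasurable)
    · refine Filter.Eventually.of_forall fun y x hx => ?_
      simp only [hF', norm_smul]
      have hx' : jb x ≤ 2 * 2 * jb ζ := by
        have h1 := jb_peetre x ζ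
        have h2 : jb (x - ζ) ≤ 2 := (jb_le _).trans (by
          have := mem_ball_iff_norm.1 hx; linarith)
        nlinarith [jb_pos ζ]
      have hx2 : jb x ^ (L:ℝ) ≤ (2 * 2 * jb ζ) ^ (L:ℝ) :=
        Real.rpow_le_rpow (jb_pos x).le hx' (by positivity)
      have h3 := (hb (x - y)).trans (mul_le_mul_of_nonneg_left (peetre_neg L x y) hC)
      have := (jbr_pos y (-(L:ℝ))).le
      calc _ ≤ ‖Y y‖ * (C * (2 ^ L * jb x ^ (L:ℝ) * jb y ^ (-(L:ℝ)))) := by gcongr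
        _ ≤ ‖Y y‖ * (C * (2 ^ L * (2 * 2 * jb ζ) ^ (L:ℝ) * jb y ^ (-(L:ℝ)))) := by gcongr
        _ = _ := by ring
    · refine Filter.Eventually.of_forall fun y x _ => ?_
      have h1 : HasFDerivAt (fun x => 𝓕 c (x - y)) (fderiv ℝ (𝓕 c) (x - y)) x := by
        exact (hasFDerivAt_comp_sub y).2 (h.fdiff hk (x - y)).1
      exact h1.mul_const (Y y)
  refine ⟨key.differentiableAt, fun e => ?_⟩
  rw [key.fderiv]
  have hIntg : Integrable (fun y => F' ζ y) := by
    refine Integrable.mono' (hL.const_mul (C * (2 ^ L * jb ζ ^ (L:ℝ))))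
      (hm.smul ((hfc.comp (continuous_const.sub continuous_id)).aestronglyMeasurable))
      (Filter.Eventually.of_forall fun y => ?_)
    simp only [hF', norm_smul]
    have h3 := (hb (ζ - y)).trans (mul_le_mul_of_nonneg_left (peetre_neg L ζ y) hC)
    calc _ ≤ ‖Y y‖ * (C * (2 ^ L * jb ζ ^ (L:ℝ) * jb y ^ (-(L:ℝ)))) := by gcongr
      _ = _ := by ring
  rw [ContinuousLinearMap.integral_apply hIntg]
  unfold Cv
  congr 1
  ext y
  simp only [hF']
  rw [← (h.fdiff hk (ζ - y)).2 e]
  simp [mul_comm]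

lemma cv_cont {k : ℝ} {c : Z n → ℂ} (h : Bk k c) (hk : 2 * (n:ℝ) + 3 ≤ k) {Y : Z n → ℂ}
    (hY : GI Y) : Continuous (Cv c Y) :=
  continuous_iff_continuousAt.2 fun ζ => (cv_fd h hk hY ζ).1.continuousAt

lemma GI.of_bd {Y : Z n → ℂ} (hm : AEStronglyMeasurable Y) {C r : ℝ}
    (h : ∀ ζ, ‖Y ζ‖ ≤ C * jb ζ ^ r) : GI Y := by
  obtain ⟨L, hL⟩ := exists_nat_ge (r + (2 * n + 2))
  have hC : 0 ≤ C := by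
    have h0 := (norm_nonneg _).trans (h 0)
    simpa [jb_zero] using h0
  refine ⟨hm, L, Integrable.mono' ((jb_int (n := n) le_rfl).const_mul C)
    ((jbr_cont _).aestronglyMeasurable.mul hm.norm) (Filter.Eventually.of_forall fun ζ => ?_)⟩
  have := (jbr_pos ζ (-(L:ℝ))).le
  rw [Real.norm_of_nonneg (by positivity)]
  calc _ ≤ jb ζ ^ (-(L:ℝ)) * (C * jb ζ ^ r) := by gcongr; exact h ζ
    _ = C * jb ζ ^ (-(L:ℝ) + r) := by rw [Real.rpow_add (jb_pos ζ)]; ring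
    _ ≤ _ := by gcongr; exacts [one_le_jb ζ, by linarith]

lemma GI.mul_bd {Y m : Z n → ℂ} (hY : GI Y) (hm : AEStronglyMeasurable m) {C r : ℝ}
    (h : ∀ ζ, ‖m ζ‖ ≤ C * jb ζ ^ r) : GI (fun ζ => m ζ * Y ζ) := by
  obtain ⟨hYm, L, hL⟩ := hY
  obtain ⟨L', hL'⟩ := exists_nat_ge (L + r)
  have hC : 0 ≤ C := by
    have h0 := (norm_nonneg _).trans (h 0)
    simpa [jb_zero] using h0
  refine ⟨hm.mul hYm, L', Integrable.mono' (hL.const_mul C)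
    ((jbr_cont _).aestronglyMeasurable.mul (hm.mul hYm).norm) (Filter.Eventually.of_forall fun ζ => ?_)⟩
  have := (jbr_pos ζ (-(L':ℝ))).le
  rw [Real.norm_of_nonneg (by positivity), norm_mul]
  calc _ ≤ jb ζ ^ (-(L':ℝ)) * (C * jb ζ ^ r * ‖Y ζ‖) := by gcongr; exact h ζ
    _ = C * (jb ζ ^ (-(L':ℝ) + r) * ‖Y ζ‖) := by rw [Real.rpow_add (jb_pos ζ)]; ring
    _ ≤ _ := by gcongr; exacts [one_le_jb ζ, by linarith]

lemma cv_GI {k : ℝ} {c : Z n → ℂ} (h : Bk k c) (hk : 2 * (n:ℝ) + 3 ≤ k) {Y : Z n → ℂ}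
    (hY : GI Y) : GI (Cv c Y) := by
  obtain ⟨C, L, hC, hb⟩ := cv_bd h (by linarith) hY
  exact GI.of_bd (cv_cont h hk hY).aestronglyMeasurable hb

lemma GI.of_L2 {Y : Z n → ℂ} (hm : AEStronglyMeasurable Y) {r : ℝ}
    (h : MemLp (fun ζ => jb ζ ^ r * ‖Y ζ‖) 2) : GI Y := by
  obtain ⟨L, hL⟩ := exists_nat_ge ((n:ℝ) + 1 - r)
  refine ⟨hm, L, ?_⟩
  have h2 : MemLp (fun ζ : Z n => jb ζ ^ (-((n:ℝ) + 1))) 2 := by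
    rw [memLp_two_iff_integrable_sq (jbr_cont _).aestronglyMeasurable]
    refine (jb_int (n := n) (r := 2 * n + 2) le_rfl).congr (Filter.Eventually.of_forall fun ζ => ?_)
    simp only
    rw [← Real.rpow_natCast, ← Real.rpow_mul (jb_pos ζ).le]; congr 1; push_cast; ring
  refine Integrable.mono' (h2.integrable_mul h) ((jbr_cont _).aestronglyMeasurable.mul hm.norm)
    (Filter.Eventually.of_forall fun ζ => ?_)
  have := (jbr_pos ζ (-(L:ℝ))).le
  rw [Real.norm_of_nonneg (by positivity)]
  simp only [Pi.mul_apply]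
  rw [← mul_assoc, ← Real.rpow_add (jb_pos ζ)]
  gcongr; exacts [one_le_jb ζ, by linarith]

end HE

namespace HE
open scoped FourierTransform

/-! ### convolution identities -/

lemma inv_adj {f g : Z n → ℂ} (hf : Integrable f) (hg : Integrable g) :
    ∫ ζ, 𝓕⁻ f ζ * g ζ = ∫ x, f x * 𝓕⁻ g x := by
  have := VectorFourier.integral_fourierIntegral_smul_eq_flip (L := -innerₗ (Z n)) (μ := volume)
    (ν := volume) (f := f) (g := g) Real.continuous_fourierChar
    (by simp only [LinearMap.neg_apply]; exact (continuous_inner (𝕜 := ℝ)).neg) hf hg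
  simp only [smul_eq_mul] at this
  refine this.trans ?_
  congr 1
  ext x
  congr 1
  rw [Real.fourierInv_eq]
  simp [VectorFourier.fourierIntegral, real_inner_comm]

lemma FC {c φ : Z n → ℂ} (hc : Integrable c) (hφ : Integrable φ) (ζ : Z n) :
    ∫ y, 𝓕 c (ζ - y) * φ y = 𝓕 (fun x => c x * 𝓕⁻ φ x) ζ := by
  have h1 : ∀ y, 𝓕 c (ζ - y) = 𝓕⁻ (fun x => (Real.fourierChar (-(inner ℝ x ζ)) : ℂ) * c x) y := by
    intro y
    rw [Real.fourier_eq, Real.fourierInv_eq]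
    congr 1
    ext x
    simp only [Circle.smul_def, smul_eq_mul]
    rw [← mul_assoc, ← Circle.coe_mul, ← AddChar.map_add_eq_mul]
    congr 3
    rw [inner_sub_right]; ring
  have h2 : Integrable (fun x => (Real.fourierChar (-(inner ℝ x ζ)) : ℂ) * c x) := by
    have := (Real.fourierIntegral_convergent_iff ζ).2 hc
    simpa only [Circle.smul_def, smul_eq_mul] using this
  simp_rw [h1]
  rw [inv_adj h2 hφ, Real.fourier_eq]
  congr 1
  ext x
  simp only [Circle.smul_def, smul_eq_mul]
  ring

lemma Bk.fint {k : ℝ} {c : Z n → ℂ} (h : Bk k c) (hk : 2 * (n:ℝ) + 2 ≤ k) : Integrable (𝓕 c) := by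
  obtain ⟨C, hC, hb⟩ := h.decay hk (2 * n + 2)
  exact Integrable.mono' ((jb_int le_rfl).const_mul C) (h.fcont hk).aestronglyMeasurable
    (Filter.Eventually.of_forall hb)

lemma Bk.finv {k : ℝ} {c : Z n → ℂ} (h : Bk k c) (hk : 2 * (n:ℝ) + 2 ≤ k) : 𝓕⁻ (𝓕 c) = c :=
  Continuous.fourierInv_fourier_eq h.cont (h.int hk) (h.fint hk)

lemma cv_swap {k : ℝ} {q : Z n → ℂ} (h : Bk k q) (hk : 2 * (n:ℝ) + 2 ≤ k) {Y g : Z n → ℂ}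
    (hY : GI Y) (hgm : AEStronglyMeasurable g)
    (hg : ∀ L : ℕ, Integrable (fun ζ => jb ζ ^ (L:ℝ) * ‖g ζ‖)) :
    ∫ ζ, g ζ * Cv q Y ζ = ∫ ζ', (∫ ζ, g ζ * 𝓕 q (ζ - ζ')) * Y ζ' := by
  obtain ⟨hm, L, hL⟩ := hY
  obtain ⟨C, hC, hb⟩ := h.decay hk L
  have e1 : ∀ ζ, g ζ * Cv q Y ζ = ∫ ζ', g ζ * 𝓕 q (ζ - ζ') * Y ζ' := by
    intro ζ; rw [Cv, ← integral_const_mul]; simp only [mul_assoc]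
  have e2 : ∀ ζ', (∫ ζ, g ζ * 𝓕 q (ζ - ζ')) * Y ζ' = ∫ ζ, g ζ * 𝓕 q (ζ - ζ') * Y ζ' := by
    intro ζ; rw [← integral_mul_const]
  simp_rw [e1, e2]
  refine integral_integral_swap ?_
  refine Integrable.mono' (((hg L).mul_prod hL).const_mul (C * 2 ^ L)) ?_
    (Filter.Eventually.of_forall fun p => ?_)
  · refine (hgm.comp_fst.mul ?_).mul hm.comp_snd
    exact ((h.fcont hk).comp (continuous_fst.sub continuous_snd)).aestronglyMeasurable
  · simp only [Function.uncurry]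
    rw [norm_mul, norm_mul]
    calc _ ≤ ‖g p.1‖ * (C * (2 ^ L * jb p.1 ^ (L:ℝ) * jb p.2 ^ (-(L:ℝ)))) * ‖Y p.2‖ := by
          gcongr; exact (hb _).trans (mul_le_mul_of_nonneg_left (peetre_neg L _ _) hC)
      _ = _ := by ring

/-- composition of convolutions -/
lemma B2 {k l : ℝ} {b q : Z n → ℂ} (hb : Bk k b) (hk : 2 * (n:ℝ) + 2 ≤ k)
    (hq : Bk l q) (hl : 2 * (n:ℝ) + 2 ≤ l) {Y : Z n → ℂ} (hY : GI Y) (ζ : Z n) :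
    Cv b (Cv q Y) ζ = Cv (fun z => b z * q z) Y ζ := by
  rw [Cv, cv_swap hq hl hY (g := fun ζ' => 𝓕 b (ζ - ζ'))]
  · rw [Cv]
    congr 1
    ext y
    congr 1
    have e : ∫ ζ', 𝓕 b (ζ - ζ') * 𝓕 q (ζ' - y) = ∫ x, 𝓕 b ((ζ - y) - x) * 𝓕 q x := by
      rw [← integral_add_right_eq_self _ y]
      congr 1; ext x
      rw [add_sub_cancel_right, show ζ - (x + y) = ζ - y - x by abel]
    rw [e, FC (hb.int hk) (hq.fint hl), hq.finv hl]
  · exact ((hb.fcont hk).comp (continuous_const.sub continuous_id)).aestronglyMeasurable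
  · intro L
    have h1 : GI (fun ζ : Z n => ((jb ζ ^ (L:ℝ) : ℝ) : ℂ)) :=
      GI.of_bd (Complex.continuous_ofReal.comp (jbr_cont _)).aestronglyMeasurable (C := 1) (r := L)
        (fun ζ => by
          rw [Complex.norm_real, Real.norm_of_nonneg (jbr_pos _ _).le, one_mul])
    have h2 := (cv_int hb hk h1 ζ).norm
    refine h2.congr (Filter.Eventually.of_forall fun y => ?_)
    simp only [norm_mul]
    rw [Complex.norm_real, Real.norm_of_nonneg (jbr_pos _ _).le, mul_comm]

lemma schwartz_jb (g : SchwartzMap (Z n) ℂ) (L : ℕ) : Integrable (fun ζ => jb ζ ^ (L:ℝ) * ‖g ζ‖) := by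
  have h1 : Integrable (fun ζ => 2 ^ L * (‖ζ‖ ^ 0 * ‖g ζ‖ + ‖ζ‖ ^ L * ‖g ζ‖)) :=
    ((g.integrable_pow_mul volume 0).add (g.integrable_pow_mul volume L)).const_mul _
  refine Integrable.mono' h1 ((jbr_cont _).mul g.continuous.norm).aestronglyMeasurable
    (Filter.Eventually.of_forall fun ζ => ?_)
  rw [Real.norm_of_nonneg (mul_nonneg (jbr_pos _ _).le (norm_nonneg _)), Real.rpow_natCast]
  have : jb ζ ≤ 2 * max 1 ‖ζ‖ := (jb_le ζ).trans (by
    have := le_max_left 1 ‖ζ‖; have := le_max_right 1 ‖ζ‖; linarith)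
  have e1 : jb ζ ^ L ≤ 2 ^ L * (1 + ‖ζ‖ ^ L) := by
    calc jb ζ ^ L ≤ (2 * max 1 ‖ζ‖) ^ L := pow_le_pow_left₀ (jb_pos ζ).le this L
      _ = 2 ^ L * (max 1 ‖ζ‖) ^ L := by rw [mul_pow]
      _ ≤ _ := by
        gcongr
        rcases max_cases 1 ‖ζ‖ with h | h <;> rw [h.1] <;> simp
  calc _ ≤ 2 ^ L * (1 + ‖ζ‖ ^ L) * ‖g ζ‖ := by gcongr
    _ = _ := by rw [pow_zero]; ring

/-- multiplication by `c` becomes convolution -/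
lemma B3 {k : ℝ} {c : Z n → ℂ} (h : Bk k c) (hk : 2 * (n:ℝ) + 2 ≤ k) {Y : Z n → ℂ} (hY : GI Y)
    (ψ : SchwartzMap (Z n) ℂ) :
    pairing Y (fun z => c z * ψ z) = pairing (Cv c Y) ψ := by
  unfold pairing
  have e1 : (fun ζ => Cv c Y ζ * 𝓕⁻ (⇑ψ) ζ) = fun ζ => (𝓕⁻ ψ) ζ * Cv c Y ζ := by
    ext ζ; rw [← SchwartzMap.fourierInv_coe, mul_comm]
  rw [e1, cv_swap h hk hY (𝓕⁻ ψ).continuous.aestronglyMeasurable (fun L => schwartz_jb _ L)]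
  congr 1
  ext y
  rw [mul_comm]
  congr 1
  have hψ : 𝓕⁻ (fun x => 𝓕 ψ x) = ⇑ψ := by
    rw [← SchwartzMap.fourierInv_coe, FourierTransform.fourierInv_fourier_eq]
  rw [Real.fourierInv_eq_fourier_neg]
  have := FC (h.int hk) (φ := fun x => 𝓕 ψ x) (SchwartzMap.integrable (𝓕 ψ)) (-y)
  rw [hψ] at this
  rw [← this, ← integral_neg_eq_self]
  congr 1
  ext x
  rw [SchwartzMap.fourierInv_coe, Real.fourierInv_eq_fourier_neg, SchwartzMap.fourier_coe, mul_comm]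
  rw [show -y - -x = x - y by abel]

/-! ### Young's inequality -/

def HH (X : Z n → ℝ) (ζ : Z n) : ℝ := ∫ ζ', jb (ζ - ζ') ^ (-(2 * (n:ℝ) + 2)) * X ζ'

lemma jbk_int (ζ : Z n) : Integrable (fun ζ' => jb (ζ - ζ') ^ (-(2 * (n:ℝ) + 2))) :=
  (jb_int (n := n) le_rfl).comp_sub_left ζ

lemma hh_int {X : Z n → ℝ} (hX : MemLp X 2) (ζ : Z n) :
    Integrable (fun ζ' => jb (ζ - ζ') ^ (-(2 * (n:ℝ) + 2)) * X ζ') := by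
  have hc : Continuous fun ζ' => jb (ζ - ζ') ^ (-(2 * (n:ℝ) + 2)) :=
    (jbr_cont _).comp (continuous_const.sub continuous_id)
  refine MemLp.integrable_mul (p := 2) (q := 2) ?_ hX
  rw [memLp_two_iff_integrable_sq hc.aestronglyMeasurable]
  refine Integrable.mono' (jbk_int ζ) (hc.pow 2).aestronglyMeasurable
    (Filter.Eventually.of_forall fun y => ?_)
  rw [Real.norm_of_nonneg (by positivity)]
  have h1 : jb (ζ - y) ^ (-(2 * (n:ℝ) + 2)) ≤ 1 :=
    Real.rpow_le_one_of_one_le_of_nonpos (one_le_jb _) (by linarith [n.cast_nonneg (α := ℝ)])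
  have h0 := (jbr_pos (ζ - y) (-(2 * (n:ℝ) + 2))).le
  nlinarith

lemma hh_nonneg {X : Z n → ℝ} (hX : ∀ ζ, 0 ≤ X ζ) (ζ : Z n) : 0 ≤ HH X ζ :=
  integral_nonneg fun y => mul_nonneg (jbr_pos _ _).le (hX y)

lemma hh_L2 {X : Z n → ℝ} (h0 : ∀ ζ, 0 ≤ X ζ) (hX : MemLp X 2) : MemLp (HH X) 2 := by
  set w : Z n → ℝ := fun z => jb z ^ (-(2 * (n:ℝ) + 2)) with hw
  have hwc : Continuous w := jbr_cont _
  have hw0 : ∀ z, 0 < w z := fun z => jbr_pos _ _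
  have hm : AEStronglyMeasurable (HH X) := by
    have : AEStronglyMeasurable (fun p : Z n × Z n => w (p.1 - p.2) * X p.2) (volume.prod volume) :=
      ((hwc.comp (continuous_fst.sub continuous_snd)).aestronglyMeasurable).mul hX.1.comp_snd
    exact this.integral_prod_right'
  have hX2 : Integrable (fun ζ => X ζ ^ 2) := (memLp_two_iff_integrable_sq hX.1).1 hX
  rw [memLp_two_iff_integrable_sq hm]
  have hconv : Integrable (fun ζ => ∫ y, w (ζ - y) * X y ^ 2) := by
    have := Integrable.integrable_convolution (L := ContinuousLinearMap.mul ℝ ℝ) (μ := volume) hX2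
      (jb_int (n := n) le_rfl)
    refine this.congr (Filter.Eventually.of_forall fun ζ => ?_)
    simp only [convolution, ContinuousLinearMap.mul_apply']
    congr 1; ext y; rw [mul_comm]
  set I := ∫ z, w z with hI
  refine Integrable.mono' (hconv.const_mul I) (hm.pow 2) (Filter.Eventually.of_forall fun ζ => ?_)
  rw [Real.norm_of_nonneg (sq_nonneg _)]
  have hws : ∀ y, 0 ≤ w (ζ - y) := fun y => (hw0 _).le
  have hwsc : Continuous fun y => w (ζ - y) := hwc.comp (continuous_const.sub continuous_id)
  have hsI : ∫ y, w (ζ - y) = I := integral_sub_left_eq_self w volume ζ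
  by_cases hIntg : Integrable (fun y => w (ζ - y) * X y ^ 2)
  · -- quadratic discriminant argument
    have hI1 : Integrable (fun y => w (ζ - y) * X y) := hh_int hX ζ
    have hquad : ∀ t : ℝ, 0 ≤ (∫ y, w (ζ - y) * X y ^ 2) * (t * t) + (-2 * HH X ζ) * t + I := by
      intro t
      have : (∫ y, w (ζ - y) * X y ^ 2) * (t * t) + (-2 * HH X ζ) * t + I =
          ∫ y, w (ζ - y) * (t * X y - 1) ^ 2 := by
        have e : (fun y => w (ζ - y) * (t * X y - 1) ^ 2) =
            fun y => ((t * t) * (w (ζ - y) * X y ^ 2) + (-2 * t) * (w (ζ - y) * X y)) + w (ζ - y) := by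
          ext y; ring
        have i1 : Integrable (fun y => (t * t) * (w (ζ - y) * X y ^ 2)) := hIntg.const_mul _
        have i2 : Integrable (fun y => (-2 * t) * (w (ζ - y) * X y)) := hI1.const_mul _
        have i12 : Integrable (fun y => (t * t) * (w (ζ - y) * X y ^ 2) + (-2 * t) * (w (ζ - y) * X y)) :=
          i1.add i2
        have i3 : Integrable (fun y => w (ζ - y)) := jbk_int ζ
        rw [e, integral_add i12 i3, integral_add i1 i2, integral_const_mul, integral_const_mul, hsI]
        simp only [HH, hw]; ring
      rw [this]
      exact integral_nonneg fun y => mul_nonneg (hws y) (sq_nonneg _)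
    have := discrim_le_zero hquad
    rw [discrim] at this
    nlinarith
  · exfalso; apply hIntg
    refine Integrable.mono' hX2 (hwsc.aestronglyMeasurable.mul hX2.1) (Filter.Eventually.of_forall fun y => ?_)
    rw [Real.norm_of_nonneg (mul_nonneg (hws y) (sq_nonneg _))]
    have h1 : w (ζ - y) ≤ 1 :=
      Real.rpow_le_one_of_one_le_of_nonpos (one_le_jb _) (by linarith [n.cast_nonneg (α := ℝ)])
    nlinarith [sq_nonneg (X y)]

/-- kernel lemma -/
lemma ker_bd {k : ℝ} {c : Z n → ℂ} (h : Bk k c) (hk : 2 * (n:ℝ) + 2 ≤ k) (C : ℝ) (M : ℕ) :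
    ∃ C' : ℝ, 0 ≤ C' ∧ ∀ (Y : Z n → ℂ) (W : Z n → ℝ) (ker : Z n → ℂ) (ζ : Z n),
      MemLp (fun ζ => W ζ * ‖Y ζ‖) 2 → (∀ ζ', 0 ≤ W ζ') →
      (∀ ζ', ‖ker ζ'‖ ≤ C * jb (ζ - ζ') ^ M * W ζ') →
      ‖∫ ζ', 𝓕 c (ζ - ζ') * (ker ζ' * Y ζ')‖ ≤ C' * HH (fun ζ' => W ζ' * ‖Y ζ'‖) ζ := by
  obtain ⟨C1, hC1, hb⟩ := h.decay hk (2 * n + 2 + M)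
  refine ⟨C1 * |C|, by positivity, fun Y W ker ζ hL hW hker => ?_⟩
  rw [HH, ← integral_const_mul]
  refine norm_integral_le_of_norm_le ((hh_int hL ζ).const_mul _) (Filter.Eventually.of_forall fun y => ?_)
  rw [norm_mul, norm_mul]
  have hJ := jb_pos (ζ - y)
  have h1 := hb (ζ - y)
  have e : jb (ζ - y) ^ (-(2 * (n:ℝ) + 2 + M)) * jb (ζ - y) ^ M = jb (ζ - y) ^ (-(2 * (n:ℝ) + 2)) := by
    rw [← Real.rpow_natCast, ← Real.rpow_add hJ]; congr 1; ring
  have h2 : ‖ker y‖ ≤ jb (ζ - y) ^ M * (|C| * W y) := by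
    have := hW y
    calc _ ≤ C * jb (ζ - y) ^ M * W y := hker y
      _ ≤ |C| * jb (ζ - y) ^ M * W y := by gcongr; exact le_abs_self C
      _ = _ := by ring
  calc _ ≤ (C1 * jb (ζ - y) ^ (-(2 * (n:ℝ) + 2 + M))) * (jb (ζ - y) ^ M * (|C| * W y) * ‖Y y‖) := by
        gcongr
    _ = C1 * |C| * ((jb (ζ - y) ^ (-(2 * (n:ℝ) + 2 + M)) * jb (ζ - y) ^ M) * (W y * ‖Y y‖)) := by ring
    _ = _ := by rw [e]

/-- bump functions -/
lemma bump {K U : Set (ℝ × E n)} (hK : IsCompact K) (hU : IsOpen U) (hKU : K ⊆ U) :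
    ∃ φ : ℝ × E n → ℝ, ContDiff ℝ (⊤ : ℕ∞) φ ∧ HasCompactSupport φ ∧ tsupport φ ⊆ U ∧
      ∀ y ∈ K, φ y = 1 := by
  obtain ⟨L, hL, hKL, hLU⟩ := exists_compact_between hK hU hKU
  obtain ⟨φ, h1, h2, h3, h4⟩ := exists_contMDiff_support_eq_eq_one_iff
    (modelWithCornersSelf ℝ (ℝ × E n)) (n := (⊤ : ℕ∞)) isOpen_interior hK.isClosed hKL
  have hsub : tsupport φ ⊆ L := by
    rw [tsupport, h3]; exact closure_minimal interior_subset hL.isClosed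
  exact ⟨φ, h1.contDiff, HasCompactSupport.of_support_subset_isCompact hL
    (by rw [h3]; exact interior_subset), hsub.trans hLU, fun y hy => (h4 y).1 hy⟩

end HE

namespace HE
open scoped FourierTransform

/-! ### multiplication and Fourier multipliers on Schwartz functions -/

abbrev Sz (n : ℕ) := SchwartzMap (Z n) ℂ

def mS (p : Z n → ℂ) : Sz n →L[ℂ] Sz n := SchwartzMap.smulLeftCLM ℂ p

lemma mS_apply {p : Z n → ℂ} (hp : p.HasTemperateGrowth) (g : Sz n) (z : Z n) :
    mS p g z = p z * g z := by
  rw [mS, SchwartzMap.smulLeftCLM_apply_apply hp, smul_eq_mul]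

lemma mS_mul {p q : Z n → ℂ} (hp : p.HasTemperateGrowth) (hq : q.HasTemperateGrowth) (g : Sz n) :
    mS p (mS q g) = mS (fun z => p z * q z) g := by
  rw [mS, mS, SchwartzMap.smulLeftCLM_smulLeftCLM_apply hp hq]; rfl

def Op (m : Z n → ℂ) (g : Sz n) : Sz n := 𝓕 (mS m (𝓕⁻ g))

lemma fi_inj {f g : Sz n} (h : 𝓕⁻ f = 𝓕⁻ g) : f = g := by
  have h2 : 𝓕 (𝓕⁻ f) = 𝓕 (𝓕⁻ g) := congrArg (fun x : Sz n => (𝓕 x : Sz n)) h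
  rwa [FourierTransform.fourier_fourierInv_eq, FourierTransform.fourier_fourierInv_eq] at h2

lemma fi_Op (m : Z n → ℂ) (g : Sz n) : 𝓕⁻ (Op m g) = mS m (𝓕⁻ g) := by
  rw [Op, FourierTransform.fourierInv_fourier_eq]

lemma Op_add (m : Z n → ℂ) (f g : Sz n) : Op m (f + g) = Op m f + Op m g := by
  apply fi_inj
  rw [fi_Op, FourierTransform.fourierInv_add, FourierTransform.fourierInv_add, fi_Op, fi_Op, map_add]

lemma fi_coord (e : Z n) (f : Sz n) :
    (2 * π * Complex.I) • 𝓕⁻ (mS (fun z => ((inner ℝ z e : ℝ) : ℂ)) f) =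
      LineDeriv.lineDerivOp e (𝓕⁻ f) := by
  rw [SchwartzMap.lineDerivOp_fourierInv_eq, FourierTransform.fourierInv_smul]
  congr 2
  rw [mS]
  exact SchwartzMap.smulLeftCLM_ofReal ℂ ((innerSL ℝ).flip e).hasTemperateGrowth f

lemma coord_temp (e : Z n) : (fun z : Z n => ((inner ℝ z e : ℝ) : ℂ)).HasTemperateGrowth := by
  have := (Bk.coord (n := n) (innerSL ℝ e)).temp
  refine (congrArg Function.HasTemperateGrowth (funext fun z => ?_)).mp this
  rw [innerSL_apply_apply, real_inner_comm]

lemma tpi : (2 * (π:ℂ) * Complex.I) ≠ 0 := by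
  have : (π:ℂ) ≠ 0 := by exact_mod_cast Real.pi_ne_zero
  simp [this, Complex.I_ne_zero]

/-- the commutator of a coordinate with a multiplier -/
lemma Op_coord {m : Z n → ℂ} (hm : m.HasTemperateGrowth) (e : Z n)
    (hm' : (fun ζ => (2 * π * Complex.I)⁻¹ * fderiv ℝ m ζ e).HasTemperateGrowth) (g : Sz n) :
    mS (fun z => ((inner ℝ z e : ℝ) : ℂ)) (Op m g) =
      Op m (mS (fun z => ((inner ℝ z e : ℝ) : ℂ)) g) +
      Op (fun ζ => (2 * π * Complex.I)⁻¹ * fderiv ℝ m ζ e) g := by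
  apply fi_inj
  apply smul_right_injective _ (tpi)
  simp only
  rw [FourierTransform.fourierInv_add, smul_add, fi_coord, fi_Op, fi_Op, fi_Op, ← map_smul,
    fi_coord]
  ext ζ
  rw [add_apply, smul_apply, mS_apply hm, mS_apply hm',
    SchwartzMap.lineDerivOp_apply_eq_fderiv, SchwartzMap.lineDerivOp_apply_eq_fderiv]
  have e1 : ⇑(mS m (𝓕⁻ g)) = fun z => m z * (𝓕⁻ g) z := funext fun z => mS_apply hm _ z
  rw [e1, fderiv_fun_mul (hm.1.differentiable (by simp)).differentiableAt
    (𝓕⁻ g).differentiable.differentiableAt]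
  simp only [add_apply, smul_apply, smul_eq_mul]
  rw [← mul_assoc, ← mul_assoc, mul_inv_cancel₀ tpi]
  ring

lemma fracLap_eq {σ : ℝ} {w : E n → ℝ} (hF : (Fz (n := n) σ w).HasTemperateGrowth) (g : Sz n) :
    fracLapNeg σ w ⇑g = ⇑(Op (Fz σ w) g) := by
  ext z
  unfold fracLapNeg
  rw [Op, SchwartzMap.fourier_coe, Real.fourierInv_eq_fourier_neg, Real.fourier_eq, Real.fourier_eq,
    ← integral_neg_eq_self]
  congr 1
  ext x
  rw [mS_apply hF, SchwartzMap.fourierInv_coe, Real.fourierInv_eq_fourier_neg]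
  simp only [Fz, vC_neg, neg_neg, inner_neg_neg]

/-! ### representation of commutators with polynomial weights -/

structure SS (κ : ℝ) (m : Z n → ℂ) : Prop where
  temp : m.HasTemperateGrowth
  dir : ∀ e, Wc (fun ζ => je ζ ^ κ) (fun ζ => fderiv ℝ m ζ e)

lemma sym_temp {F : Type*} [NormedAddCommGroup F] [NormedSpace ℝ F] {κ : ℝ} {m : Z n → F} (h : Wc (fun ζ => je ζ ^ κ) m) : m.HasTemperateGrowth := by
  obtain ⟨k, hk⟩ := exists_nat_ge κ
  refine Wc.temperate h (fun z => (jer_pos z _).le) k 1 fun z => ?_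
  rw [one_mul, ← Real.rpow_natCast]
  calc je z ^ κ ≤ je z ^ (k:ℝ) := Real.rpow_le_rpow_of_exponent_le (one_le_je z) hk
    _ ≤ _ := Real.rpow_le_rpow (je_pos z).le
        ((je_le_jm z).trans ((jm_le_jb z).trans (jb_le z))) (by positivity)

lemma SS.of_sym {κ : ℝ} {m : Z n → ℂ} (h : Wc (fun ζ => je ζ ^ κ) m) : SS κ m :=
  ⟨sym_temp h, fun e => h.dir e⟩

lemma Fz_temp {σ : ℝ} {w : E n → ℝ} (hσ0 : 0 < σ) (hσ1 : σ < 1)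
    (hw : ContDiff ℝ ((⊤ : ℕ∞) : WithTop ℕ∞) w)
    (hwout : ∀ η : E n, 2 ≤ ‖η‖ → w η = 1)
    (hwin : ∀ η : E n, ‖η‖ ≤ 1 → w η = 0) : (Fz (n := n) σ w).HasTemperateGrowth := by
  obtain ⟨C, hC, hF⟩ := Fz_diff (n := n) hσ0 hσ1 hw hwout hwin
  refine Function.HasTemperateGrowth.of_fderiv (k := 2) (C := C + 1) ?_
    ((Fz_cd hσ0 hw hwin).differentiable (by simp)) (fun ζ => ?_)
  · have h1 := ((Fsym_bd hσ0 hw hwout hwin).comp (vL (n := n))).clm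
      ((ContinuousLinearMap.compL ℝ (Z n) ℝ ℂ Complex.ofRealCLM).comp
        ((ContinuousLinearMap.compL ℝ (Z n) (E n) ℝ).flip vL))
    have : fderiv ℝ (Fz (n := n) σ w) = fun z => ((ContinuousLinearMap.compL ℝ (Z n) ℝ ℂ Complex.ofRealCLM).comp
        ((ContinuousLinearMap.compL ℝ (Z n) (E n) ℝ).flip vL)) (fderiv ℝ (Fsym σ w) (vL z)) := by
      ext1 z
      have hd : HasFDerivAt (Fsym σ w) (fderiv ℝ (Fsym σ w) (vL z)) (vL z) :=
        (((Fsym_cd hσ0 hw hwin).differentiable (by simp)) _).hasFDerivAt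
      have h3 : HasFDerivAt (Fz σ w) (Complex.ofRealCLM.comp ((fderiv ℝ (Fsym σ w) (vL z)).comp vL)) z :=
        Complex.ofRealCLM.hasFDerivAt.comp z (hd.comp z vL.hasFDerivAt)
      rw [h3.fderiv]; rfl
    rw [this]
    refine sym_temp (κ := k0 σ) ?_
    simpa only [vL_apply, je_rpow, k0] using h1
  · have h1 : je ζ ^ (2 * σ) ≤ (1 + ‖ζ‖) ^ 2 := by
      rw [← Real.rpow_natCast]
      calc je ζ ^ (2 * σ) ≤ je ζ ^ ((2:ℕ):ℝ) :=
            Real.rpow_le_rpow_of_exponent_le (one_le_je ζ) (by push_cast; linarith)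
        _ ≤ _ := Real.rpow_le_rpow (je_pos ζ).le
            ((je_le_jm ζ).trans ((jm_le_jb ζ).trans (jb_le ζ))) (by positivity)
    have h2 : ‖Fz σ w ζ‖ ≤ C + je ζ ^ (2 * σ) := by
      have h3 := norm_sub_norm_le (Fz σ w ζ) ((je ζ ^ (2 * σ) : ℝ) : ℂ)
      rw [Complex.norm_real, Real.norm_of_nonneg (jer_pos ζ _).le] at h3
      linarith [hF ζ]
    have h4 : 1 ≤ (1 + ‖ζ‖) ^ 2 := one_le_pow₀ (by linarith [norm_nonneg ζ])
    nlinarith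

def Rep (κ d : ℝ) (p : Z n → ℂ) : Prop :=
  Bk (-d) p ∧ ∀ m, SS κ m → ∃ (ι : Type) (_ : Fintype ι) (f q : ι → Z n → ℂ),
    (∀ l, Wc (fun ζ => je ζ ^ κ) (f l)) ∧ (∀ l, Bk (-d) (q l)) ∧
    ∀ g : Sz n, mS p (Op m g) = Op m (mS p g) + ∑ l, Op (f l) (mS (q l) g)

lemma Rep.mono {κ d d' : ℝ} {p : Z n → ℂ} (h : Rep κ d p) (hd : d ≤ d') : Rep κ d' p := by
  refine ⟨h.1.mono (by linarith), fun m hm => ?_⟩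
  obtain ⟨ι, i1, f, q, h1, h2, h3⟩ := h.2 m hm
  exact ⟨ι, i1, f, q, h1, fun l => (h2 l).mono (by linarith), h3⟩

lemma Rep.one {κ : ℝ} : Rep κ 0 (fun _ : Z n => (1:ℂ)) := by
  have hB : Bk (-0) (fun _ : Z n => (1:ℂ)) := by rw [neg_zero]; exact Bk.const 1
  refine ⟨hB, fun m hm => ⟨Empty, inferInstance, fun _ => 0, fun _ => 0, by simp, by simp, fun g => ?_⟩⟩
  have : ∀ g : Sz n, mS (fun _ : Z n => (1:ℂ)) g = g := fun g => by
    ext z; rw [mS_apply hB.temp, one_mul]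
  simp [this]

lemma Rep.coord {κ : ℝ} (e : Z n) : Rep κ 1 (fun z => ((inner ℝ z e : ℝ) : ℂ)) := by
  have hB : Bk (-1) (fun z : Z n => ((inner ℝ z e : ℝ) : ℂ)) := by
    have := (Bk.coord (n := n) (innerSL ℝ e))
    refine (congrArg (Bk (-1)) (funext fun z => ?_)).mp this
    rw [innerSL_apply_apply, real_inner_comm]
  refine ⟨hB, fun m hm => ⟨Unit, inferInstance,
    fun _ => fun ζ => (2 * π * Complex.I)⁻¹ * fderiv ℝ m ζ e, fun _ => fun _ => 1,
    fun _ => (hm.dir e).cmul _, fun _ => (Bk.const 1).mono (by norm_num), fun g => ?_⟩⟩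
  rw [Op_coord hm.temp e (sym_temp ((hm.dir e).cmul _))]
  have : ∀ g : Sz n, mS (fun _ : Z n => (1:ℂ)) g = g := fun g => by
    ext z; rw [mS_apply (Bk.const 1).temp, one_mul]
  simp [this]

lemma Rep.add {κ d : ℝ} {p p' : Z n → ℂ} (h : Rep κ d p) (h' : Rep κ d p') :
    Rep κ d (fun z => p z + p' z) := by
  refine ⟨h.1.add h'.1, fun m hm => ?_⟩
  obtain ⟨ι, i1, f, q, h1, h2, h3⟩ := h.2 m hm
  obtain ⟨ι', i1', f', q', h1', h2', h3'⟩ := h'.2 m hm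
  refine ⟨ι ⊕ ι', inferInstance, Sum.elim f f', Sum.elim q q', ?_, ?_, fun g => ?_⟩
  · rintro (l | l); exacts [h1 l, h1' l]
  · rintro (l | l); exacts [h2 l, h2' l]
  · have hadd : ∀ g : Sz n, mS (fun z => p z + p' z) g = mS p g + mS p' g := fun g => by
      ext z
      rw [add_apply, mS_apply (h.1.add h'.1).temp, mS_apply h.1.temp, mS_apply h'.1.temp]
      ring
    rw [hadd, hadd, Op_add, h3, h3', Fintype.sum_sum_type]
    simp only [Sum.elim_inl, Sum.elim_inr]
    abel

lemma Rep.mul {κ d d' : ℝ} {p p' : Z n → ℂ} (h : Rep κ d p) (h' : Rep κ d' p') :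
    Rep κ (d + d') (fun z => p z * p' z) := by
  have hB : ∀ {q r : Z n → ℂ}, Bk (-d) q → Bk (-d') r → Bk (-(d + d')) (fun z => q z * r z) :=
    fun hq hr => (hq.mul hr).mono (by linarith)
  refine ⟨hB h.1 h'.1, fun m hm => ?_⟩
  obtain ⟨ι, i1, f, q, h1, h2, h3⟩ := h.2 m hm
  obtain ⟨ι', i1', f', q', h1', h2', h3'⟩ := h'.2 m hm
  choose ι'' i1'' f'' q'' h1'' h2'' h3'' using fun l => h.2 (f' l) (SS.of_sym (h1' l))
  refine ⟨ι ⊕ (ι' ⊕ (Σ l, ι'' l)), inferInstance, Sum.elim f (Sum.elim f' (fun s => f'' s.1 s.2)),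
    Sum.elim (fun l z => q l z * p' z) (Sum.elim (fun l z => p z * q' l z)
      (fun s z => q'' s.1 s.2 z * q' s.1 z)), ?_, ?_, fun g => ?_⟩
  · rintro (l | l | l); exacts [h1 l, h1' l, h1'' l.1 l.2]
  · rintro (l | l | l); exacts [hB (h2 l) h'.1, hB h.1 (h2' l), hB (h2'' l.1 l.2) (h2' l.1)]
  · rw [← mS_mul h.1.temp h'.1.temp, h3', map_add, map_sum, h3]
    simp only [h3'', Fintype.sum_sum_type, Sum.elim_inl, Sum.elim_inr, Finset.sum_add_distrib,
      Fintype.sum_sigma]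
    rw [mS_mul h.1.temp h'.1.temp]
    simp only [mS_mul (h2 _).temp h'.1.temp, mS_mul h.1.temp (h2' _).temp,
      mS_mul (h2'' _ _).temp (h2' _).temp]
    abel

lemma Rep.jb2 {κ : ℝ} : Rep κ 2 (fun z : Z n => (((1 + ‖z‖ ^ 2 : ℝ)) : ℂ)) := by
  have key : ∀ s : Finset (Unit ⊕ Fin n ⊕ Fin n), Rep κ 2 (fun z : Z n =>
      (1:ℂ) + ∑ i ∈ s, ((inner ℝ z (EuclideanSpace.single i (1:ℝ)) : ℝ) : ℂ) *
        ((inner ℝ z (EuclideanSpace.single i (1:ℝ)) : ℝ) : ℂ)) := by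
    intro s
    induction s using Finset.induction_on with
    | empty => simpa using (Rep.one (n := n) (κ := κ)).mono (by norm_num)
    | insert i s hi ih =>
      have h2 := (Rep.coord (κ := κ) (EuclideanSpace.single i (1:ℝ) : Z n)).mul
        (Rep.coord (κ := κ) (EuclideanSpace.single i (1:ℝ) : Z n))
      have := ih.add (h2.mono (by norm_num))
      refine (congrArg (Rep κ 2) (funext fun z => ?_)).mp this
      rw [Finset.sum_insert hi]; ring
  refine (congrArg (Rep κ 2) (funext fun z => ?_)).mp (key Finset.univ)
  rw [EuclideanSpace.real_norm_sq_eq]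
  push_cast
  congr 1
  refine Finset.sum_congr rfl fun i _ => ?_
  rw [EuclideanSpace.inner_single_right]
  simp [sq]

def Pw (m : ℕ) (z : Z n) : ℂ := (((1 + ‖z‖ ^ 2 : ℝ)) : ℂ) ^ m

lemma Rep.pw {κ : ℝ} (m : ℕ) : Rep κ (2 * m) (Pw (n := n) m) := by
  induction m with
  | zero =>
    refine (congrArg₂ (Rep κ) ?_ (funext fun z => ?_)).mp (Rep.one (n := n) (κ := κ))
    · simp
    · simp [Pw]
  | succ m ih =>
    have := ih.mul Rep.jb2
    refine (congrArg₂ (Rep κ) ?_ (funext fun z => ?_)).mp this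
    · push_cast; ring
    · simp only [Pw]; exact (pow_succ _ m).symm

end HE

namespace HE
open scoped FourierTransform

/-! ### locality in `(t,x)` -/

lemma mS_const (c : ℂ) (g : Sz n) : mS (fun _ => c) g = c • g := by
  ext z; rw [mS_apply (Bk.const c).temp, smul_apply, smul_eq_mul]

lemma Op_smul (m : Z n → ℂ) (c : ℂ) (g : Sz n) : Op m (c • g) = c • Op m g := by
  apply fi_inj
  rw [fi_Op, FourierTransform.fourierInv_smul, FourierTransform.fourierInv_smul, fi_Op, map_smul]

lemma Op_zero (g : Sz n) : Op (fun _ => 0) g = 0 := by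
  apply fi_inj
  rw [fi_Op, mS_const, zero_smul, FourierTransform.fourierInv_zero]

def Comm (m p : Z n → ℂ) : Prop := p.HasTemperateGrowth ∧ ∀ g : Sz n, mS p (Op m g) = Op m (mS p g)

lemma mS_add {p q : Z n → ℂ} (hp : p.HasTemperateGrowth) (hq : q.HasTemperateGrowth) (g : Sz n) :
    mS (fun z => p z + q z) g = mS p g + mS q g := by
  have : (fun z => p z + q z).HasTemperateGrowth := hp.add hq
  ext z; rw [mS_apply this, add_apply, mS_apply hp, mS_apply hq]; ring

lemma Comm.add {m p q : Z n → ℂ} (h : Comm m p) (h' : Comm m q) : Comm m (fun z => p z + q z) :=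
  ⟨h.1.add h'.1, fun g => by rw [mS_add h.1 h'.1, mS_add h.1 h'.1, Op_add, h.2, h'.2]⟩

lemma Comm.mul {m p q : Z n → ℂ} (h : Comm m p) (h' : Comm m q) : Comm m (fun z => p z * q z) :=
  ⟨h.1.mul h'.1, fun g => by rw [← mS_mul h.1 h'.1, ← mS_mul h.1 h'.1, h'.2, h.2]⟩

lemma Comm.const {m : Z n → ℂ} (c : ℂ) : Comm m (fun _ => c) :=
  ⟨(Bk.const c).temp, fun g => by rw [mS_const, mS_const, Op_smul]⟩

lemma Comm.sum {m : Z n → ℂ} {ι : Type*} (s : Finset ι) {p : ι → Z n → ℂ}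
    (h : ∀ i ∈ s, Comm m (p i)) : Comm m (fun z => ∑ i ∈ s, p i z) := by
  classical
  induction s using Finset.induction_on with
  | empty => simpa using Comm.const (m := m) 0
  | insert i s hi ih =>
    have := (h i (Finset.mem_insert_self _ _)).add (ih fun j hj => h j (Finset.mem_insert_of_mem hj))
    refine (congrArg (Comm m) (funext fun z => ?_)).mp this
    rw [Finset.sum_insert hi]

lemma Fz_fd {σ : ℝ} {w : E n → ℝ} (hF : Differentiable ℝ (Fz (n := n) σ w)) (e : Z n)
    (he : vC e = 0) (ζ : Z n) : fderiv ℝ (Fz σ w) ζ e = 0 := by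
  have h1 : HasFDerivAt (Fz σ w) (fderiv ℝ (Fz σ w) ζ) (ζ + (0:ℝ) • e) := by
    simpa using (hF ζ).hasFDerivAt
  have h2 : HasDerivAt (fun t : ℝ => ζ + t • e) e 0 := by
    simpa using ((hasDerivAt_id (0:ℝ)).smul_const e).const_add ζ
  have h3 := h1.comp_hasDerivAt (0:ℝ) h2
  have h4 : (Fz σ w ∘ fun t : ℝ => ζ + t • e) = fun _ => Fz σ w ζ := by
    ext t
    have : vC (ζ + t • e) = vC ζ + t • vC e := rfl
    simp [Fz, this, he]
  rw [h4] at h3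
  exact h3.unique (hasDerivAt_const _ _)

lemma inner_eT (ζ : Z n) : inner ℝ ζ eT = tC ζ := by
  rw [eT, EuclideanSpace.inner_single_right]; simp [tC]
lemma inner_eX (ζ : Z n) (i : Fin n) : inner ℝ ζ (eX i) = xC ζ i := by
  rw [eX, EuclideanSpace.inner_single_right]; simp [xC]
lemma vC_eT : vC (eT : Z n) = 0 := by ext i; simp [vC, eT]
lemma vC_eX (i : Fin n) : vC (eX i : Z n) = 0 := by ext j; simp [vC, eX]

lemma Comm.coord {σ : ℝ} {w : E n → ℝ} (hF : (Fz (n := n) σ w).HasTemperateGrowth) (e : Z n)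
    (he : vC e = 0) (y : ℝ) : Comm (Fz σ w) (fun z => ((inner ℝ z e : ℝ) : ℂ) + (-y : ℂ)) := by
  refine Comm.add ⟨coord_temp e, fun g => ?_⟩ (Comm.const _)
  have h0 : (fun ζ => (2 * π * Complex.I)⁻¹ * fderiv ℝ (Fz (n := n) σ w) ζ e) = fun _ => 0 := by
    ext ζ; rw [Fz_fd (hF.1.differentiable (by simp)) e he, mul_zero]
  rw [Op_coord hF e (by rw [h0]; exact (Bk.const 0).temp), h0, Op_zero, add_zero]

lemma locality {σ : ℝ} {w : E n → ℝ} (hF : (Fz (n := n) σ w).HasTemperateGrowth)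
    {K : Set (ℝ × E n)} (hK : IsCompact K) (g : Sz n) (hg : ∀ z, g z ≠ 0 → (tC z, xC z) ∈ K)
    (z₀ : Z n) (hz : (tC z₀, xC z₀) ∉ K) : Op (Fz σ w) g z₀ = 0 := by
  obtain ⟨χ, h1, h2, h3, h4⟩ := bump hK (isOpen_compl_singleton (x := (tC z₀, xC z₀)))
    (fun y hy => by rintro rfl; exact hz hy)
  set N : ℝ × E n → ℝ := fun y => (y.1 - tC z₀) ^ 2 + ‖y.2 - xC z₀‖ ^ 2 with hN
  have hNcd : ContDiff ℝ (⊤ : ℕ∞) N := by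
    refine ContDiff.add (by fun_prop) (ContDiff.norm_sq ℝ (by fun_prop))
  have hN0 : ∀ y, y ≠ (tC z₀, xC z₀) → N y ≠ 0 := by
    intro y hy hy0
    apply hy
    have e1 : (y.1 - tC z₀) ^ 2 = 0 := le_antisymm (by
      have := sq_nonneg ‖y.2 - xC z₀‖; simp only [hN] at hy0; linarith) (sq_nonneg _)
    have e2 : ‖y.2 - xC z₀‖ ^ 2 = 0 := by simp only [hN] at hy0; linarith
    refine Prod.ext ?_ ?_
    · simpa [sub_eq_zero] using e1
    · simpa [sub_eq_zero] using e2
  set ρ : ℝ × E n → ℝ := fun y => χ y / N y with hρ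
  have hρcd : ContDiff ℝ (⊤ : ℕ∞) ρ := by
    rw [contDiff_iff_contDiffAt]
    intro y
    by_cases hy : y = (tC z₀, xC z₀)
    · have : ρ =ᶠ[nhds y] fun _ => 0 := by
        have h5 : y ∉ tsupport χ := by
          intro hc; exact h3 hc hy
        filter_upwards [(notMem_tsupport_iff_eventuallyEq.1 h5)] with x hx
        simp [hρ, hx]
      exact contDiffAt_const.congr_of_eventuallyEq this
    · exact h1.contDiffAt.div hNcd.contDiffAt (hN0 y hy)
  have hρc : HasCompactSupport ρ := by
    refine h2.mono fun y hy => ?_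
    simp only [Function.mem_support, hρ] at hy ⊢
    intro h; exact hy (by rw [h, zero_div])
  have hρt : (lift (n := n) ρ).HasTemperateGrowth :=
    (lift_cl (U := Set.univ) hρcd hρc (Set.subset_univ _)).1.temp
  -- the polynomial
  set p : Z n → ℂ := fun z =>
    (((inner ℝ z eT : ℝ) : ℂ) + (-(tC z₀ : ℝ) : ℂ)) * (((inner ℝ z eT : ℝ) : ℂ) + (-(tC z₀ : ℝ) : ℂ)) +
    ∑ i : Fin n, (((inner ℝ z (eX i) : ℝ) : ℂ) + (-(xC z₀ i : ℝ) : ℂ)) *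
      (((inner ℝ z (eX i) : ℝ) : ℂ) + (-(xC z₀ i : ℝ) : ℂ)) with hp
  have hpc : Comm (Fz σ w) p :=
    ((Comm.coord hF eT vC_eT _).mul (Comm.coord hF eT vC_eT _)).add
      (Comm.sum _ fun i _ => (Comm.coord hF (eX i) (vC_eX i) _).mul (Comm.coord hF (eX i) (vC_eX i) _))
  have hpN : ∀ z, p z = (N (tC z, xC z) : ℂ) := by
    intro z
    simp only [hp, hN, inner_eT, inner_eX, EuclideanSpace.real_norm_sq_eq]
    push_cast
    congr 1
    · ring
    · refine Finset.sum_congr rfl fun i _ => ?_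
      simp only [PiLp.sub_apply]; push_cast; ring
  have hg2 : g = mS p (mS (lift ρ) g) := by
    ext z
    rw [mS_apply hpc.1, mS_apply hρt, hpN]
    by_cases hgz : g z = 0
    · simp [hgz]
    · have hK' := hg z hgz
      have hne : (tC z, xC z) ≠ (tC z₀, xC z₀) := fun h => hz (h ▸ hK')
      have h6 : lift ρ z = ((N (tC z, xC z))⁻¹ : ℝ) := by
        simp only [lift, hρ, h4 _ hK', one_div]
      have h7 : (N (tC z, xC z) : ℂ) ≠ 0 := by exact_mod_cast hN0 _ hne
      rw [h6, Complex.ofReal_inv, ← mul_assoc, mul_inv_cancel₀ h7, one_mul]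
  rw [hg2, ← hpc.2, mS_apply hpc.1, hpN]
  simp [hN]

/-! ### pairings -/

def pr (Y : Z n → ℂ) (g : Sz n) : ℂ := ∫ ζ, Y ζ * (𝓕⁻ g) ζ

lemma pr_eq (Y : Z n → ℂ) (g : Sz n) : pairing Y ⇑g = pr Y g := by
  rw [pairing, pr, ← SchwartzMap.fourierInv_coe]

lemma pr_int {Y : Z n → ℂ} (hY : GI Y) (g : Sz n) : Integrable (fun ζ => Y ζ * g ζ) := by
  obtain ⟨hm, L, hL⟩ := hY
  obtain ⟨C, hC, hb⟩ := decay_of_pow (f := fun z => ‖g z‖) (fun z => norm_nonneg _)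
    (fun m => by
      obtain ⟨C, hC⟩ := g.decay m 0
      exact ⟨C, fun z => by simpa using hC.2 z⟩) L
  refine Integrable.mono' (hL.const_mul C) (hm.mul g.continuous.aestronglyMeasurable)
    (Filter.Eventually.of_forall fun ζ => ?_)
  rw [norm_mul]
  calc _ ≤ ‖Y ζ‖ * (C * jb ζ ^ (-(L:ℝ))) := by gcongr; exact hb ζ
    _ = _ := by ring

lemma pr_add {Y : Z n → ℂ} (hY : GI Y) (f g : Sz n) : pr Y (f + g) = pr Y f + pr Y g := by
  simp only [pr, FourierTransform.fourierInv_add, add_apply, mul_add]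
  exact integral_add (pr_int hY _) (pr_int hY _)

lemma pr_neg (Y : Z n → ℂ) (f : Sz n) : pr Y (-f) = -pr Y f := by
  simp only [pr, FourierTransform.fourierInv_neg, neg_apply, mul_neg, integral_neg]

lemma pr_zero (Y : Z n → ℂ) : pr Y 0 = 0 := by
  simp [pr]

lemma pr_sum {Y : Z n → ℂ} (hY : GI Y) {ι : Type*} (s : Finset ι) (f : ι → Sz n) :
    pr Y (∑ i ∈ s, f i) = ∑ i ∈ s, pr Y (f i) := by
  classical
  induction s using Finset.induction_on with
  | empty => simp [pr_zero]
  | insert i s hi ih => rw [Finset.sum_insert hi, Finset.sum_insert hi, pr_add hY, ih]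

lemma GI.add {X Y : Z n → ℂ} (hX : GI X) (hY : GI Y) : GI (fun ζ => X ζ + Y ζ) := by
  obtain ⟨h1, L, hL⟩ := hX
  obtain ⟨h2, M, hM⟩ := hY
  refine ⟨h1.add h2, L + M, Integrable.mono' (hL.add hM)
    ((jbr_cont _).aestronglyMeasurable.mul (h1.add h2).norm) (Filter.Eventually.of_forall fun ζ => ?_)⟩
  have h3 : jb ζ ^ (-((L + M : ℕ):ℝ)) ≤ jb ζ ^ (-(L:ℝ)) :=
    Real.rpow_le_rpow_of_exponent_le (one_le_jb ζ) (by push_cast; linarith [M.cast_nonneg (α := ℝ)])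
  have h4 : jb ζ ^ (-((L + M : ℕ):ℝ)) ≤ jb ζ ^ (-(M:ℝ)) :=
    Real.rpow_le_rpow_of_exponent_le (one_le_jb ζ) (by push_cast; linarith [L.cast_nonneg (α := ℝ)])
  have h0 := (jbr_pos ζ (-((L + M : ℕ):ℝ))).le
  rw [Real.norm_of_nonneg (mul_nonneg h0 (norm_nonneg _))]
  calc _ ≤ jb ζ ^ (-((L + M : ℕ):ℝ)) * (‖X ζ‖ + ‖Y ζ‖) := by gcongr; exact norm_add_le _ _
    _ = jb ζ ^ (-((L + M : ℕ):ℝ)) * ‖X ζ‖ + jb ζ ^ (-((L + M : ℕ):ℝ)) * ‖Y ζ‖ := by ring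
    _ ≤ _ := by simp only [Pi.add_apply]; gcongr

lemma GI.zero : GI (fun _ : Z n => (0:ℂ)) :=
  ⟨aestronglyMeasurable_const, 0, by simp⟩

lemma GI.neg {X : Z n → ℂ} (hX : GI X) : GI (fun ζ => -X ζ) := by
  obtain ⟨h1, L, hL⟩ := hX
  exact ⟨h1.neg, L, by simpa using hL⟩

lemma GI.sum {ι : Type*} (s : Finset ι) {X : ι → Z n → ℂ} (h : ∀ i ∈ s, GI (X i)) :
    GI (fun ζ => ∑ i ∈ s, X i ζ) := by
  classical
  induction s using Finset.induction_on with
  | empty => simpa using GI.zero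
  | insert i s hi ih =>
    have := (h i (Finset.mem_insert_self _ _)).add (ih fun j hj => h j (Finset.mem_insert_of_mem hj))
    refine (congrArg GI (funext fun z => ?_)).mp this
    rw [Finset.sum_insert hi]

lemma pr_add' {X Y : Z n → ℂ} (hX : GI X) (hY : GI Y) (g : Sz n) :
    pr (fun ζ => X ζ + Y ζ) g = pr X g + pr Y g := by
  simp only [pr, add_mul]
  exact integral_add (pr_int hX _) (pr_int hY _)

lemma pr_neg' (X : Z n → ℂ) (g : Sz n) : pr (fun ζ => -X ζ) g = -pr X g := by
  simp only [pr, neg_mul, integral_neg]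

lemma pr_sum' {ι : Type*} (s : Finset ι) {X : ι → Z n → ℂ} (h : ∀ i ∈ s, GI (X i)) (g : Sz n) :
    pr (fun ζ => ∑ i ∈ s, X i ζ) g = ∑ i ∈ s, pr (X i) g := by
  simp only [pr, Finset.sum_mul]
  exact integral_finsetSum _ fun i hi => pr_int (h i hi) _

lemma pr_cv {k : ℝ} {c : Z n → ℂ} (hc : Bk k c) (hk : 2 * (n:ℝ) + 2 ≤ k) {Y : Z n → ℂ} (hY : GI Y)
    (ψ : Sz n) : pr (Cv c Y) ψ = pr Y (mS c ψ) := by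
  rw [← pr_eq, ← pr_eq, ← B3 hc hk hY]
  congr 1
  ext z; rw [mS_apply hc.temp]

lemma pr_op {m : Z n → ℂ} (hm : m.HasTemperateGrowth) (Y : Z n → ℂ) (g : Sz n) :
    pr (fun ζ => m ζ * Y ζ) g = pr Y (Op m g) := by
  simp only [pr, fi_Op, mS_apply hm]
  congr 1; ext ζ; ring

lemma pr_dir (Y : Z n → ℂ) (e : Z n) (g : Sz n) :
    pr (fun ζ => 2 * π * Complex.I * ((inner ℝ ζ e : ℝ) : ℂ) * Y ζ) g =
      -pr Y (LineDeriv.lineDerivOp e g) := by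
  simp only [pr, SchwartzMap.fourierInv_lineDerivOp_eq]
  rw [← integral_neg]
  congr 1; ext ζ
  have ht : (fun x : Z n => (inner ℝ x e : ℝ)).HasTemperateGrowth :=
    ((innerSL ℝ).flip e).hasTemperateGrowth
  rw [smul_apply, SchwartzMap.smulLeftCLM_apply_apply ht]
  simp only [smul_eq_mul, Complex.real_smul]
  ring

lemma pr_sep {D : Z n → ℂ} (hc : Continuous D) (h : ∀ ψ : Sz n, pr D ψ = 0) (ζ : Z n) : D ζ = 0 := by
  have h1 : D =ᵐ[volume] 0 := by
    refine ae_eq_zero_of_integral_contDiff_smul_eq_zero hc.locallyIntegrable fun g hg hgc => ?_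
    have hg' : ContDiff ℝ (⊤ : ℕ∞) (fun x => (g x : ℂ)) := Complex.ofRealCLM.contDiff.comp hg
    have hgc' : HasCompactSupport (fun x => (g x : ℂ)) := hgc.comp_left (g := fun x : ℝ => (x:ℂ)) rfl
    have := h (𝓕 (hgc'.toSchwartzMap hg'))
    rw [pr, FourierTransform.fourierInv_fourier_eq] at this
    rw [← this]
    congr 1; ext x
    simp [mul_comm]
  have := (Continuous.ae_eq_iff_eq volume hc continuous_const).1 h1
  exact congrFun this ζ

end HE

namespace HE
open scoped FourierTransform

/-! ### the equation on the Fourier side -/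

structure Dat (σ : ℝ) (w : E n → ℝ) (a : Z n → ℝ) (a₀ s : ℝ) (h : Z n → ℂ) (U : Set (ℝ × E n)) : Prop where
  s0 : 0 < σ
  s1 : σ < 1
  hw : ContDiff ℝ (⊤ : ℕ∞) w
  hwout : ∀ η : E n, 2 ≤ ‖η‖ → w η = 1
  hwin : ∀ η : E n, ‖η‖ ≤ 1 → w η = 0
  ha : Bk 0 (fun z => (a z : ℂ))
  ha₀ : 0 < a₀
  haLB : ∀ z, a₀ ≤ a z
  gi : GI h
  hU : IsOpen U
  hP : ∀ φ : ℝ × E n → ℝ, ContDiff ℝ (⊤ : ℕ∞) φ → HasCompactSupport φ → tsupport φ ⊆ U →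
        IsHr s (fun ψ : Z n → ℂ =>
          pairing h (Ptrans σ w a (fun z => ((φ (tC z, xC z) : ℝ) : ℂ) * ψ z)))

def Tr (c : Z n → ℂ) (z : Z n) : ℂ := fderiv ℝ c z eT + ∑ i : Fin n, (vC z i : ℂ) * fderiv ℝ c z (eX i)

def vco (i : Fin n) : Z n →L[ℝ] ℝ := innerSL ℝ (eV i)

lemma vco_eq (i : Fin n) (z : Z n) : vco i z = vC z i := by
  rw [vco, innerSL_apply_apply, eV, EuclideanSpace.inner_single_left]; simp [vC]

lemma Bk.v (i : Fin n) : Bk (-1) (fun z : Z n => ((vC z i : ℝ) : ℂ)) := by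
  simpa only [vco_eq] using Bk.coord (vco (n := n) i)

lemma Cl.vm {U : Set (ℝ × E n)} {k : ℝ} {c : Z n → ℂ} (h : Cl U k c) (i : Fin n) :
    Cl U (k - 1) (fun z => c z * ((vC z i : ℝ) : ℂ)) := by
  have := h.mul (Bk.v i); rwa [← sub_eq_add_neg] at this

lemma Cl.tr {U : Set (ℝ × E n)} {k : ℝ} {c : Z n → ℂ} (h : Cl U k c) : Cl U (k - 1) (Tr c) := by
  refine ((h.dir eT).mono (by linarith)).add (Cl.sum _ fun i _ => ?_)
  refine (congrArg (Cl U (k-1)) (funext fun z => ?_)).mp ((h.dir (eX i)).vm i)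
  rw [mul_comm]

lemma Pw_bk (m : ℕ) : Bk (-(2 * (m:ℝ))) (Pw (n := n) m) := (Rep.pw (κ := 0) m).1

lemma Pw_inv (m : ℕ) : Bk (2 * (m:ℝ)) (fun z : Z n => (Pw m z)⁻¹) := by
  have := Bk.pow (n := n) (-(m:ℝ))
  rw [show -(2 * -(m:ℝ)) = 2 * m by ring] at this
  refine (congrArg (Bk (2 * (m:ℝ))) (funext fun z => ?_)).mp this
  rw [Pw, Real.rpow_neg (by positivity), Real.rpow_natCast]
  push_cast; rfl

lemma Pw_ne (m : ℕ) (z : Z n) : Pw m z ≠ 0 := by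
  rw [Pw]; apply pow_ne_zero
  have : (1 + ‖z‖ ^ 2 : ℝ) ≠ 0 := by positivity
  exact_mod_cast this

lemma temp_bd {F : Type*} [NormedAddCommGroup F] [NormedSpace ℝ F] {m : Z n → F}
    (h : m.HasTemperateGrowth) : ∃ (C : ℝ) (k : ℕ), ∀ ζ, ‖m ζ‖ ≤ C * jb ζ ^ (k:ℝ) := by
  obtain ⟨k, C, hb⟩ := h.2 0
  refine ⟨2 ^ k * |C|, k, fun ζ => ?_⟩
  have := hb ζ
  rw [norm_iteratedFDeriv_zero] at this
  rw [Real.rpow_natCast]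
  have h1 : 1 + ‖ζ‖ ≤ 2 * jb ζ := by linarith [one_le_jb ζ, norm_le_jb ζ]
  calc _ ≤ C * (1 + ‖ζ‖) ^ k := this
    _ ≤ |C| * (2 * jb ζ) ^ k := by gcongr; exact le_abs_self C
    _ = _ := by rw [mul_pow]; ring

lemma GI.mul_temp {Y m : Z n → ℂ} (hY : GI Y) (hm : m.HasTemperateGrowth) : GI (fun ζ => m ζ * Y ζ) := by
  obtain ⟨C, k, hb⟩ := temp_bd hm
  exact hY.mul_bd hm.1.continuous.aestronglyMeasurable hb

lemma jbC_pos (ζ : Z n) (s : ℝ) : (((1 + ‖ζ‖ ^ 2) ^ (s / 2) : ℝ) : ℂ) ≠ 0 := by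
  rw [jb_rpow]; exact_mod_cast (jbr_pos ζ s).ne'

lemma hr_norm {G : Z n → ℂ} {s : ℝ}
    (h : MemLp (fun ζ => (((1 + ‖ζ‖ ^ 2) ^ (s / 2) : ℝ) : ℂ) * G ζ) 2 volume) :
    AEStronglyMeasurable G ∧ MemLp (fun ζ => jb ζ ^ s * ‖G ζ‖) 2 := by
  constructor
  · have hc : Continuous (fun ζ : Z n => ((((1 + ‖ζ‖ ^ 2) ^ (s / 2) : ℝ) : ℂ))⁻¹) := by
      refine Continuous.inv₀ ?_ fun ζ => jbC_pos ζ s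
      simp only [jb_rpow]
      exact Complex.continuous_ofReal.comp (jbr_cont s)
    have := hc.aestronglyMeasurable.mul h.1
    refine this.congr (Filter.Eventually.of_forall fun ζ => ?_)
    simp only [Pi.mul_apply]
    rw [← mul_assoc, inv_mul_cancel₀ (jbC_pos ζ s), one_mul]
  · have := h.norm
    simpa only [norm_mul, jb_rpow, Complex.norm_real, Real.norm_of_nonneg (jbr_pos _ _).le] using this

lemma EQ {σ : ℝ} {w : E n → ℝ} {a : Z n → ℝ} {a₀ s : ℝ} {h : Z n → ℂ} {U : Set (ℝ × E n)}
    (D : Dat σ w a a₀ s h U) {c : Z n → ℂ} {k : ℝ} (hc : Cl U k c) (m : ℕ)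
    (hm : 2 * (n:ℝ) + 3 ≤ 2 * m) (hk : 2 * (n:ℝ) + 4 + 2 * m ≤ k) :
    ∃ q : Z n → ℂ, Cl U (2 * m) q ∧ (∀ z, c z * Pw m z * q z = c z) ∧
    ∃ G : Z n → ℂ, AEStronglyMeasurable G ∧ MemLp (fun ζ => jb ζ ^ s * ‖G ζ‖) 2 ∧
    ∃ (ι : Type) (_ : Fintype ι) (f p : ι → Z n → ℂ),
      (∀ l, Wc (fun ζ => je ζ ^ (k0 σ)) (f l)) ∧ (∀ l, Bk (-(2 * (m:ℝ))) (p l)) ∧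
      ∀ ζ, 2 * π * Complex.I * ((tC ζ : ℝ) : ℂ) * Cv c h ζ +
        ∑ i : Fin n, 2 * π * Complex.I * ((xC ζ i : ℝ) : ℂ) * Cv (fun z => c z * ((vC z i : ℝ) : ℂ)) h ζ +
        Cv (fun z => (a z : ℂ) * (c z * Pw m z)) (fun ζ => Fz σ w ζ * Cv q h ζ) ζ +
        ∑ l, Cv (fun z => (a z : ℂ) * (c z * p l z)) (fun ζ => f l ζ * Cv q h ζ) ζ =
        Cv c G ζ + Cv (Tr c) h ζ := by
  obtain ⟨hcB, K, hK, hKU, hcK⟩ := hc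
  obtain ⟨φ, φ1, φ2, φ3, φ4⟩ := bump hK D.hU hKU
  have hc : Cl U k c := ⟨hcB, K, hK, hKU, hcK⟩
  have hF := Fz_temp (n := n) D.s0 D.s1 D.hw D.hwout D.hwin
  have hSS : SS (k0 σ) (Fz (n := n) σ w) := ⟨hF, fun e => Fz_dir D.s0 D.hw D.hwout D.hwin e⟩
  set q : Z n → ℂ := fun z => lift φ z * (Pw m z)⁻¹ with hq
  have hqC : Cl U (2 * m) q := by
    have := (lift_cl φ1 φ2 φ3).mul (Pw_inv (n := n) m); rwa [zero_add] at this
  have hlift : ∀ z, (tC z, xC z) ∈ K → lift φ z = 1 := fun z hz => by simp [lift, φ4 _ hz]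
  obtain ⟨G, hG1, hG2⟩ := D.hP φ φ1 φ2 φ3
  obtain ⟨hGm, hGL⟩ := hr_norm hG1
  have hGG : GI G := GI.of_L2 hGm hGL
  obtain ⟨ι, iι, f, p, hf, hp, hrep⟩ := (Rep.pw (n := n) (κ := k0 σ) m).2 _ hSS
  have h2n : (0:ℝ) ≤ 2 * m := by positivity
  refine ⟨q, hqC, ?_, G, hGm, hGL, ι, iι, f, p, hf, hp, fun ζ => ?_⟩
  · intro z
    by_cases hz : c z = 0
    · simp [hz]
    · simp only [hq]
      rw [hlift z (hcK z hz), one_mul, mul_assoc, mul_inv_cancel₀ (Pw_ne m z), mul_one]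
  set Y := Cv q h with hY
  have hYG : GI Y := cv_GI hqC.1 hm D.gi
  have hpB : ∀ {P : Z n → ℂ}, Bk (-(2 * (m:ℝ))) P → Bk (2 * n + 4) (fun z => (a z : ℂ) * (c z * P z)) :=
    fun hP => (D.ha.mul (hcB.mul hP)).mono (by linarith)
  have hpB2 : Bk (2 * n + 4) (fun z => (a z : ℂ) * (c z * Pw m z)) := hpB (Pw_bk m)
  have hgF : GI (fun ζ => Fz σ w ζ * Y ζ) := hYG.mul_temp hF
  have hgf : ∀ l, GI (fun ζ => f l ζ * Y ζ) := fun l => hYG.mul_temp (sym_temp (hf l))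
  have hkk : 2 * (n:ℝ) + 3 ≤ k - 1 := by linarith
  have n34 : 2 * (n:ℝ) + 3 ≤ 2 * n + 4 := by linarith
  have n24 : 2 * (n:ℝ) + 2 ≤ 2 * n + 4 := by linarith
  -- all terms
  have g1 : GI (fun ζ => 2 * π * Complex.I * ((inner ℝ ζ eT : ℝ) : ℂ) * Cv c h ζ) :=
    (cv_GI hcB (by linarith) D.gi).mul_temp
      ((Function.HasTemperateGrowth.const (2 * π * Complex.I)).mul (coord_temp eT))
  have g2 : ∀ i, GI (fun ζ => 2 * π * Complex.I * ((inner ℝ ζ (eX i) : ℝ) : ℂ) *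
      Cv (fun z => c z * ((vC z i : ℝ) : ℂ)) h ζ) := fun i =>
    (cv_GI (hc.vm i).1 hkk D.gi).mul_temp
      ((Function.HasTemperateGrowth.const (2 * π * Complex.I)).mul (coord_temp (eX i)))
  have g3 := cv_GI hpB2 n34 hgF
  have g4 : ∀ l, GI (Cv (fun z => (a z : ℂ) * (c z * p l z)) (fun ζ => f l ζ * Y ζ)) :=
    fun l => cv_GI (hpB (hp l)) n34 (hgf l)
  have g5 := cv_GI hcB (by linarith) hGG
  have g6 := cv_GI hc.tr.1 hkk D.gi
  have key := pr_sep (D := fun ζ => ((2 * π * Complex.I * ((inner ℝ ζ eT : ℝ) : ℂ) * Cv c h ζ +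
        ∑ i : Fin n, 2 * π * Complex.I * ((inner ℝ ζ (eX i) : ℝ) : ℂ) * Cv (fun z => c z * ((vC z i : ℝ) : ℂ)) h ζ) +
        (Cv (fun z => (a z : ℂ) * (c z * Pw m z)) (fun ζ => Fz σ w ζ * Y ζ) ζ +
        ∑ l, Cv (fun z => (a z : ℂ) * (c z * p l z)) (fun ζ => f l ζ * Y ζ) ζ)) +
        -(Cv c G ζ + Cv (Tr c) h ζ)) ?_ ?_ ζ
  · simp only [inner_eT, inner_eX] at key
    linear_combination key
  · have hco : ∀ e : Z n, Continuous fun ζ : Z n => ((inner ℝ ζ e : ℝ) : ℂ) := fun e =>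
      (coord_temp e).1.continuous
    have c1 := cv_cont hcB (by linarith) D.gi
    have c2 := fun i => cv_cont (hc.vm i).1 hkk D.gi
    have c3 := cv_cont hpB2 n34 hgF
    have c4 := fun l => cv_cont (hpB (hp l)) n34 (hgf l)
    have c5 := cv_cont hcB (by linarith) hGG
    have c6 := cv_cont hc.tr.1 hkk D.gi
    refine ((((continuous_const.mul (hco _)).mul c1).add (continuous_finsetSum _ fun i _ =>
      (continuous_const.mul (hco _)).mul (c2 i))).add (c3.add (continuous_finsetSum _ fun l _ => c4 l))).add
      (c5.add c6).neg
  · intro ψ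
    rw [pr_add' ((g1.add (GI.sum _ fun i _ => g2 i)).add (g3.add (GI.sum _ fun l _ => g4 l))) (g5.add g6).neg,
      pr_neg', pr_add' (g1.add (GI.sum _ fun i _ => g2 i)) (g3.add (GI.sum _ fun l _ => g4 l)),
      pr_add' g1 (GI.sum _ fun i _ => g2 i), pr_add' g3 (GI.sum _ fun l _ => g4 l),
      pr_add' g5 g6, pr_sum' _ (fun i _ => g2 i), pr_sum' _ (fun l _ => g4 l)]
    simp only [pr_dir]
    rw [pr_cv hcB (by linarith) D.gi, pr_cv hpB2 n24 hgF, pr_cv hcB (by linarith) hGG,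
      pr_cv hc.tr.1 (by linarith) D.gi, pr_op hF]
    simp only [fun i => pr_cv (hc.vm i).1 (by linarith : 2 * (n:ℝ) + 2 ≤ k - 1) D.gi,
      fun l => pr_cv (hpB (hp l)) n24 (hgf l), fun l => pr_op (sym_temp (hf l))]
    simp only [hY, pr_cv hqC.1 (by linarith : 2 * (n:ℝ) + 2 ≤ 2 * m) D.gi]
    -- the equation
    have hacψ : (fun z => (a z : ℂ) * c z).HasTemperateGrowth := (D.ha.mul hcB).temp
    have e1 : pr G (mS c ψ) = pr h ((-(mS c (LineDeriv.lineDerivOp (eT : Z n) ψ)) +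
        -(∑ i : Fin n, mS (fun z => c z * ((vC z i : ℝ) : ℂ)) (LineDeriv.lineDerivOp (eX i : Z n) ψ)) +
        -(mS (Tr c) ψ)) + (mS q (Op (Fz σ w) (mS (fun z => (a z : ℂ) * (c z * Pw m z)) ψ)) +
        ∑ l, mS q (Op (f l) (mS (fun z => (a z : ℂ) * (c z * p l z)) ψ)))) := by
      rw [← pr_eq, ← hG2, ← pr_eq]
      beta_reduce
      have e2 : (fun z => ((φ (tC z, xC z) : ℝ) : ℂ) * (mS c ψ) z) = fun z => c z * ψ z := by
        ext z
        rw [mS_apply hcB.temp]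
        by_cases hz : c z = 0
        · simp [hz]
        · rw [show ((φ (tC z, xC z) : ℝ) : ℂ) = 1 from hlift z (hcK z hz), one_mul]
      rw [e2]
      refine congrArg (pairing h) ?_
      ext z
      have e3 : (fun z' => (a z' : ℂ) * (c z' * ψ z')) = ⇑(mS (fun z => (a z : ℂ) * c z) ψ) := by
        ext z; rw [mS_apply hacψ, mul_assoc]
      have e4 : ∀ e, fderiv ℝ (fun z => c z * ψ z) z e = fderiv ℝ c z e * ψ z + c z * fderiv ℝ ψ z e := by
        intro e
        rw [fderiv_fun_mul hcB.diff.differentiableAt ψ.differentiable.differentiableAt]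
        simp only [add_apply, smul_apply, smul_eq_mul]; ring
      have e5 : mS q (Op (Fz σ w) (mS (fun z => (a z : ℂ) * (c z * Pw m z)) ψ)) +
          ∑ l, mS q (Op (f l) (mS (fun z => (a z : ℂ) * (c z * p l z)) ψ)) =
          mS q (mS (Pw m) (Op (Fz σ w) (mS (fun z => (a z : ℂ) * c z) ψ))) := by
        have r1 : ∀ P : Z n → ℂ, (fun z => (a z : ℂ) * (c z * P z)) = fun z => P z * ((a z : ℂ) * c z) :=
          fun P => by ext z; ring
        rw [hrep, map_add, map_sum, mS_mul (Pw_bk m).temp hacψ, r1]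
        congr 1
        refine Finset.sum_congr rfl fun l _ => ?_
        rw [mS_mul (hp l).temp hacψ, r1]
      have e6 : mS q (mS (Pw m) (Op (Fz σ w) (mS (fun z => (a z : ℂ) * c z) ψ))) z =
          Op (Fz σ w) (mS (fun z => (a z : ℂ) * c z) ψ) z := by
        rw [mS_apply hqC.1.temp, mS_apply (Pw_bk m).temp]
        by_cases hz : (tC z, xC z) ∈ K
        · simp only [hq]
          rw [hlift z hz, one_mul, ← mul_assoc, inv_mul_cancel₀ (Pw_ne m z), one_mul]
        · rw [locality hF hK _ (fun z hz => ?_) z hz]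
          · simp
          · rw [mS_apply hacψ] at hz
            exact hcK z (fun h0 => hz (by rw [h0]; ring))
      rw [e5, Ptrans, e3, fracLap_eq hF]
      simp only [add_apply, neg_apply, e6, mS_apply hcB.temp, mS_apply hc.tr.1.temp, sum_apply,
        fun i => mS_apply (hc.vm i).1.temp, SchwartzMap.lineDerivOp_apply_eq_fderiv, e4, Tr]
      simp only [mul_add, Finset.sum_add_distrib, add_mul, Finset.sum_mul]
      have e7 : ∑ i : Fin n, c z * ((vC z i : ℝ) : ℂ) * fderiv ℝ ψ z (eX i) =
          ∑ i : Fin n, ((vC z i : ℝ) : ℂ) * (c z * fderiv ℝ ψ z (eX i)) :=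
        Finset.sum_congr rfl fun i _ => by ring
      have e8 : ∑ i : Fin n, ((vC z i : ℝ) : ℂ) * (fderiv ℝ c z (eX i) * ψ z) =
          ∑ i : Fin n, ((vC z i : ℝ) : ℂ) * fderiv ℝ c z (eX i) * ψ z :=
        Finset.sum_congr rfl fun i _ => by ring
      rw [e7, e8]
      ring
    rw [e1, pr_add D.gi, pr_add D.gi, pr_add D.gi, pr_add D.gi, pr_sum D.gi, pr_neg, pr_neg, pr_neg,
      pr_sum D.gi, Finset.sum_neg_distrib]
    ring

end HE

namespace HE
open scoped FourierTransform

lemma ML {ι : Type*} {k : ℝ} {b : Z n → ℂ} (hb : Bk k b) (hk : 2 * (n:ℝ) + 2 ≤ k)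
    {lam : ι → Z n → ℝ} (hl : Md lam) (C : ℝ) :
    ∃ C' : ℝ, 0 ≤ C' ∧ ∀ (i : ι) (g Y : Z n → ℂ) (W : Z n → ℝ) (ζ : Z n),
      MemLp (fun ζ => W ζ * ‖Y ζ‖) 2 → (∀ ζ', 0 ≤ W ζ') →
      (∀ ζ', lam i ζ' * ‖g ζ'‖ ≤ C * W ζ') →
      lam i ζ * ‖Cv b (fun ζ' => g ζ' * Y ζ') ζ‖ ≤ C' * HH (fun ζ' => W ζ' * ‖Y ζ'‖) ζ := by
  obtain ⟨hl0, Cl, M, hCl, hl⟩ := hl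
  obtain ⟨C', hC', H⟩ := ker_bd hb hk (Cl * C) M
  refine ⟨C', hC', fun i g Y W ζ hY hW hg => ?_⟩
  have := H Y W (fun ζ' => (lam i ζ : ℂ) * g ζ') ζ hY hW (fun ζ' => by
    rw [norm_mul, Complex.norm_real, Real.norm_of_nonneg (hl0 i ζ).le]
    calc lam i ζ * ‖g ζ'‖ ≤ (Cl * jb (ζ - ζ') ^ M * lam i ζ') * ‖g ζ'‖ := by gcongr; exact hl i ζ ζ'
      _ = Cl * jb (ζ - ζ') ^ M * (lam i ζ' * ‖g ζ'‖) := by ring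
      _ ≤ Cl * jb (ζ - ζ') ^ M * (C * W ζ') := by
        have := (jb_pos (ζ - ζ')).le
        exact mul_le_mul_of_nonneg_left (hg ζ') (by positivity)
      _ = _ := by ring)
  refine le_trans (le_of_eq ?_) this
  rw [Cv, ← Real.norm_of_nonneg (hl0 i ζ).le, ← Complex.norm_real, ← norm_mul, ← integral_const_mul]
  rw [Complex.norm_real, Real.norm_of_nonneg (hl0 i ζ).le]
  congr 1
  refine integral_congr_ae (Filter.Eventually.of_forall fun ζ' => ?_)
  simp only; ring

lemma CM {ι : Type*} {k : ℝ} {b : Z n → ℂ} (hb : Bk k b) (hk : 2 * (n:ℝ) + 2 ≤ k)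
    {lam p : ι → Z n → ℝ} (hl : Md lam) (hp : SV p) (C : ℝ) :
    ∃ C' : ℝ, 0 ≤ C' ∧ ∀ (i : ι) (g Y : Z n → ℂ) (W : Z n → ℝ) (ζ : Z n),
      MemLp (fun ζ => W ζ * ‖Y ζ‖) 2 → (∀ ζ', 0 ≤ W ζ') →
      GI (fun ζ' => g ζ' * Y ζ') → GI (fun ζ' => (p i ζ' : ℂ) * (g ζ' * Y ζ')) →
      (∀ ζ', lam i ζ' * (p i ζ' / je ζ') * ‖g ζ'‖ ≤ C * W ζ') →
      lam i ζ * ‖(p i ζ : ℂ) * Cv b (fun ζ' => g ζ' * Y ζ') ζ -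
        Cv b (fun ζ' => (p i ζ' : ℂ) * (g ζ' * Y ζ')) ζ‖ ≤ C' * HH (fun ζ' => W ζ' * ‖Y ζ'‖) ζ := by
  obtain ⟨hl0, Cl, M, hCl, hl⟩ := hl
  obtain ⟨hp0, Cp, M', hCp, hp⟩ := hp
  obtain ⟨C', hC', H⟩ := ker_bd hb hk (Cl * Cp * C) (M + M')
  refine ⟨C', hC', fun i g Y W ζ hY hW hG1 hG2 hg => ?_⟩
  have := H Y W (fun ζ' => (lam i ζ : ℂ) * ((p i ζ - p i ζ' : ℝ) : ℂ) * g ζ') ζ hY hW (fun ζ' => by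
    rw [norm_mul, norm_mul, Complex.norm_real, Real.norm_of_nonneg (hl0 i ζ).le, Complex.norm_real,
      Real.norm_eq_abs]
    have hj := (jb_pos (ζ - ζ')).le
    have h1 := hp0 i ζ'
    have h2 := je_pos ζ'
    have h3 := hl0 i ζ'
    calc lam i ζ * |p i ζ - p i ζ'| * ‖g ζ'‖
        ≤ (Cl * jb (ζ - ζ') ^ M * lam i ζ') * (Cp * jb (ζ - ζ') ^ M' * (p i ζ' / je ζ')) * ‖g ζ'‖ := by
          gcongr
          · exact hl i ζ ζ'
          · exact hp i ζ ζ'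
      _ = Cl * Cp * jb (ζ - ζ') ^ (M + M') * (lam i ζ' * (p i ζ' / je ζ') * ‖g ζ'‖) := by
        rw [pow_add]; ring
      _ ≤ Cl * Cp * jb (ζ - ζ') ^ (M + M') * (C * W ζ') := by
        exact mul_le_mul_of_nonneg_left (hg ζ') (by positivity)
      _ = _ := by ring)
  refine le_trans (le_of_eq ?_) this
  rw [Cv, Cv, ← integral_const_mul, ← integral_sub ((cv_int hb hk hG1 ζ).const_mul _) (cv_int hb hk hG2 ζ)]
  rw [← Real.norm_of_nonneg (hl0 i ζ).le, ← Complex.norm_real, ← norm_mul, ← integral_const_mul]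
  rw [Complex.norm_real, Real.norm_of_nonneg (hl0 i ζ).le]
  congr 1
  refine integral_congr_ae (Filter.Eventually.of_forall fun ζ' => ?_)
  simp only [Complex.ofReal_sub]; ring

lemma fou_cont {X : Z n → ℂ} (h : Integrable X) : Continuous (𝓕 X) :=
  VectorFourier.fourierIntegral_continuous Real.continuous_fourierChar (by exact continuous_inner) h

lemma fou_le (X : Z n → ℂ) (z : Z n) : ‖𝓕 X z‖ ≤ ∫ ζ, ‖X ζ‖ :=
  VectorFourier.norm_fourierIntegral_le_integral_norm _ _ _ _ _

/-- decay is preserved -/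
lemma cv_decay {k : ℝ} {b : Z n → ℂ} (hb : Bk k b) (hk : 2 * (n:ℝ) + 2 ≤ k) {X : Z n → ℂ} 
    (hX : Integrable X) : Integrable (Cv b X) := by
  have h1 := (hb.fint hk).integrable_convolution (ContinuousLinearMap.mul ℂ ℂ) hX
  have h2 : (fun x => convolution (𝓕 b) X (ContinuousLinearMap.mul ℂ ℂ) volume x) = Cv b X := by
    ext x
    rw [← convolution_flip]
    simp only [convolution, Cv, ContinuousLinearMap.flip_apply, ContinuousLinearMap.mul_apply']
  rw [← h2]; exact h1

lemma PL {k : ℝ} {b₁ b₂ : Z n → ℂ} (h₁ : Bk k b₁) (h₂ : Bk k b₂) (hk : 2 * (n:ℝ) + 2 ≤ k) (hk0 : 0 ≤ k)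
    {X : Z n → ℂ} (hX : Integrable X) :
    Integrable (fun ζ => Cv b₁ X ζ * (starRingEnd ℂ) (Cv b₂ X ζ)) ∧ 
    ∫ ζ, Cv b₁ X ζ * (starRingEnd ℂ) (Cv b₂ X ζ) = 
      ∫ x, (b₁ x * 𝓕⁻ X x) * (starRingEnd ℂ) (b₂ x * 𝓕⁻ X x) ∧ 
    Integrable (fun x => (b₁ x * 𝓕⁻ X x) * (starRingEnd ℂ) (b₂ x * 𝓕⁻ X x)) := by
  set u := 𝓕⁻ X with hu
  have huc : Continuous u := by
    rw [hu, show 𝓕⁻ X = fun z => 𝓕 X (-z) from by ext z; rw [Real.fourierInv_eq_fourier_neg]]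
    exact (fou_cont hX).comp continuous_neg
  have hub : ∀ x, ‖u x‖ ≤ ∫ ζ, ‖X ζ‖ := fun x => by
    rw [hu, Real.fourierInv_eq_fourier_neg]; exact fou_le X _
  have hi : ∀ {b : Z n → ℂ}, Bk k b → Integrable (fun x => b x * u x) := fun hb => 
    (hb.int hk).mul_bdd huc.aestronglyMeasurable (Filter.Eventually.of_forall hub)
  have hc : ∀ {b : Z n → ℂ}, Bk k b → ∀ ζ, Cv b X ζ = 𝓕 (fun x => b x * u x) ζ := fun hb ζ => 
    FC (hb.int hk) hX ζ
  have hF : ∀ {b : Z n → ℂ}, Bk k b → Integrable (𝓕 (fun x => b x * u x)) := fun hb => by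
    rw [← funext (hc hb)]; exact cv_decay hb hk hX
  have hconj : ∀ ζ, (starRingEnd ℂ) (Cv b₂ X ζ) = 𝓕⁻ (fun x => (starRingEnd ℂ) (b₂ x * u x)) ζ := by
    intro ζ
    rw [hc h₂, Real.fourier_eq, Real.fourierInv_eq, ← integral_conj]
    refine integral_congr_ae (Filter.Eventually.of_forall fun x => ?_)
    simp only [Circle.smul_def, smul_eq_mul, map_mul, ← Circle.coe_inv_eq_conj]
    rw [← AddChar.map_neg_eq_inv, neg_neg]
  have hinv : 𝓕⁻ (𝓕 (fun x => b₁ x * u x)) = fun x => b₁ x * u x :=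
    Continuous.fourierInv_fourier_eq (h₁.cont.mul huc) (hi h₁) (hF h₁)
  refine ⟨?_, ?_, ?_⟩
  · simp only [hconj, hc h₁]
    refine (hF h₁).mul_bdd (c := ∫ x, ‖(starRingEnd ℂ) (b₂ x * u x)‖) ?_ (Filter.Eventually.of_forall fun ζ => ?_)
    · rw [← funext hconj, funext (hc h₂)]
      exact (Complex.continuous_conj.comp (fou_cont (hi h₂))).aestronglyMeasurable
    · rw [Real.fourierInv_eq_fourier_neg]; exact fou_le _ _
  · simp only [hconj, hc h₁]
    simp only [mul_comm (𝓕 (fun x => b₁ x * u x) _)]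
    rw [inv_adj ?_ (hF h₁), hinv]
    · simp only [mul_comm]
    · exact (Complex.conjLIE.toContinuousLinearEquiv : ℂ →L[ℝ] ℂ).integrable_comp (hi h₂)
  · obtain ⟨C, hC0, hC⟩ := h₂.bd
    refine (hi h₁).mul_bdd (c := C * ∫ ζ, ‖X ζ‖) ?_ (Filter.Eventually.of_forall fun x => ?_)
    · exact (Complex.continuous_conj.comp (h₂.cont.mul huc)).aestronglyMeasurable
    · rw [RCLike.norm_conj, norm_mul]
      have h3 : jb x ^ (-k) ≤ 1 := Real.rpow_le_one_of_one_le_of_nonpos (one_le_jb x) (by linarith)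
      have h4 : ‖b₂ x‖ ≤ C := (hC x).trans (mul_le_of_le_one_right hC0 h3)
      exact mul_le_mul h4 (hub x) (norm_nonneg _) hC0

end HE

namespace HE
open scoped FourierTransform

lemma GARD {k a₀ : ℝ} {a : Z n → ℝ} {b : Z n → ℂ} (ha : Bk 0 (fun z => (a z : ℂ))) (hb : Bk k b)
    (hk : 2 * (n:ℝ) + 2 ≤ k) (h0 : ∀ z, a₀ ≤ a z) {X : Z n → ℂ} (hX : Integrable X) :
    Integrable (fun ζ => ‖Cv b X ζ‖ ^ 2) ∧
    Integrable (fun ζ => (Cv (fun z => (a z : ℂ) * b z) X ζ * (starRingEnd ℂ) (Cv b X ζ)).re) ∧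
    a₀ * ∫ ζ, ‖Cv b X ζ‖ ^ 2 ≤
      ∫ ζ, (Cv (fun z => (a z : ℂ) * b z) X ζ * (starRingEnd ℂ) (Cv b X ζ)).re := by
  have hk0 : 0 ≤ k := le_trans (by positivity) hk
  have hab : Bk k (fun z => (a z : ℂ) * b z) := by simpa using ha.mul hb
  obtain ⟨i1, e1, j1⟩ := PL hab hb hk hk0 hX
  obtain ⟨i2, e2, j2⟩ := PL hb hb hk hk0 hX
  have r2 : ∀ ζ, ‖Cv b X ζ‖ ^ 2 = (Cv b X ζ * (starRingEnd ℂ) (Cv b X ζ)).re := fun ζ => by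
    rw [Complex.mul_conj, Complex.ofReal_re, Complex.normSq_eq_norm_sq]
  refine ⟨by simp only [r2]; exact i2.re, i1.re, ?_⟩
  simp only [r2]
  have s1 := integral_re i1
  have s2 := integral_re i2
  have s3 := integral_re j1
  have s4 := integral_re j2
  simp only [RCLike.re_to_complex] at s1 s2 s3 s4
  rw [s1, s2, e1, e2, ← s3, ← s4, ← integral_const_mul]
  refine integral_mono (j2.re.const_mul _) j1.re fun x => ?_
  simp only
  rw [mul_assoc (a x : ℂ), mul_assoc (a x : ℂ), Complex.mul_conj, Complex.re_ofReal_mul]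
  rw [Complex.ofReal_re]
  exact mul_le_mul_of_nonneg_right (h0 x) (Complex.normSq_nonneg _)

lemma th_sv (ρ p M : ℝ) : SV (fun (ε : Set.Ioi (0:ℝ)) (ζ : Z n) => th ρ p M ε.1 ζ) :=
  ((sv_jb.rpow ρ).mul (sv_jm.rpow p)).mul (sv_eps.rpow (-M))

lemma th_cont (ρ p M : ℝ) {ε : ℝ} (hε : 0 < ε) : Continuous (th ρ p M ε : Z n → ℝ) :=
  (th_diff ρ p M hε).continuous

lemma th_le (ρ p : ℝ) {M ε : ℝ} (hM : 0 ≤ M) (hε : 0 < ε) (ζ : Z n) :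
    th ρ p M ε ζ ≤ jb ζ ^ ρ * jm ζ ^ p := by
  have h1 := jb_pos ζ
  have h2 := jm_pos ζ
  refine mul_le_of_le_one_right (by positivity) ?_
  exact Real.rpow_le_one_of_one_le_of_nonpos (by nlinarith [sq_nonneg (jb ζ)]) (by linarith)

lemma th_dec (ρ p : ℝ) {M ε : ℝ} (hM : 0 ≤ M) (hε : 0 < ε) (ζ : Z n) :
    th ρ p M ε ζ ≤ ε ^ (-M) * jb ζ ^ (|ρ| + |p| - 2 * M) := by
  have h1 := jb_pos ζ
  have h2 := jm_pos ζ
  have g1 : jb ζ ^ ρ ≤ jb ζ ^ |ρ| := Real.rpow_le_rpow_of_exponent_le (one_le_jb ζ) (le_abs_self _)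
  have g2 : jm ζ ^ p ≤ jb ζ ^ |p| :=
    (Real.rpow_le_rpow_of_exponent_le (one_le_jm ζ) (le_abs_self _)).trans
      (Real.rpow_le_rpow h2.le (jm_le_jb ζ) (abs_nonneg _))
  have g3 : (1 + ε * jb ζ ^ 2) ^ (-M) ≤ ε ^ (-M) * jb ζ ^ (-(2 * M)) := by
    have : ε ^ (-M) * jb ζ ^ (-(2 * M)) = (ε * jb ζ ^ 2) ^ (-M) := by
      rw [Real.mul_rpow hε.le (by positivity), ← Real.rpow_natCast, ← Real.rpow_mul h1.le]
      congr 2; push_cast; ring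
    rw [this]
    exact Real.rpow_le_rpow_of_nonpos (by positivity) (by linarith) (by linarith)
  calc th ρ p M ε ζ ≤ jb ζ ^ |ρ| * jb ζ ^ |p| * (ε ^ (-M) * jb ζ ^ (-(2 * M))) := by
        unfold th; gcongr
    _ = _ := by rw [sub_eq_add_neg, Real.rpow_add h1, Real.rpow_add h1]; ring

/-- square root of `qq` -/
def Qh (ρ p M σ κ ε : ℝ) (ζ : Z n) : ℝ := th ρ p M ε ζ * (1 + κ * gg σ ζ) ^ (1 / 2 : ℝ)

lemma gg_bd {σ κ : ℝ} (hσ : 0 < σ) (hκ : 0 ≤ κ) (hκ' : κ ≤ 1 / 2) (ζ : Z n) :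
    1 / 2 ≤ 1 + κ * gg σ ζ ∧ 1 + κ * gg σ ζ ≤ 3 / 2 := by
  have := abs_le.1 (abs_gg hσ ζ)
  constructor <;> nlinarith

lemma Qh_sq (ρ p M : ℝ) {σ κ ε : ℝ} (hσ : 0 < σ) (hκ : 0 ≤ κ) (hκ' : κ ≤ 1 / 2) (ζ : Z n) :
    Qh ρ p M σ κ ε ζ ^ 2 = qq ρ p M σ κ ε ζ := by
  unfold Qh qq
  rw [mul_pow, ← Real.rpow_natCast ((1 + κ * gg σ ζ) ^ (1 / 2 : ℝ)), ← Real.rpow_mul (by linarith [(gg_bd hσ hκ hκ' ζ).1])]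
  norm_num

lemma Qh_le (ρ p M : ℝ) {σ κ ε : ℝ} (hσ : 0 < σ) (hκ : 0 ≤ κ) (hκ' : κ ≤ 1 / 2) (hε : 0 < ε) (ζ : Z n) :
    0 < Qh ρ p M σ κ ε ζ ∧ Qh ρ p M σ κ ε ζ ≤ 2 * th ρ p M ε ζ := by
  have hg := gg_bd hσ hκ hκ' ζ
  have ht := th_pos ρ p M hε ζ
  constructor
  · unfold Qh; have := hg.1; have : 0 < 1 + κ * gg σ ζ := by linarith
    positivity
  · unfold Qh
    rw [mul_comm]
    refine mul_le_mul_of_nonneg_right ?_ ht.le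
    refine (Real.rpow_le_rpow (by linarith [hg.1]) (hg.2.trans (by norm_num : (3/2:ℝ) ≤ 2)) (by norm_num)).trans ?_
    exact (Real.rpow_le_rpow_of_exponent_le (by norm_num) (by norm_num : (1/2:ℝ) ≤ 1)).trans (by simp)

lemma Qh_sv (ρ p M : ℝ) {σ κ : ℝ} (hσ : 0 < σ) (hκ : 0 ≤ κ) (hκ' : κ ≤ 1 / 2) :
    SV (fun (ε : Set.Ioi (0:ℝ)) (ζ : Z n) => Qh ρ p M σ κ ε.1 ζ) :=
  (th_sv ρ p M).mul ((sv_gg hσ hκ hκ').rpow _)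

lemma Qh_cont (ρ p M : ℝ) {σ κ ε : ℝ} (hσ : 0 < σ) (hκ : 0 ≤ κ) (hκ' : κ ≤ 1 / 2) (hε : 0 < ε) :
    Continuous (Qh ρ p M σ κ ε : Z n → ℝ) := by
  refine (th_cont ρ p M hε).mul ?_
  refine Continuous.rpow_const (continuous_const.add (continuous_const.mul (gg_cont σ))) fun ζ => Or.inl ?_
  linarith [(gg_bd hσ hκ hκ' ζ).1]

/-- the algebra of the energy inequality -/
lemma energy_alg {a₀ κ K L0 H H2 H3 : ℝ} (hK : 0 ≤ K) (hκ : 0 < κ) (hκa : 12 * κ ≤ a₀)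
    (hH3 : 0 ≤ H3) (hH2 : 0 ≤ H2) (hH : 0 ≤ H)
    {J Dq t q je2 rr x : ℝ} (ht : 0 < t) (hq1 : q ≤ 3 / 2 * t ^ 2) (hq2 : t ^ 2 ≤ 2 * q)
    (hrr : 0 ≤ rr) (hje : 0 ≤ je2) (hx : 0 ≤ x)
    (hD : t ^ 2 * (-(3 * L0) + κ * (rr ^ 2 - 6 * je2)) ≤ Dq) (hL : 0 ≤ L0)
    {reA reB B2 E2 R cG cT : ℝ} (hB2 : 0 ≤ B2) (hE2 : 0 ≤ E2) (hcG : 0 ≤ cG) (hcT : 0 ≤ cT)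
    (h0 : -(1 / 2) * J + 1 / 2 * Dq * x ^ 2 + reA ≤ q * (cG + cT + R) * x)
    (h1 : reB - 3 * (K * H) ^ 2 ≤ reA)
    (h2 : q * je2 * x ^ 2 ≤ (B2 + E2) ^ 2) (h3 : E2 ≤ K * H)
    (h4 : q * R * x ≤ (K * H) ^ 2) (h5 : t * x ≤ K * H) (h6 : t * cT ≤ H3) (h7 : t * cG ≤ K * rr * H2) :
    κ / 4 * (t * rr * x) ^ 2 ≤ 1 / 2 * J + (a₀ * B2 ^ 2 - reB) +
      (a₀ * K ^ 2 + 2 * L0 * K ^ 2 + 4 * K ^ 2 + 3 * K ^ 2 / κ + 2 * K) * (H ^ 2 + H2 ^ 2 + H3 ^ 2) := by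
  have hq0 : 0 ≤ q := by have := sq_nonneg t; linarith
  have m1 : 1 / 2 * (t ^ 2 * (-(3 * L0) + κ * (rr ^ 2 - 6 * je2))) * x ^ 2 ≤ 1 / 2 * Dq * x ^ 2 := by
    gcongr
  have m2 : (t * x) ^ 2 ≤ K ^ 2 * H ^ 2 := by rw [← mul_pow]; gcongr
  have m3 : E2 ^ 2 ≤ K ^ 2 * H ^ 2 := by rw [← mul_pow]; gcongr
  have m4 : t ^ 2 * je2 * x ^ 2 ≤ 4 * B2 ^ 2 + 4 * E2 ^ 2 := by
    have : t ^ 2 * je2 * x ^ 2 ≤ 2 * q * je2 * x ^ 2 := by gcongr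
    have z1 := sq_nonneg (B2 - E2)
    have z2 : (B2 + E2) ^ 2 = B2 ^ 2 + E2 ^ 2 + 2 * (B2 * E2) := by ring
    have z3 : (B2 - E2) ^ 2 = B2 ^ 2 + E2 ^ 2 - 2 * (B2 * E2) := by ring
    linarith
  have m5 : q * cG * x ≤ 3 / 2 * (K * H2) * (t * rr * x) := by
    calc q * cG * x ≤ 3 / 2 * t ^ 2 * cG * x := by gcongr
      _ = 3 / 2 * (t * cG) * (t * x) := by ring
      _ ≤ 3 / 2 * (K * rr * H2) * (t * x) := by gcongr
      _ = _ := by ring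
  have m6 : q * cT * x ≤ 3 / 2 * H3 * (K * H) := by
    calc q * cT * x ≤ 3 / 2 * t ^ 2 * cT * x := by gcongr
      _ = 3 / 2 * (t * cT) * (t * x) := by ring
      _ ≤ 3 / 2 * H3 * (K * H) := by gcongr
  have m7 : 3 / 2 * (K * H2) * (t * rr * x) ≤ κ / 4 * (t * rr * x) ^ 2 + 3 * K ^ 2 / κ * H2 ^ 2 := by
    have e : κ / 4 * (t * rr * x) ^ 2 + 3 * K ^ 2 / κ * H2 ^ 2 - 3 / 2 * (K * H2) * (t * rr * x) =
      (κ * (t * rr * x) / 2 - 3 / 2 * (K * H2)) ^ 2 / κ + 3 / 4 * (K * H2) ^ 2 / κ := by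
      field_simp; ring
    have : 0 ≤ (κ * (t * rr * x) / 2 - 3 / 2 * (K * H2)) ^ 2 / κ + 3 / 4 * (K * H2) ^ 2 / κ := by positivity
    linarith
  have m8 : 3 / 2 * H3 * (K * H) ≤ K * (H ^ 2 + H3 ^ 2) := by
    have z1 := mul_nonneg hK (sq_nonneg (H - H3))
    have z2 := mul_nonneg hK (sq_nonneg H)
    have z3 := mul_nonneg hK (sq_nonneg H3)
    linarith
  have m9 : 3 * κ * (t ^ 2 * je2 * x ^ 2) ≤ a₀ * B2 ^ 2 + a₀ * (K ^ 2 * H ^ 2) := by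
    have : 3 * κ * (t ^ 2 * je2 * x ^ 2) ≤ 3 * κ * (4 * B2 ^ 2 + 4 * E2 ^ 2) := by gcongr
    have z1 := mul_le_mul_of_nonneg_right hκa (sq_nonneg B2)
    have z2 := mul_le_mul_of_nonneg_right hκa (sq_nonneg E2)
    have z3 := mul_le_mul_of_nonneg_left m3 (by linarith : 0 ≤ a₀)
    linarith
  have m10 : L0 * (t * x) ^ 2 ≤ L0 * (K ^ 2 * H ^ 2) := by gcongr
  have ha : 0 ≤ a₀ := by linarith
  have p1 : 0 ≤ (a₀ * K ^ 2 + 2 * L0 * K ^ 2 + 4 * K ^ 2) * (H2 ^ 2 + H3 ^ 2) := by positivity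
  have p2 : 0 ≤ 3 * K ^ 2 / κ * (H ^ 2 + H3 ^ 2) := by positivity
  have p3 : 0 ≤ K * H ^ 2 := by positivity
  have p4 : 0 ≤ L0 * (K ^ 2 * H ^ 2) := by positivity
  have p5 : q * (cG + cT + R) * x = q * cG * x + q * cT * x + q * R * x := by ring
  rw [p5] at h0
  generalize 3 * K ^ 2 / κ = W at *
  have p6 : 0 ≤ K * H3 ^ 2 := by positivity
  have p7 : 0 ≤ K * H2 ^ 2 := by positivity
  linarith

end HE

namespace HE
open scoped FourierTransform

lemma cv_cmul (α : ℂ) (c Y : Z n → ℂ) (ζ : Z n) : Cv (fun z => α * c z) Y ζ = α * Cv c Y ζ := by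
  rw [Cv, Cv, ← integral_const_mul]
  refine integral_congr_ae (Filter.Eventually.of_forall fun x => ?_)
  simp only
  have : 𝓕 (fun z => α * c z) (ζ - x) = α * 𝓕 c (ζ - x) := by
    rw [Real.fourier_eq, Real.fourier_eq, ← integral_const_mul]
    refine integral_congr_ae (Filter.Eventually.of_forall fun x => ?_)
    simp only [Circle.smul_def, smul_eq_mul]; ring
  rw [this]; ring

lemma cv_fd_eV {k : ℝ} {c : Z n → ℂ} (h : Bk k c) (hk : 2 * (n:ℝ) + 3 ≤ k) {Y : Z n → ℂ}
    (hY : GI Y) (ζ : Z n) (i : Fin n) : fderiv ℝ (Cv c Y) ζ (eV i) =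
      -(2 * π * Complex.I * Cv (fun z => c z * ((vC z i : ℝ) : ℂ)) Y ζ) := by
  rw [(cv_fd h hk hY ζ).2, ← neg_mul (2 * (π:ℂ) * Complex.I), ← cv_cmul]
  refine congrArg (fun c' => Cv c' Y ζ) (funext fun z => ?_)
  have : (inner ℝ (eV i) z : ℝ) = vC z i := by
    rw [eV, EuclideanSpace.inner_single_left]; simp [vC]
  rw [this]; ring

lemma int_dec {F : Z n → ℝ} (hF : AEStronglyMeasurable F) {C r : ℝ} (hr : r ≤ -(2 * (n:ℝ) + 2))
    (hC : 0 ≤ C) (h : ∀ ζ, |F ζ| ≤ C * jb ζ ^ r) : Integrable F := by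
  refine ((jb_int (n := n) (le_refl (2 * (n:ℝ) + 2))).const_mul C).mono' hF (Filter.Eventually.of_forall fun ζ => ?_)
  refine (h ζ).trans ?_
  gcongr
  exact one_le_jb ζ

lemma xC_le_jb (ζ : Z n) (i : Fin n) : |xC ζ i| ≤ jb ζ :=
  ((Real.norm_eq_abs _).symm.le.trans (PiLp.norm_apply_le _ i)).trans ((norm_xC_le_jm ζ).trans (jm_le_jb ζ))

lemma eV_in (ζ : Z n) (i : Fin n) : |(inner ℝ (vC ζ) (vC (eV i : Z n)) : ℝ)| ≤ 1 * jm ζ ^ 2 := by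
  have h1 := abs_real_inner_le_norm (vC ζ) (vC (eV i : Z n))
  have h2 : ‖vC (eV i : Z n)‖ ≤ 1 := (norm_vC_le _).trans (norm_eV i).le
  have h3 := (norm_vC_le_je ζ).trans (je_le_jm ζ)
  have h4 := one_le_jm ζ
  have h5 : ‖vC ζ‖ * ‖vC (eV i : Z n)‖ ≤ jm ζ * 1 := by gcongr
  nlinarith

lemma transport {k : ℝ} {c : Z n → ℂ} (hc : Bk k c) (hk : 2 * (n:ℝ) + 4 ≤ k) {h : Z n → ℂ}
    (hh : GI h) (ρ p : ℝ) {σ : ℝ} (hσ : 0 < σ) (hσ1 : σ < 1) {κ : ℝ} (hκ : 0 ≤ κ) (hκ' : κ ≤ 1 / 2) :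
    ∃ M0 : ℝ, 0 ≤ M0 ∧ ∀ M ≥ M0, ∀ ε > 0, ∃ J : Z n → ℝ, Integrable J ∧ ∫ ζ, J ζ = 0 ∧
      ∀ ζ, J ζ = fderiv ℝ (qq ρ p M σ κ ε) ζ (dv ζ) * ‖Cv c h ζ‖ ^ 2 -
        2 * (qq ρ p M σ κ ε ζ * ((∑ i : Fin n, 2 * π * Complex.I * ((xC ζ i : ℝ) : ℂ) *
          Cv (fun z => c z * ((vC z i : ℝ) : ℂ)) h ζ) * (starRingEnd ℂ) (Cv c h ζ)).re) := by
  have hk1 : 2 * (n:ℝ) + 3 ≤ k := by linarith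
  have hv : ∀ i, Bk (k - 1) (fun z => c z * ((vC z i : ℝ) : ℂ)) := fun i => by
    have := hc.mul (Bk.v (n := n) i); rwa [← sub_eq_add_neg] at this
  obtain ⟨C1, L1, hC1, h1⟩ := cv_bd hc (by linarith) hh
  choose C2 L2 hC2 h2 using fun i => cv_bd (hv i) (by linarith) hh
  set f := Cv c h with hf
  have hfd : Differentiable ℝ f := fun ζ => (cv_fd hc hk1 hh ζ).1
  set A := |ρ| + |p| with hA
  have hA0 : 0 ≤ A := by positivity
  set L : ℝ := L1 + ∑ i, (L2 i : ℝ) with hL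
  have hL2 : ∀ i, (L2 i : ℝ) ≤ L := fun i => by
    have := Finset.single_le_sum (f := fun i => (L2 i : ℝ)) (fun i _ => Nat.cast_nonneg _) (Finset.mem_univ i)
    have h' : (0:ℝ) ≤ L1 := Nat.cast_nonneg _
    rw [hL]; linarith
  have hL1 : (L1 : ℝ) ≤ L := by
    have : 0 ≤ ∑ i, (L2 i : ℝ) := Finset.sum_nonneg fun i _ => Nat.cast_nonneg _
    rw [hL]; linarith
  refine ⟨A + L + n + 10, by positivity, fun M hM ε hε => ?_⟩
  have hM0 : 0 ≤ M := by linarith [Nat.cast_nonneg (α := ℝ) n, Nat.cast_nonneg (α := ℝ) L1]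
  set Φ : Z n → ℝ := fun ζ => qq ρ p M σ κ ε ζ * ‖f ζ‖ ^ 2 with hΦ
  have hqd := qq_diff (n := n) ρ p M σ κ hε
  have hnd : Differentiable ℝ (fun ζ => ‖f ζ‖ ^ 2) := fun ζ => (hfd ζ).norm_sq ℝ
  have hΦd : Differentiable ℝ Φ := hqd.mul hnd
  have hder : ∀ ζ e, fderiv ℝ Φ ζ e = fderiv ℝ (qq ρ p M σ κ ε) ζ e * ‖f ζ‖ ^ 2 +
      2 * (qq ρ p M σ κ ε ζ * (fderiv ℝ f ζ e * (starRingEnd ℂ) (f ζ)).re) := by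
    intro ζ e
    rw [hΦ, fderiv_fun_mul (hqd ζ) (hnd ζ)]
    have : fderiv ℝ (fun ζ => ‖f ζ‖ ^ 2) ζ = 2 • (innerSL ℝ (f ζ)).comp (fderiv ℝ f ζ) :=
      (hfd ζ).hasFDerivAt.norm_sq.fderiv
    rw [this]
    simp only [add_apply, smul_apply, smul_eq_mul, ContinuousLinearMap.comp_apply, innerSL_apply_apply,
      Complex.inner]
    ring_nf
  -- bounds
  have hj : ∀ ζ : Z n, 0 < jb ζ := jb_pos
  have hfb : ∀ ζ, ‖f ζ‖ ≤ C1 * jb ζ ^ L := fun ζ => (h1 ζ).trans (by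
    gcongr; exact one_le_jb ζ)
  set B := C1 + ∑ i, 2 * π * C2 i with hB
  have hB0 : 0 ≤ B := add_nonneg hC1 (Finset.sum_nonneg fun i _ => mul_nonneg (by positivity) (hC2 i))
  have hBi : ∀ i, 2 * π * C2 i ≤ B := fun i => by
    have := Finset.single_le_sum (f := fun i => 2 * π * C2 i) (fun i _ => mul_nonneg (by positivity) (hC2 i))
      (Finset.mem_univ i)
    linarith
  have hB1 : C1 ≤ B := by
    have : 0 ≤ ∑ i, 2 * π * C2 i := Finset.sum_nonneg fun i _ => mul_nonneg (by positivity) (hC2 i)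
    linarith
  have hfb' : ∀ ζ, ‖f ζ‖ ≤ B * jb ζ ^ L := fun ζ => (hfb ζ).trans (mul_le_mul_of_nonneg_right hB1 (jbr_pos ζ L).le)
  have hfib : ∀ ζ i, ‖fderiv ℝ f ζ (eV i)‖ ≤ B * jb ζ ^ L := fun ζ i => by
    rw [hf, cv_fd_eV hc hk1 hh, norm_neg, norm_mul]
    have e : ‖(2 * π * Complex.I : ℂ)‖ = 2 * π := by
      simp [abs_of_pos Real.pi_pos]
    rw [e]
    calc 2 * π * ‖Cv (fun z => c z * ((vC z i : ℝ) : ℂ)) h ζ‖ ≤ 2 * π * (C2 i * jb ζ ^ (L2 i : ℝ)) := by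
          gcongr; exact h2 i ζ
      _ = 2 * π * C2 i * jb ζ ^ (L2 i : ℝ) := by ring
      _ ≤ B * jb ζ ^ L := by
        refine mul_le_mul (hBi i) ?_ (jbr_pos ζ _).le hB0
        exact Real.rpow_le_rpow_of_exponent_le (one_le_jb ζ) (hL2 i)
  set t := th (n := n) ρ p M ε with ht
  have htp : ∀ ζ, 0 < t ζ := th_pos ρ p M hε
  have htb : ∀ ζ, t ζ ≤ ε ^ (-M) * jb ζ ^ (A - 2 * M) := th_dec ρ p hM0 hε
  set D := 3 * (|ρ| + |p| + 2 * |M|) + 5 with hD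
  have hD0 : 0 ≤ D := by positivity
  have hqb : ∀ ζ, |qq ρ p M σ κ ε ζ| ≤ D * t ζ ^ 2 := fun ζ => by
    have hg := gg_bd (n := n) hσ hκ hκ' ζ
    unfold qq
    rw [abs_of_nonneg (mul_nonneg (sq_nonneg _) (by linarith [hg.1])), mul_comm]
    gcongr
    have : 0 ≤ 3 * (|ρ| + |p| + 2 * |M|) := by positivity
    linarith [hg.2]
  have hqib : ∀ ζ i, |fderiv ℝ (qq ρ p M σ κ ε) ζ (eV i)| ≤ D * t ζ ^ 2 * jb ζ ^ 3 := fun ζ i => by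
    have hg := gg_bd (n := n) hσ hκ hκ' ζ
    rw [fderiv_qq ρ p M κ hσ hε ζ _ (tC_eV i) (xC_eV i), abs_mul, abs_of_nonneg (sq_nonneg _)]
    have a1 := abs_lth ρ p M hε ζ (eV i) 1 (eV_in ζ i)
    have a2 := abs_dgg_eV hσ hσ1 ζ i
    have a3 : |2 * lth ρ p M ε ζ (eV i) * (1 + κ * gg σ ζ) + κ * dgg σ ζ (eV i)| ≤ D * jb ζ ^ 3 := by
      refine (abs_add_le _ _).trans ?_
      rw [abs_mul, abs_mul, abs_mul, abs_two, abs_of_nonneg hκ, abs_of_nonneg (by linarith [hg.1] : 0 ≤ 1 + κ * gg σ ζ)]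
      have hj3 : 1 ≤ jb ζ ^ 3 := one_le_jbpow ζ 3
      calc 2 * |lth ρ p M ε ζ (eV i)| * (1 + κ * gg σ ζ) + κ * |dgg σ ζ (eV i)|
          ≤ 2 * (1 * (|ρ| + |p| + 2 * |M|)) * (3 / 2) + 1 / 2 * (5 * jb ζ ^ 3) := by
            gcongr
            · linarith [hg.1]
            · exact hg.2
        _ = 3 * (|ρ| + |p| + 2 * |M|) * 1 + 5 / 2 * jb ζ ^ 3 := by ring
        _ ≤ 3 * (|ρ| + |p| + 2 * |M|) * jb ζ ^ 3 + 5 * jb ζ ^ 3 := by gcongr; norm_num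
        _ = _ := by rw [hD]; ring
    calc _ ≤ t ζ ^ 2 * (D * jb ζ ^ 3) := by gcongr
      _ = _ := by ring
  set r : ℝ := 2 * (A - 2 * M) + 2 * L + 4 with hr
  have hrn : r ≤ -(2 * (n:ℝ) + 2) := by rw [hr]; linarith [Nat.cast_nonneg (α := ℝ) n, Nat.cast_nonneg (α := ℝ) L1]
  have hpow : ∀ ζ : Z n, (ε ^ (-M) * jb ζ ^ (A - 2 * M)) ^ 2 * (B * jb ζ ^ L) ^ 2 * jb ζ ^ 4 =
      (ε ^ (-M)) ^ 2 * B ^ 2 * jb ζ ^ r := fun ζ => by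
    have e4 : jb ζ ^ (4:ℝ) = jb ζ ^ 4 := by rw [← Real.rpow_natCast]; norm_num
    have e5 : ∀ x : ℝ, jb ζ ^ (2 * x) = (jb ζ ^ x) ^ 2 := fun x => by
      rw [← Real.rpow_natCast, ← Real.rpow_mul (hj ζ).le]; congr 1; push_cast; ring
    rw [hr, Real.rpow_add (hj ζ) (2 * (A - 2 * M) + 2 * L) 4, Real.rpow_add (hj ζ) (2 * (A - 2 * M)) (2 * L), e4,
      e5 (A - 2 * M), e5 L]
    ring
  set C := 3 * D * ((ε ^ (-M)) ^ 2 * B ^ 2) with hC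
  have hC0 : 0 ≤ C := by positivity
  have hi1 : ∀ i, Integrable (fun ζ => xC ζ i * fderiv ℝ Φ ζ (eV i)) := fun i => by
    refine int_dec ?_ hrn hC0 fun ζ => ?_
    · refine AEStronglyMeasurable.mul ?_ (measurable_fderiv_apply_const ℝ Φ (eV i)).aestronglyMeasurable
      have : Continuous fun ζ : Z n => xC ζ i := (EuclideanSpace.proj (𝕜 := ℝ) i).continuous.comp xC_cont
      exact this.aestronglyMeasurable
    · rw [abs_mul, hder]
      have hre : |(fderiv ℝ f ζ (eV i) * (starRingEnd ℂ) (f ζ)).re| ≤ (B * jb ζ ^ L) * (B * jb ζ ^ L) := by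
        refine (Complex.abs_re_le_norm _).trans ?_
        rw [norm_mul, RCLike.norm_conj]
        exact mul_le_mul (hfib ζ i) (hfb' ζ) (norm_nonneg _) (by have := hj ζ; positivity)
      have hx := xC_le_jb ζ i
      have hj3 : 1 ≤ jb ζ ^ 3 := one_le_jbpow ζ 3
      have := hj ζ
      have := htp ζ
      calc |xC ζ i| * |fderiv ℝ (qq ρ p M σ κ ε) ζ (eV i) * ‖f ζ‖ ^ 2 +
            2 * (qq ρ p M σ κ ε ζ * (fderiv ℝ f ζ (eV i) * (starRingEnd ℂ) (f ζ)).re)|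
          ≤ jb ζ * (D * t ζ ^ 2 * jb ζ ^ 3 * (B * jb ζ ^ L) ^ 2 +
            2 * (D * t ζ ^ 2 * ((B * jb ζ ^ L) * (B * jb ζ ^ L)))) := by
            refine mul_le_mul hx ((abs_add_le _ _).trans (add_le_add ?_ ?_)) (abs_nonneg _) (hj ζ).le
            · rw [abs_mul, abs_of_nonneg (sq_nonneg ‖f ζ‖)]
              gcongr
              · exact hqib ζ i
              · exact hfb' ζ
            · rw [abs_mul, abs_mul, abs_two]
              gcongr
              exact hqb ζ
        _ = D * t ζ ^ 2 * (B * jb ζ ^ L) ^ 2 * jb ζ * (jb ζ ^ 3 + 2 * 1) := by ring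
        _ ≤ D * (ε ^ (-M) * jb ζ ^ (A - 2 * M)) ^ 2 * (B * jb ζ ^ L) ^ 2 * jb ζ * (jb ζ ^ 3 + 2 * jb ζ ^ 3) := by
          gcongr
          exact htb ζ
        _ = 3 * D * ((ε ^ (-M) * jb ζ ^ (A - 2 * M)) ^ 2 * (B * jb ζ ^ L) ^ 2 * jb ζ ^ 4) := by ring
        _ = _ := by rw [hpow, hC]; ring
  have hi2 : ∀ i, Integrable (fun ζ => xC ζ i * Φ ζ) := fun i => by
    refine int_dec ?_ hrn hC0 fun ζ => ?_
    · have : Continuous fun ζ : Z n => xC ζ i := (EuclideanSpace.proj (𝕜 := ℝ) i).continuous.comp xC_cont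
      exact (this.mul hΦd.continuous).aestronglyMeasurable
    · have hx := xC_le_jb ζ i
      have hj3 : 1 ≤ jb ζ ^ 3 := one_le_jbpow ζ 3
      have := hj ζ
      have := htp ζ
      rw [abs_mul, hΦ]
      simp only
      rw [abs_mul, abs_of_nonneg (sq_nonneg ‖f ζ‖)]
      calc |xC ζ i| * (|qq ρ p M σ κ ε ζ| * ‖f ζ‖ ^ 2) ≤ jb ζ * (D * t ζ ^ 2 * (B * jb ζ ^ L) ^ 2) := by
            gcongr
            · exact hqb ζ
            · exact hfb' ζ
        _ = D * t ζ ^ 2 * (B * jb ζ ^ L) ^ 2 * jb ζ * 1 := by ring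
        _ ≤ D * (ε ^ (-M) * jb ζ ^ (A - 2 * M)) ^ 2 * (B * jb ζ ^ L) ^ 2 * jb ζ * (3 * jb ζ ^ 3) := by
          gcongr
          · exact htb ζ
          · linarith
        _ = 3 * D * ((ε ^ (-M) * jb ζ ^ (A - 2 * M)) ^ 2 * (B * jb ζ ^ L) ^ 2 * jb ζ ^ 4) := by ring
        _ = _ := by rw [hpow, hC]; ring
  have hxd : ∀ i (ζ : Z n), HasFDerivAt (fun ζ : Z n => xC ζ i) ((EuclideanSpace.proj (𝕜 := ℝ) i).comp (xL (n := n))) ζ :=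
    fun i ζ => ((EuclideanSpace.proj (𝕜 := ℝ) i).comp (xL (n := n))).hasFDerivAt
  have hx0 : ∀ i (ζ : Z n), fderiv ℝ (fun ζ : Z n => xC ζ i) ζ (eV i) = 0 := fun i ζ => by
    rw [(hxd i ζ).fderiv]; simp [xC_eV]
  refine ⟨fun ζ => ∑ i, xC ζ i * fderiv ℝ Φ ζ (eV i), integrable_finsetSum _ fun i _ => hi1 i, ?_, fun ζ => ?_⟩
  · rw [integral_finsetSum _ fun i _ => hi1 i]
    refine Finset.sum_eq_zero fun i _ => ?_
    rw [integral_mul_fderiv_eq_neg_fderiv_mul_of_integrable (f := fun ζ : Z n => xC ζ i) (g := Φ) (v := eV i)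
      (by simp [hx0]) (hi1 i) (hi2 i) (fun ζ _ => (hxd i ζ).differentiableAt) (fun ζ _ => hΦd ζ)]
    simp [hx0]
  · have e1 : ∑ i, xC ζ i * fderiv ℝ Φ ζ (eV i) = fderiv ℝ Φ ζ (dv ζ) := by
      rw [dv, map_sum]; simp only [map_smul, smul_eq_mul]
    have e2 : fderiv ℝ f ζ (dv ζ) = -∑ i : Fin n, 2 * π * Complex.I * ((xC ζ i : ℝ) : ℂ) *
          Cv (fun z => c z * ((vC z i : ℝ) : ℂ)) h ζ := by
      rw [dv, map_sum, ← Finset.sum_neg_distrib]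
      refine Finset.sum_congr rfl fun i _ => ?_
      rw [map_smul, hf, cv_fd_eV hc hk1 hh, Complex.real_smul]; ring
    simp only
    rw [e1, hder, e2, neg_mul, Complex.neg_re]; ring

end HE

namespace HE
open scoped FourierTransform

lemma je_rp_le (ζ : Z n) (x : ℝ) : je ζ ^ x ≤ jb ζ ^ |x| :=
  (Real.rpow_le_rpow_of_exponent_le (one_le_je ζ) (le_abs_self x)).trans
    (Real.rpow_le_rpow (je_pos ζ).le ((je_le_jm ζ).trans (jm_le_jb ζ)) (abs_nonneg x))

lemma je_mono (ζ : Z n) {x y : ℝ} (h : x ≤ y) : je ζ ^ x ≤ je ζ ^ y :=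
  Real.rpow_le_rpow_of_exponent_le (one_le_je ζ) h

lemma Qh_W {ρ p M σ κ ε : ℝ} (hσ : 0 < σ) (hκ : 0 ≤ κ) (hκ' : κ ≤ 1 / 2) (hM : 0 ≤ M) (hε : 0 < ε) (ζ : Z n)
    {x : ℝ} (hx : x ≤ k0 σ / 2) :
    Qh ρ p M σ κ ε ζ * je ζ ^ x ≤ 2 * (jb ζ ^ ρ * jm ζ ^ p * je ζ ^ (k0 σ / 2)) := by
  have h1 := Qh_le ρ p M hσ hκ hκ' hε ζ
  have h2 := th_le ρ p hM hε ζ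
  have h3 := je_mono ζ hx
  have h4 := jer_pos ζ x
  calc _ ≤ (2 * (jb ζ ^ ρ * jm ζ ^ p)) * je ζ ^ (k0 σ / 2) :=
        mul_le_mul (h1.2.trans (by linarith)) h3 h4.le (by linarith [h1.1, h1.2])
    _ = _ := by ring

lemma gi_Qh {ρ p M σ κ ε : ℝ} (hσ : 0 < σ) (hκ : 0 ≤ κ) (hκ' : κ ≤ 1 / 2) (hM : 0 ≤ M) (hε : 0 < ε)
    {Y : Z n → ℂ} (hY : GI Y) (x : ℝ) : GI (fun ζ => ((Qh ρ p M σ κ ε ζ * je ζ ^ x : ℝ) : ℂ) * Y ζ) := by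
  refine hY.mul_bd (C := 2 * ε ^ (-M)) (r := |ρ| + |p| - 2 * M + |x|) ?_ fun ζ => ?_
  · exact (Complex.continuous_ofReal.comp ((Qh_cont ρ p M hσ hκ hκ' hε).mul (jer_cont x))).aestronglyMeasurable
  · have h1 := Qh_le ρ p M hσ hκ hκ' hε ζ
    have h2 := th_dec ρ p hM hε ζ
    have h3 := je_rp_le ζ x
    have h4 := jer_pos ζ x
    rw [Complex.norm_real, Real.norm_of_nonneg (mul_nonneg h1.1.le h4.le), Real.rpow_add (jb_pos ζ)]
    calc _ ≤ (2 * (ε ^ (-M) * jb ζ ^ (|ρ| + |p| - 2 * M))) * jb ζ ^ |x| :=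
        mul_le_mul (h1.2.trans (by linarith)) h3 h4.le (by linarith [h1.1, h1.2])
      _ = _ := by ring

lemma gi_je {Y : Z n → ℂ} (hY : GI Y) (x : ℝ) : GI (fun ζ => ((je ζ ^ x : ℝ) : ℂ) * Y ζ) := by
  refine hY.mul_bd (C := 1) (r := |x|) ?_ fun ζ => ?_
  · exact (Complex.continuous_ofReal.comp (jer_cont x)).aestronglyMeasurable
  · rw [Complex.norm_real, Real.norm_of_nonneg (jer_pos ζ x).le, one_mul]
    exact je_rp_le ζ x

/-- uniform commutator bounds -/
lemma e_comm {k : ℝ} {b : Z n → ℂ} (hb : Bk k b) (hk : 2 * (n:ℝ) + 2 ≤ k) (ρ p : ℝ) {M σ κ : ℝ} (hσ : 0 < σ)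
    (hκ : 0 ≤ κ) (hκ' : κ ≤ 1 / 2) (hM : 0 ≤ M) {Y : Z n → ℂ} (hY : GI Y)
    (hW : MemLp (fun ζ => jb ζ ^ ρ * jm ζ ^ p * je ζ ^ (k0 σ / 2) * ‖Y ζ‖) 2) (x y : ℝ) (hxy : x + y = σ) :
    ∃ K, 0 ≤ K ∧ ∀ ε > 0, ∀ ζ, je ζ ^ (1 / 2 : ℝ) *
      ‖((Qh ρ p M σ κ ε ζ * je ζ ^ x : ℝ) : ℂ) * Cv b (fun ζ => ((je ζ ^ y : ℝ) : ℂ) * Y ζ) ζ -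
        Cv b (fun ζ => ((Qh ρ p M σ κ ε ζ * je ζ ^ σ : ℝ) : ℂ) * Y ζ) ζ‖ ≤
      K * HH (fun ζ => jb ζ ^ ρ * jm ζ ^ p * je ζ ^ (k0 σ / 2) * ‖Y ζ‖) ζ := by
  obtain ⟨K, hK, h⟩ := CM (ι := Set.Ioi (0:ℝ)) hb hk (lam := fun _ ζ => je ζ ^ (1 / 2 : ℝ))
    (p := fun ε ζ => Qh ρ p M σ κ ε.1 ζ * je ζ ^ x) ((sv_je.rpow (1/2)).md)
    ((Qh_sv ρ p M hσ hκ hκ').mul (sv_je.rpow x)) 2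
  refine ⟨K, hK, fun ε hε ζ => ?_⟩
  have he : ∀ ζ' : Z n, ((Qh ρ p M σ κ ε ζ' * je ζ' ^ x : ℝ) : ℂ) * (((je ζ' ^ y : ℝ) : ℂ) * Y ζ') =
      ((Qh ρ p M σ κ ε ζ' * je ζ' ^ σ : ℝ) : ℂ) * Y ζ' := fun ζ' => by
    rw [← hxy, Real.rpow_add (je_pos ζ')]; push_cast; ring
  have := h ⟨ε, hε⟩ (fun ζ => ((je ζ ^ y : ℝ) : ℂ)) Y (fun ζ => jb ζ ^ ρ * jm ζ ^ p * je ζ ^ (k0 σ / 2)) ζ hW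
    (fun ζ' => ?_) (gi_je hY y) ?_ fun ζ' => ?_
  · simp only [he] at this
    exact this
  · have := jb_pos ζ'; have := jm_pos ζ'; have := je_pos ζ'; positivity
  · simp only [he]; exact gi_Qh hσ hκ hκ' hM hε hY σ
  · simp only
    rw [Complex.norm_real, Real.norm_of_nonneg (jer_pos ζ' y).le]
    have e : je ζ' ^ (1 / 2 : ℝ) * (Qh ρ p M σ κ ε ζ' * je ζ' ^ x / je ζ') * je ζ' ^ y =
        Qh ρ p M σ κ ε ζ' * je ζ' ^ (σ - 1 / 2) := by
      have : σ - 1 / 2 = 1 / 2 + x - 1 + y := by linarith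
      rw [this, Real.rpow_add (je_pos ζ'), Real.rpow_sub (je_pos ζ'), Real.rpow_add (je_pos ζ'), Real.rpow_one]
      ring
    rw [e]
    refine Qh_W hσ hκ hκ' hM hε ζ' ?_
    have := le_max_left (2 * σ - 1) 0
    rw [k0]; linarith

/-- uniform multiplier bounds -/
lemma e_mult {k : ℝ} {b : Z n → ℂ} (hb : Bk k b) (hk : 2 * (n:ℝ) + 2 ≤ k) (ρ p : ℝ) {M σ κ : ℝ} (hσ : 0 < σ)
    (hκ : 0 ≤ κ) (hκ' : κ ≤ 1 / 2) (hM : 0 ≤ M) {Y : Z n → ℂ}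
    (hW : MemLp (fun ζ => jb ζ ^ ρ * jm ζ ^ p * je ζ ^ (k0 σ / 2) * ‖Y ζ‖) 2) (x y C : ℝ) (hC : 0 ≤ C)
    (hxy : x + y ≤ k0 σ / 2) {g : Z n → ℂ} (hg : ∀ ζ, ‖g ζ‖ ≤ C * je ζ ^ y) :
    ∃ K, 0 ≤ K ∧ ∀ ε > 0, ∀ ζ, Qh ρ p M σ κ ε ζ * je ζ ^ x * ‖Cv b (fun ζ => g ζ * Y ζ) ζ‖ ≤
      K * HH (fun ζ => jb ζ ^ ρ * jm ζ ^ p * je ζ ^ (k0 σ / 2) * ‖Y ζ‖) ζ := by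
  obtain ⟨K, hK, h⟩ := ML (ι := Set.Ioi (0:ℝ)) hb hk (lam := fun ε ζ => Qh ρ p M σ κ ε.1 ζ * je ζ ^ x)
    ((Qh_sv ρ p M hσ hκ hκ').mul (sv_je.rpow x)).md (C * 2)
  refine ⟨K, hK, fun ε hε ζ => ?_⟩
  refine h ⟨ε, hε⟩ g Y (fun ζ => jb ζ ^ ρ * jm ζ ^ p * je ζ ^ (k0 σ / 2)) ζ hW
    (fun ζ' => ?_) fun ζ' => ?_
  · have := jb_pos ζ'; have := jm_pos ζ'; have := je_pos ζ'; positivity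
  · have h1 := Qh_W (ρ := ρ) (p := p) hσ hκ hκ' hM hε ζ' hxy
    rw [Real.rpow_add (je_pos ζ')] at h1
    have h2 := (Qh_le ρ p M hσ hκ hκ' hε ζ').1
    have h3 := jer_pos ζ' x
    calc _ ≤ Qh ρ p M σ κ ε ζ' * je ζ' ^ x * (C * je ζ' ^ y) := by
          exact mul_le_mul_of_nonneg_left (hg ζ') (mul_pos h2 h3).le
      _ = C * (Qh ρ p M σ κ ε ζ' * (je ζ' ^ x * je ζ' ^ y)) := by ring
      _ ≤ C * (2 * (jb ζ' ^ ρ * jm ζ' ^ p * je ζ' ^ (k0 σ / 2))) := mul_le_mul_of_nonneg_left h1 hC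
      _ = _ := by ring

/-- the bounds for `Cv b (S Y)` -/
lemma e_multS {k : ℝ} {b : Z n → ℂ} (hb : Bk k b) (hk : 2 * (n:ℝ) + 2 ≤ k) (ρ p : ℝ) {M σ κ : ℝ} (hσ : 0 < σ)
    (hκ : 0 ≤ κ) (hκ' : κ ≤ 1 / 2) (hM : 0 ≤ M) {Y : Z n → ℂ}
    (hW : MemLp (fun ζ => jb ζ ^ ρ * jm ζ ^ p * je ζ ^ (k0 σ / 2) * ‖Y ζ‖) 2) :
    ∃ K, 0 ≤ K ∧ ∀ ε > 0, ∀ ζ, je ζ ^ (-(1 / 2) : ℝ) *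
      ‖Cv b (fun ζ => ((Qh ρ p M σ κ ε ζ * je ζ ^ σ : ℝ) : ℂ) * Y ζ) ζ‖ ≤
      K * HH (fun ζ => jb ζ ^ ρ * jm ζ ^ p * je ζ ^ (k0 σ / 2) * ‖Y ζ‖) ζ := by
  obtain ⟨K, hK, h⟩ := ML (ι := Set.Ioi (0:ℝ)) hb hk (lam := fun ε ζ => je ζ ^ (-(1 / 2) : ℝ))
    (sv_je.rpow (-(1/2))).md 2
  refine ⟨K, hK, fun ε hε ζ => ?_⟩
  refine h ⟨ε, hε⟩ _ Y (fun ζ => jb ζ ^ ρ * jm ζ ^ p * je ζ ^ (k0 σ / 2)) ζ hW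
    (fun ζ' => ?_) fun ζ' => ?_
  · have := jb_pos ζ'; have := jm_pos ζ'; have := je_pos ζ'; positivity
  · have h2 := (Qh_le ρ p M hσ hκ hκ' hε ζ').1
    rw [Complex.norm_real, Real.norm_of_nonneg (mul_pos h2 (jer_pos ζ' σ)).le]
    have e : je ζ' ^ (-(1 / 2) : ℝ) * (Qh ρ p M σ κ ε ζ' * je ζ' ^ σ) =
        Qh ρ p M σ κ ε ζ' * je ζ' ^ (σ - 1 / 2) := by
      rw [sub_eq_add_neg, Real.rpow_add (je_pos ζ')]; ring
    rw [e]
    refine Qh_W hσ hκ hκ' hM hε ζ' ?_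
    have := le_max_left (2 * σ - 1) 0
    rw [k0]; linarith

lemma th_W (ρ p : ℝ) {σ s : ℝ} (hσ : 0 < σ) (h1 : ρ ≤ s) (h2 : ρ + p ≤ s + σ / (2 * σ + 1)) (ζ : Z n) :
    jb ζ ^ ρ * jm ζ ^ p ≤ jb ζ ^ s * rr σ ζ ^ σ := by
  set d := σ / (2 * σ + 1) with hd
  have e1 : jm ζ ^ d ≤ rr σ ζ ^ σ := by
    calc _ ≤ (rr σ ζ ^ (2 * σ + 1)) ^ d := Real.rpow_le_rpow (jm_pos ζ).le (jm_le_rr hσ ζ) (by positivity)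
      _ = _ := by
        rw [← Real.rpow_mul (rr_pos σ ζ).le]; congr 1; rw [hd]; field_simp
  have e2 : jm ζ ^ (p - d) ≤ jb ζ ^ (max (p - d) 0) :=
    (Real.rpow_le_rpow_of_exponent_le (one_le_jm ζ) (le_max_left _ _)).trans
      (Real.rpow_le_rpow (jm_pos ζ).le (jm_le_jb ζ) (le_max_right _ _))
  have e3 : jb ζ ^ ρ * jb ζ ^ (max (p - d) 0) ≤ jb ζ ^ s := by
    rw [← Real.rpow_add (jb_pos ζ)]
    refine Real.rpow_le_rpow_of_exponent_le (one_le_jb ζ) ?_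
    rcases max_cases (p - d) 0 with h | h <;> linarith [h.1]
  have e4 : jm ζ ^ p = jm ζ ^ (p - d) * jm ζ ^ d := by
    rw [← Real.rpow_add (jm_pos ζ)]; congr 1; ring
  rw [e4, ← mul_assoc]
  refine mul_le_mul ((mul_le_mul_of_nonneg_left e2 (jbr_pos ζ ρ).le).trans e3) e1 ?_ (jbr_pos ζ s).le
  have := jm_pos ζ; positivity

lemma D_bd (ρ p M : ℝ) {σ κ ε : ℝ} (hσ : 0 < σ) (hσ1 : σ < 1) (hκ : 0 ≤ κ) (hκ' : κ ≤ 1 / 2) (hε : 0 < ε) (ζ : Z n) :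
    th ρ p M ε ζ ^ 2 * (-(3 * (|ρ| + |p| + 2 * |M|)) + κ * ((rr σ ζ ^ σ) ^ 2 - 6 * je ζ ^ (2 * σ))) ≤
      fderiv ℝ (qq ρ p M σ κ ε) ζ (dv ζ) := by
  rw [fderiv_qq ρ p M κ hσ hε ζ _ (tC_dv ζ) (xC_dv ζ)]
  refine mul_le_mul_of_nonneg_left ?_ (sq_nonneg _)
  have h1 := abs_lth_dv ρ p M hε ζ
  have h2 := mul_le_mul_of_nonneg_left (dgg_dv hσ hσ1 ζ) hκ
  have h3 := gg_bd (n := n) hσ hκ hκ' ζ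
  have e : (rr σ ζ ^ σ) ^ 2 = rr σ ζ ^ (2 * σ) := by
    rw [← Real.rpow_natCast, ← Real.rpow_mul (rr_pos σ ζ).le]; congr 1; push_cast; ring
  rw [e]
  have h4 : |2 * lth ρ p M ε ζ (dv ζ) * (1 + κ * gg σ ζ)| ≤ 3 * (|ρ| + |p| + 2 * |M|) := by
    rw [abs_mul, abs_mul, abs_two, abs_of_nonneg (by linarith [h3.1] : 0 ≤ 1 + κ * gg σ ζ)]
    calc _ ≤ 2 * (|ρ| + |p| + 2 * |M|) * (3 / 2) := by
          refine mul_le_mul (by linarith) h3.2 (by linarith [h3.1]) (by positivity)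
      _ = _ := by ring
  linarith [neg_abs_le (2 * lth ρ p M ε ζ (dv ζ) * (1 + κ * gg σ ζ))]

lemma fatou {g : ℝ → Z n → ℝ} {G : Z n → ℝ} (hg : ∀ ε > 0, Continuous (g ε))
    (hG : Continuous G) (hl : ∀ ζ, Filter.Tendsto (fun j : ℕ => g (1 / ((j:ℝ) + 1)) ζ) Filter.atTop (nhds (G ζ)))
    {C : ℝ} (hi : ∀ ε > 0, Integrable (fun ζ => g ε ζ ^ 2) ∧ ∫ ζ, g ε ζ ^ 2 ≤ C) : MemLp G 2 := by
  rw [memLp_two_iff_integrable_sq hG.aestronglyMeasurable]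
  refine ⟨(hG.pow 2).aestronglyMeasurable, ?_⟩
  have hp : ∀ j : ℕ, (0:ℝ) < 1 / ((j:ℝ) + 1) := fun j => by positivity
  have h1 := lintegral_liminf_le (μ := (volume : Measure (Z n))) (u := Filter.atTop) (f := fun (j : ℕ) ζ => ENNReal.ofReal (g (1 / ((j:ℝ) + 1)) ζ ^ 2))
    fun j => (((hg _ (hp j)).pow 2).measurable).ennreal_ofReal
  have h2 : ∀ ζ, Filter.liminf (fun j : ℕ => ENNReal.ofReal (g (1 / ((j:ℝ) + 1)) ζ ^ 2)) Filter.atTop =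
      ENNReal.ofReal (G ζ ^ 2) := fun ζ =>
    (ENNReal.tendsto_ofReal ((hl ζ).pow 2)).liminf_eq
  simp only [h2] at h1
  have h3 : ∀ j : ℕ, ∫⁻ ζ, ENNReal.ofReal (g (1 / ((j:ℝ) + 1)) ζ ^ 2) ≤ ENNReal.ofReal C := fun j => by
    rw [← ofReal_integral_eq_lintegral_ofReal (hi _ (hp j)).1 (Filter.Eventually.of_forall fun ζ => sq_nonneg _)]
    exact ENNReal.ofReal_le_ofReal (hi _ (hp j)).2
  rw [hasFiniteIntegral_iff_ofReal (Filter.Eventually.of_forall fun ζ => sq_nonneg _)]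
  refine lt_of_le_of_lt (h1.trans ?_) (ENNReal.ofReal_lt_top (r := C))
  refine Filter.liminf_le_of_le (by isBoundedDefault) fun b hb => ?_
  obtain ⟨j, hj⟩ := hb.exists
  exact hj.trans (h3 j)

end HE

namespace HE
open scoped FourierTransform

lemma cv_add {k : ℝ} {c : Z n → ℂ} (h : Bk k c) (hk : 2 * (n:ℝ) + 2 ≤ k) {X Y : Z n → ℂ}
    (hX : GI X) (hY : GI Y) (ζ : Z n) : Cv c (fun ζ => X ζ + Y ζ) ζ = Cv c X ζ + Cv c Y ζ := by
  rw [Cv, Cv, Cv, ← integral_add (cv_int h hk hX ζ) (cv_int h hk hY ζ)]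
  exact integral_congr_ae (Filter.Eventually.of_forall fun x => by simp only; ring)

lemma e_pt {f A R T G1 T1 : ℂ} {τ q J Dq : ℝ} (hq : 0 ≤ q)
    (he : 2 * π * Complex.I * τ * f + T + (A + R) = G1 + T1)
    (hJ : J = Dq * ‖f‖ ^ 2 - 2 * (q * (T * (starRingEnd ℂ) f).re)) :
    -(1 / 2) * J + 1 / 2 * Dq * ‖f‖ ^ 2 + q * (A * (starRingEnd ℂ) f).re ≤ q * (‖G1‖ + ‖T1‖ + ‖R‖) * ‖f‖ := by
  have h0 : (2 * π * Complex.I * τ * f * (starRingEnd ℂ) f).re = 0 := by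
    have : 2 * π * Complex.I * τ * f * (starRingEnd ℂ) f = ((2 * π * τ * Complex.normSq f : ℝ) : ℂ) * Complex.I := by
      rw [mul_assoc _ f, Complex.mul_conj]; push_cast; ring
    rw [this, Complex.re_ofReal_mul, Complex.I_re, mul_zero]
  have h1 : (T * (starRingEnd ℂ) f).re + (A * (starRingEnd ℂ) f).re =
      ((G1 + T1 - R) * (starRingEnd ℂ) f).re := by
    have : (G1 + T1 - R) * (starRingEnd ℂ) f = 2 * π * Complex.I * τ * f * (starRingEnd ℂ) f +
        T * (starRingEnd ℂ) f + A * (starRingEnd ℂ) f := by rw [← he]; ring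
    rw [this, Complex.add_re, Complex.add_re, h0]; ring
  have h2 : ((G1 + T1 - R) * (starRingEnd ℂ) f).re ≤ (‖G1‖ + ‖T1‖ + ‖R‖) * ‖f‖ := by
    refine (Complex.re_le_norm _).trans ?_
    rw [norm_mul, RCLike.norm_conj]
    exact mul_le_mul_of_nonneg_right ((norm_sub_le _ _).trans (by linarith [norm_add_le G1 T1])) (norm_nonneg _)
  have h3 := mul_le_mul_of_nonneg_left h2 hq
  rw [← h1] at h3
  rw [hJ]
  linarith

lemma re_pert {u v x y : ℂ} {L r : ℝ} (hr : 1 ≤ r) (h1 : r * ‖u - x‖ ≤ L) (h2 : r * ‖v - y‖ ≤ L)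
    (h3 : r⁻¹ * ‖x‖ ≤ L) (h4 : r⁻¹ * ‖y‖ ≤ L) :
    (x * (starRingEnd ℂ) y).re - 3 * L ^ 2 ≤ (u * (starRingEnd ℂ) v).re := by
  have hr0 : 0 < r := by linarith
  have hL : 0 ≤ L := le_trans (by positivity) h1
  have e : x * (starRingEnd ℂ) y = u * (starRingEnd ℂ) v - ((u - x) * (starRingEnd ℂ) (v - y) +
      (u - x) * (starRingEnd ℂ) y + x * (starRingEnd ℂ) (v - y)) := by
    simp only [map_sub]; ring
  have b1 : ‖(u - x) * (starRingEnd ℂ) (v - y)‖ ≤ L * L := by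
    rw [norm_mul, RCLike.norm_conj]
    refine mul_le_mul ?_ ?_ (norm_nonneg _) hL
    · exact (le_mul_of_one_le_left (norm_nonneg _) hr).trans h1
    · exact (le_mul_of_one_le_left (norm_nonneg _) hr).trans h2
  have b2 : ‖(u - x) * (starRingEnd ℂ) y‖ ≤ L * L := by
    rw [norm_mul, RCLike.norm_conj]
    calc ‖u - x‖ * ‖y‖ = (r * ‖u - x‖) * (r⁻¹ * ‖y‖) := by field_simp
      _ ≤ _ := mul_le_mul h1 h4 (by positivity) hL
  have b3 : ‖x * (starRingEnd ℂ) (v - y)‖ ≤ L * L := by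
    rw [norm_mul, RCLike.norm_conj]
    calc ‖x‖ * ‖v - y‖ = (r⁻¹ * ‖x‖) * (r * ‖v - y‖) := by field_simp
      _ ≤ _ := mul_le_mul h3 h2 (by positivity) hL
  rw [e, Complex.sub_re]
  have b := Complex.abs_re_le_norm ((u - x) * (starRingEnd ℂ) (v - y) +
      (u - x) * (starRingEnd ℂ) y + x * (starRingEnd ℂ) (v - y))
  have b' := norm_add₃_le (a := (u - x) * (starRingEnd ℂ) (v - y)) (b := (u - x) * (starRingEnd ℂ) y)
    (c := x * (starRingEnd ℂ) (v - y))
  have b'' := neg_abs_le ((u - x) * (starRingEnd ℂ) (v - y) +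
      (u - x) * (starRingEnd ℂ) y + x * (starRingEnd ℂ) (v - y)).re
  have : L ^ 2 = L * L := sq L
  linarith

lemma th_tend (ρ p M : ℝ) (ζ : Z n) :
    Filter.Tendsto (fun j : ℕ => th ρ p M (1 / ((j:ℝ) + 1)) ζ) Filter.atTop (nhds (jb ζ ^ ρ * jm ζ ^ p)) := by
  have h1 : Filter.Tendsto (fun j : ℕ => 1 + (1 / ((j:ℝ) + 1)) * jb ζ ^ 2) Filter.atTop (nhds (1 + 0 * jb ζ ^ 2)) :=
    tendsto_const_nhds.add (tendsto_one_div_add_atTop_nhds_zero_nat.mul_const _)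
  have h2 := h1.rpow_const (p := -M) (Or.inl (by simp))
  have h3 := h2.const_mul (jb ζ ^ ρ * jm ζ ^ p)
  simpa [th] using h3

end HE

namespace HE
open scoped FourierTransform

lemma int_SY {ρ p M σ κ ε : ℝ} (hσ : 0 < σ) (hκ : 0 ≤ κ) (hκ' : κ ≤ 1 / 2) (hM : 0 ≤ M) (hε : 0 < ε)
    {Y : Z n → ℂ} (hYc : Continuous Y) {C L : ℝ} (hC : 0 ≤ C) (hY : ∀ ζ, ‖Y ζ‖ ≤ C * jb ζ ^ L)
    (hML : |ρ| + |p| + |σ| + L + 2 * (n:ℝ) + 2 ≤ 2 * M) :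
    Integrable (fun ζ => ((Qh ρ p M σ κ ε ζ * je ζ ^ σ : ℝ) : ℂ) * Y ζ) := by
  have hm : Continuous (fun ζ => ((Qh ρ p M σ κ ε ζ * je ζ ^ σ : ℝ) : ℂ) * Y ζ) :=
    (Complex.continuous_ofReal.comp ((Qh_cont ρ p M hσ hκ hκ' hε).mul (jer_cont σ))).mul hYc
  refine (integrable_norm_iff hm.aestronglyMeasurable).1 ?_
  refine int_dec (C := 2 * ε ^ (-M) * C) (r := |ρ| + |p| - 2 * M + |σ| + L) hm.norm.aestronglyMeasurable
    (by linarith) (by positivity) fun ζ => ?_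
  have h1 := Qh_le ρ p M hσ hκ hκ' hε ζ
  have h2 := th_dec ρ p hM hε ζ
  have h3 := je_rp_le ζ σ
  have h4 := jer_pos ζ σ
  rw [abs_norm, norm_mul, Complex.norm_real, Real.norm_of_nonneg (mul_nonneg h1.1.le h4.le),
    Real.rpow_add (jb_pos ζ) (|ρ| + |p| - 2 * M + |σ|) L, Real.rpow_add (jb_pos ζ)]
  have h5 : Qh ρ p M σ κ ε ζ * je ζ ^ σ ≤ (2 * (ε ^ (-M) * jb ζ ^ (|ρ| + |p| - 2 * M))) * jb ζ ^ |σ| :=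
      mul_le_mul (h1.2.trans (by linarith)) h3 h4.le (by linarith [h1.1, h1.2])
  calc _ ≤ ((2 * (ε ^ (-M) * jb ζ ^ (|ρ| + |p| - 2 * M))) * jb ζ ^ |σ|) * (C * jb ζ ^ L) :=
        mul_le_mul h5 (hY ζ) (norm_nonneg _) ((mul_pos h1.1 h4).le.trans h5)
    _ = _ := by ring

set_option maxHeartbeats 1000000 in
lemma energy_fix {σ : ℝ} {w : E n → ℝ} {a : Z n → ℝ} {a₀ s : ℝ} {h : Z n → ℂ} {U : Set (ℝ × E n)}
    (D : Dat σ w a a₀ s h U) {ρ p : ℝ} (hρ : ρ ≤ s) (hρp : ρ + p ≤ s + σ / (2 * σ + 1))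
    {c : Z n → ℂ} {k : ℝ} (hc : Cl U k c) (m : ℕ) (hm : 2 * (n:ℝ) + 3 ≤ 2 * m) (hk : 2 * (n:ℝ) + 4 + 2 * m ≤ k)
    (hYq : ∀ q, Cl U (2 * (m:ℝ)) q → MemLp (fun ζ => jb ζ ^ ρ * jm ζ ^ p * je ζ ^ (k0 σ / 2) * ‖Cv q h ζ‖) 2)
    (hT : MemLp (fun ζ => jb ζ ^ ρ * jm ζ ^ p * je ζ ^ (k0 σ / 2) * ‖Cv (Tr c) h ζ‖) 2) :
    MemLp (fun ζ => jb ζ ^ ρ * jm ζ ^ p * rr σ ζ ^ σ * ‖Cv c h ζ‖) 2 := by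
  have hσ := D.s0
  have hσ1 := D.s1
  have hn0 : (0:ℝ) ≤ n := Nat.cast_nonneg n
  obtain ⟨q, hq, hcq, G, hGm, hGL, ι, _, fl, pl, hfl, hpl, heq⟩ := EQ D hc m hm hk
  have hW := hYq q hq
  have hm2 : 2 * (n:ℝ) + 2 ≤ 2 * m := by linarith
  have hYc : Continuous (Cv q h) := cv_cont hq.1 hm D.gi
  have hYG : GI (Cv q h) := cv_GI hq.1 hm D.gi
  obtain ⟨CY, LY, hCY, hYb⟩ := cv_bd hq.1 hm2 D.gi
  set Y := Cv q h with hY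
  have hb : Bk (k - 2 * m) (fun z => c z * Pw m z) := by
    have := hc.1.mul (Pw_bk m); exact this.mono (by linarith)
  have hab : Bk (k - 2 * m) (fun z => (a z : ℂ) * (c z * Pw m z)) := (D.ha.mul hb).mono (by linarith)
  have hapl : ∀ l, Bk (k - 2 * m) (fun z => (a z : ℂ) * (c z * pl l z)) := fun l =>
    (D.ha.mul (hc.1.mul (hpl l))).mono (by linarith)
  have hkm : 2 * (n:ℝ) + 2 ≤ k - 2 * m := by linarith
  set b := fun z => c z * Pw m z with hbdef
  have hf : ∀ ζ, Cv c h ζ = Cv b Y ζ := fun ζ => by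
    rw [hY, B2 hb hkm hq.1 hm2 D.gi]
    exact congrArg (fun c' => Cv c' h ζ) (funext fun z => (hcq z).symm)
  set κ := min (1 / 2) (a₀ / 12) with hκd
  have ha₀ := D.ha₀
  have hκ : 0 < κ := lt_min (by norm_num) (by linarith)
  have hκ' : κ ≤ 1 / 2 := min_le_left _ _
  have hκa : 12 * κ ≤ a₀ := by have : κ ≤ a₀ / 12 := min_le_right _ _
                               linarith
  clear_value κ
  obtain ⟨M0, hM0, htr⟩ := transport hc.1 (by linarith [Nat.cast_nonneg (α := ℝ) m]) D.gi ρ p hσ hσ1 hκ.le hκ'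
  set M := M0 + (|ρ| + |p| + |σ| + LY + 2 * (n:ℝ) + 2) with hMd
  have hMx : 0 ≤ |ρ| + |p| + |σ| + LY + 2 * (n:ℝ) + 2 := by positivity
  have hMM0 : M ≥ M0 := by linarith
  have hM : 0 ≤ M := by linarith
  have hML : |ρ| + |p| + |σ| + LY + 2 * (n:ℝ) + 2 ≤ 2 * M := by linarith
  clear_value M
  have hk0 : 0 ≤ k0 σ := le_max_right _ _
  obtain ⟨CF, hCF, hF⟩ := Fz_diff hσ hσ1 D.hw D.hwout D.hwin
  obtain ⟨K1, hK1, b1⟩ := e_comm hab hkm ρ p hσ hκ.le hκ' hM hYG hW (-σ) (2 * σ) (by ring)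
  obtain ⟨K2, hK2, b2⟩ := e_comm hb hkm ρ p hσ hκ.le hκ' hM hYG hW σ 0 (by ring)
  obtain ⟨K3, hK3, b3⟩ := e_multS hab hkm ρ p hσ hκ.le hκ' hM hW
  obtain ⟨K4, hK4, b4⟩ := e_multS hb hkm ρ p hσ hκ.le hκ' hM hW
  obtain ⟨K5, hK5, b5⟩ := e_mult hab hkm ρ p hσ hκ.le hκ' hM hW (-(k0 σ / 2)) 0 CF hCF (by linarith)
    (g := fun ζ => Fz σ w ζ - ((je ζ ^ (2 * σ) : ℝ) : ℂ)) (fun ζ => by simpa using hF ζ)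
  obtain ⟨K6, hK6, b6⟩ := e_mult hb hkm ρ p hσ hκ.le hκ' hM hW (k0 σ / 2) 0 1 zero_le_one (by linarith)
    (g := fun ζ => 1) (fun ζ => by simp)
  have h7 : ∀ l, ∃ K, 0 ≤ K ∧ ∀ ε > 0, ∀ ζ, Qh ρ p M σ κ ε ζ * je ζ ^ (-(k0 σ / 2)) *
      ‖Cv (fun z => (a z : ℂ) * (c z * pl l z)) (fun ζ => fl l ζ * Y ζ) ζ‖ ≤
      K * HH (fun ζ => jb ζ ^ ρ * jm ζ ^ p * je ζ ^ (k0 σ / 2) * ‖Y ζ‖) ζ := fun l => by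
    obtain ⟨C, hC, hCl⟩ := (hfl l).bd0 (fun z => (jer_pos z _).le)
    exact e_mult (hapl l) hkm ρ p hσ hκ.le hκ' hM hW (-(k0 σ / 2)) (k0 σ) C hC (by linarith) hCl
  choose K7 hK7 b7 using h7
  obtain ⟨K8, hK8, b8⟩ := ML (ι := Unit) hc.1 (by linarith [Nat.cast_nonneg (α := ℝ) m]) (lam := fun _ ζ => jb ζ ^ s)
    (sv_jb.rpow s).md 1
  have hH0 : ∀ ζ, 0 ≤ HH (fun ζ => jb ζ ^ ρ * jm ζ ^ p * je ζ ^ (k0 σ / 2) * ‖Y ζ‖) ζ := hh_nonneg fun ζ => by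
    have := jb_pos ζ; have := jm_pos ζ; have := je_pos ζ; positivity
  have hHL : MemLp (HH (fun ζ => jb ζ ^ ρ * jm ζ ^ p * je ζ ^ (k0 σ / 2) * ‖Y ζ‖)) 2 := hh_L2 (fun ζ => by
    have := jb_pos ζ; have := jm_pos ζ; have := je_pos ζ; positivity) hW
  have hH20 : ∀ ζ, 0 ≤ HH (fun ζ => jb ζ ^ s * ‖G ζ‖) ζ := hh_nonneg fun ζ => by
    have := jb_pos ζ; positivity
  have hH2L : MemLp (HH (fun ζ => jb ζ ^ s * ‖G ζ‖)) 2 := hh_L2 (fun ζ => by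
    have := jb_pos ζ; positivity) hGL
  set H := HH (fun ζ => jb ζ ^ ρ * jm ζ ^ p * je ζ ^ (k0 σ / 2) * ‖Y ζ‖) with hH
  set H2 := HH (fun ζ => jb ζ ^ s * ‖G ζ‖) with hH2
  set H3 := fun ζ => jb ζ ^ ρ * jm ζ ^ p * je ζ ^ (k0 σ / 2) * ‖Cv (Tr c) h ζ‖ with hH3
  have hH30 : ∀ ζ, 0 ≤ H3 ζ := fun ζ => by
    have := jb_pos ζ; have := jm_pos ζ; have := je_pos ζ; positivity
  set K := K1 + K2 + K3 + K4 + (K5 + ∑ l, K7 l) + 2 * K6 + K8 with hK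
  have hS7 : 0 ≤ ∑ l, K7 l := Finset.sum_nonneg fun l _ => hK7 l
  have hK0 : 0 ≤ K := by positivity
  have hm1 : ∀ {x : ℝ} (ζ), x ≤ K → x * H ζ ≤ K * H ζ := fun ζ hx => mul_le_mul_of_nonneg_right hx (hH0 ζ)
  set L0 := |ρ| + |p| + 2 * |M| with hL0
  have hL00 : 0 ≤ L0 := by positivity
  set CC := a₀ * K ^ 2 + 2 * L0 * K ^ 2 + 4 * K ^ 2 + 3 * K ^ 2 / κ + 2 * K with hCC
  have hfc : Continuous (Cv c h) := cv_cont hc.1 (by linarith [Nat.cast_nonneg (α := ℝ) m]) D.gi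
  have hrc : Continuous fun ζ : Z n => rr σ ζ ^ σ := (rr_cont σ).rpow_const fun ζ => Or.inl (rr_pos σ ζ).ne'
  have hL2 : ∀ {X : Z n → ℝ}, MemLp X 2 → Integrable fun ζ => X ζ ^ 2 := fun hX => hX.integrable_sq
  have iH := ((hL2 hHL).add (hL2 hH2L)).add (hL2 hT)
  -- pointwise inequality
  have key : ∀ ε > 0, ∃ J : Z n → ℝ, Integrable J ∧ ∫ ζ, J ζ = 0 ∧ ∀ ζ,
      κ / 4 * (th ρ p M ε ζ * rr σ ζ ^ σ * ‖Cv c h ζ‖) ^ 2 ≤ 1 / 2 * J ζ +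
      (a₀ * ‖Cv b (fun ζ => ((Qh ρ p M σ κ ε ζ * je ζ ^ σ : ℝ) : ℂ) * Y ζ) ζ‖ ^ 2 -
        (Cv (fun z => (a z : ℂ) * b z) (fun ζ => ((Qh ρ p M σ κ ε ζ * je ζ ^ σ : ℝ) : ℂ) * Y ζ) ζ *
          (starRingEnd ℂ) (Cv b (fun ζ => ((Qh ρ p M σ κ ε ζ * je ζ ^ σ : ℝ) : ℂ) * Y ζ) ζ)).re) +
        CC * (H ζ ^ 2 + H2 ζ ^ 2 + H3 ζ ^ 2) := by
    intro ε hε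
    obtain ⟨J, hJi, hJ0, hJ⟩ := htr M hMM0 ε hε
    refine ⟨J, hJi, hJ0, fun ζ => ?_⟩
    have hQ := Qh_le ρ p M hσ hκ.le hκ' hε ζ
    have hQs := Qh_sq (n := n) (ε := ε) ρ p M hσ hκ.le hκ' ζ
    have hg := gg_bd (n := n) hσ hκ.le hκ' ζ
    have htp := th_pos ρ p M hε ζ
    have htW := th_le ρ p hM hε ζ
    have hjp := je_pos ζ
    set B1 := Cv (fun z => (a z : ℂ) * b z) (fun ζ => ((Qh ρ p M σ κ ε ζ * je ζ ^ σ : ℝ) : ℂ) * Y ζ) ζ with hB1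
    set B2' := Cv b (fun ζ => ((Qh ρ p M σ κ ε ζ * je ζ ^ σ : ℝ) : ℂ) * Y ζ) ζ with hB2
    set A := Cv (fun z => (a z : ℂ) * b z) (fun ζ => ((je ζ ^ (2 * σ) : ℝ) : ℂ) * Y ζ) ζ with hA
    set R1 := Cv (fun z => (a z : ℂ) * b z) (fun ζ => (Fz σ w ζ - ((je ζ ^ (2 * σ) : ℝ) : ℂ)) * Y ζ) ζ with hR1
    set R2 := ∑ l, Cv (fun z => (a z : ℂ) * (c z * pl l z)) (fun ζ => fl l ζ * Y ζ) ζ with hR2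
    have hsplit : Cv (fun z => (a z : ℂ) * b z) (fun ζ => Fz σ w ζ * Y ζ) ζ = A + R1 := by
      rw [hA, hR1, ← cv_add hab hkm (gi_je hYG _)]
      · exact congrArg (fun Y' => Cv _ Y' ζ) (funext fun z => by ring)
      · have g1 := hYG.mul_temp (Fz_temp hσ hσ1 D.hw D.hwout D.hwin)
        have g2 := g1.add (gi_je hYG (2 * σ)).neg
        exact (congrArg GI (funext fun z => by ring)).mp g2
    have heq' := heq ζ
    rw [hsplit] at heq'
    have heq2 : 2 * π * Complex.I * (tC ζ) * Cv c h ζ + (∑ i, 2 * π * Complex.I * (xC ζ i) *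
        Cv (fun z => c z * ((vC z i : ℝ) : ℂ)) h ζ) + (A + (R1 + R2)) = Cv c G ζ + Cv (Tr c) h ζ := by
      rw [← heq']; ring
    have hq0 : qq ρ p M σ κ ε ζ = Qh ρ p M σ κ ε ζ ^ 2 := hQs.symm
    have hqp : 0 ≤ qq ρ p M σ κ ε ζ := by rw [hq0]; positivity
    have hp0 := e_pt hqp heq2 (hJ ζ)
    have hqt1 : qq ρ p M σ κ ε ζ ≤ 3 / 2 * th ρ p M ε ζ ^ 2 := by
      rw [qq]
      have := mul_le_mul_of_nonneg_left hg.2 (sq_nonneg (th ρ p M ε ζ)); linarith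
    have hqt2 : th ρ p M ε ζ ^ 2 ≤ 2 * qq ρ p M σ κ ε ζ := by
      rw [qq]
      have := mul_le_mul_of_nonneg_left hg.1 (sq_nonneg (th ρ p M ε ζ)); linarith
    have hsum := hS7
    have c1 := (b1 ε hε ζ).trans (hm1 ζ (by linarith : K1 ≤ K))
    have c2 := (b2 ε hε ζ).trans (hm1 ζ (by linarith : K2 ≤ K))
    have c3 := (b3 ε hε ζ).trans (hm1 ζ (by linarith : K3 ≤ K))
    have c4 := (b4 ε hε ζ).trans (hm1 ζ (by linarith : K4 ≤ K))
    have c5 := b5 ε hε ζ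
    have c6 := b6 ε hε ζ
    simp only [Real.rpow_zero, Complex.ofReal_one, one_mul] at c2 c6
    rw [← hf ζ] at c2 c6
    have hx0 := norm_nonneg (Cv c h ζ)
    have hje1 : 1 ≤ je ζ ^ (1 / 2 : ℝ) := Real.one_le_rpow (one_le_je ζ) (by norm_num)
    rw [Real.rpow_neg hjp.le] at c3 c4
    have hreA : qq ρ p M σ κ ε ζ * (A * (starRingEnd ℂ) (Cv c h ζ)).re =
        ((((Qh ρ p M σ κ ε ζ * je ζ ^ (-σ) : ℝ) : ℂ) * A) *
          (starRingEnd ℂ) (((Qh ρ p M σ κ ε ζ * je ζ ^ σ : ℝ) : ℂ) * Cv c h ζ)).re := by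
      have e1 : (((Qh ρ p M σ κ ε ζ * je ζ ^ (-σ) : ℝ) : ℂ) * A) *
          (starRingEnd ℂ) (((Qh ρ p M σ κ ε ζ * je ζ ^ σ : ℝ) : ℂ) * Cv c h ζ) =
          (((Qh ρ p M σ κ ε ζ * je ζ ^ (-σ)) * (Qh ρ p M σ κ ε ζ * je ζ ^ σ) : ℝ) : ℂ) *
            (A * (starRingEnd ℂ) (Cv c h ζ)) := by
        rw [map_mul, Complex.conj_ofReal]; push_cast; ring
      rw [e1, Complex.re_ofReal_mul, hq0]
      congr 1
      have : je ζ ^ (-σ) * je ζ ^ σ = 1 := by rw [← Real.rpow_add hjp]; simp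
      linear_combination (-(Qh ρ p M σ κ ε ζ ^ 2)) * this
    refine energy_alg (K := K) (L0 := L0) (Dq := fderiv ℝ (qq ρ p M σ κ ε) ζ (dv ζ)) (q := qq ρ p M σ κ ε ζ)
      (je2 := je ζ ^ (2 * σ))
      (reA := qq ρ p M σ κ ε ζ * (A * (starRingEnd ℂ) (Cv c h ζ)).re)
      (E2 := ‖((Qh ρ p M σ κ ε ζ * je ζ ^ σ : ℝ) : ℂ) * Cv c h ζ - B2'‖) (R := ‖R1 + R2‖)
      (cG := ‖Cv c G ζ‖) (cT := ‖Cv (Tr c) h ζ‖)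
      hK0 hκ hκa (hH30 ζ) (hH20 ζ) (hH0 ζ) htp hqt1 hqt2 (Real.rpow_nonneg (rr_pos σ ζ).le _)
      (jer_pos ζ _).le hx0 (D_bd ρ p M hσ hσ1 hκ.le hκ' hε ζ) hL00 (norm_nonneg _) (norm_nonneg _) (norm_nonneg _)
      (norm_nonneg _) hp0 ?_ ?_ ?_ ?_ ?_ ?_ ?_
    · rw [hreA]
      exact re_pert hje1 c1 c2 c3 c4
    · have e1 : qq ρ p M σ κ ε ζ * je ζ ^ (2 * σ) * ‖Cv c h ζ‖ ^ 2 =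
          ‖((Qh ρ p M σ κ ε ζ * je ζ ^ σ : ℝ) : ℂ) * Cv c h ζ‖ ^ 2 := by
        rw [norm_mul, Complex.norm_real, Real.norm_of_nonneg (mul_pos hQ.1 (jer_pos ζ σ)).le, hq0]
        have : je ζ ^ (2 * σ) = (je ζ ^ σ) ^ 2 := by
          rw [← Real.rpow_natCast, ← Real.rpow_mul hjp.le]; congr 1; push_cast; ring
        rw [this]; ring
      rw [e1]
      refine pow_le_pow_left₀ (norm_nonneg _) ?_ 2
      have := norm_add_le B2' (((Qh ρ p M σ κ ε ζ * je ζ ^ σ : ℝ) : ℂ) * Cv c h ζ - B2')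
      rwa [add_sub_cancel] at this
    · exact (le_mul_of_one_le_left (norm_nonneg _) hje1).trans c2
    · have hR : Qh ρ p M σ κ ε ζ * je ζ ^ (-(k0 σ / 2)) * ‖R1 + R2‖ ≤ K * H ζ := by
        have hQp : 0 ≤ Qh ρ p M σ κ ε ζ * je ζ ^ (-(k0 σ / 2)) := (mul_pos hQ.1 (jer_pos ζ _)).le
        have e2 : Qh ρ p M σ κ ε ζ * je ζ ^ (-(k0 σ / 2)) * ‖R2‖ ≤ (∑ l, K7 l) * H ζ := by
          refine (mul_le_mul_of_nonneg_left (norm_sum_le _ _) hQp).trans ?_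
          rw [Finset.mul_sum, Finset.sum_mul]
          exact Finset.sum_le_sum fun l _ => b7 l ε hε ζ
        have e3 := mul_le_mul_of_nonneg_left (norm_add_le R1 R2) hQp
        have e4 := hm1 ζ (by linarith : K5 + ∑ l, K7 l ≤ K)
        linarith
      have h6' : Qh ρ p M σ κ ε ζ * je ζ ^ (k0 σ / 2) * ‖Cv c h ζ‖ ≤ K * H ζ :=
        c6.trans (hm1 ζ (by linarith))
      have e5 : je ζ ^ (-(k0 σ / 2)) * je ζ ^ (k0 σ / 2) = 1 := by rw [← Real.rpow_add hjp]; simp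
      calc qq ρ p M σ κ ε ζ * ‖R1 + R2‖ * ‖Cv c h ζ‖
          = (Qh ρ p M σ κ ε ζ * je ζ ^ (-(k0 σ / 2)) * ‖R1 + R2‖) *
            (Qh ρ p M σ κ ε ζ * je ζ ^ (k0 σ / 2) * ‖Cv c h ζ‖) := by
            rw [hq0]; linear_combination (-(Qh ρ p M σ κ ε ζ ^ 2 * ‖R1 + R2‖ * ‖Cv c h ζ‖)) * e5
        _ ≤ (K * H ζ) * (K * H ζ) := mul_le_mul hR h6' (by have := hQ.1; positivity) (mul_nonneg hK0 (hH0 ζ))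
        _ = _ := by ring
    · have e1 : th ρ p M ε ζ ≤ 2 * Qh ρ p M σ κ ε ζ := by
        refine le_of_sq_le_sq' ?_ (by linarith [hQ.1])
        rw [hq0] at hqt2; nlinarith [hQ.1]
      have e2 : 1 ≤ je ζ ^ (k0 σ / 2) := Real.one_le_rpow (one_le_je ζ) (by linarith)
      have e3 : Qh ρ p M σ κ ε ζ * ‖Cv c h ζ‖ ≤ Qh ρ p M σ κ ε ζ * je ζ ^ (k0 σ / 2) * ‖Cv c h ζ‖ :=
        mul_le_mul_of_nonneg_right (le_mul_of_one_le_right hQ.1.le e2) hx0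
      have e4 := mul_le_mul_of_nonneg_right e1 hx0
      have e5 := hm1 ζ (by linarith : 2 * K6 ≤ K)
      linarith
    · refine mul_le_mul_of_nonneg_right (htW.trans ?_) (norm_nonneg _)
      refine le_mul_of_one_le_right ?_ (Real.one_le_rpow (one_le_je ζ) (by linarith))
      have := jb_pos ζ; have := jm_pos ζ; positivity
    · have e1 := b8 () (fun _ => 1) G (fun ζ => jb ζ ^ s) ζ hGL (fun ζ => (jbr_pos ζ s).le) fun ζ => by simp
      simp only [one_mul] at e1
      have e2 := htW.trans (th_W ρ p hσ hρ hρp ζ)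
      have hr0 := Real.rpow_nonneg (rr_pos σ ζ).le σ
      calc th ρ p M ε ζ * ‖Cv c G ζ‖ ≤ jb ζ ^ s * rr σ ζ ^ σ * ‖Cv c G ζ‖ :=
            mul_le_mul_of_nonneg_right e2 (norm_nonneg _)
        _ = rr σ ζ ^ σ * (jb ζ ^ s * ‖Cv c G ζ‖) := by ring
        _ ≤ rr σ ζ ^ σ * (K8 * H2 ζ) := mul_le_mul_of_nonneg_left e1 hr0
        _ ≤ rr σ ζ ^ σ * (K * H2 ζ) := mul_le_mul_of_nonneg_left
            (mul_le_mul_of_nonneg_right (by linarith) (hH20 ζ)) hr0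
        _ = _ := by ring
  refine fatou (g := fun ε ζ => th ρ p M ε ζ * rr σ ζ ^ σ * ‖Cv c h ζ‖)
    (C := 4 / κ * (CC * ∫ ζ, (H ζ ^ 2 + H2 ζ ^ 2 + H3 ζ ^ 2))) ?_ ?_ ?_ ?_
  · intro ε hε; exact ((th_cont ρ p M hε).mul hrc).mul hfc.norm
  · exact (((jbr_cont ρ).mul (jmr_cont p)).mul hrc).mul hfc.norm
  · intro ζ; exact ((th_tend ρ p M ζ).mul_const _).mul_const _
  · intro ε hε
    obtain ⟨J, hJi, hJ0, hJ⟩ := key ε hε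
    obtain ⟨g1, g2, g3⟩ := GARD D.ha hb hkm D.haLB
      (int_SY (ε := ε) hσ hκ.le hκ' hM hε hYc hCY hYb hML)
    have i1 : Integrable fun ζ => 1 / 2 * J ζ := hJi.const_mul _
    have i2 := (g1.const_mul a₀).sub g2
    have i3 := iH.const_mul CC
    have i4 := (i1.add i2).add i3
    have icont : Continuous fun ζ => (th ρ p M ε ζ * rr σ ζ ^ σ * ‖Cv c h ζ‖) ^ 2 :=
      (((th_cont ρ p M hε).mul hrc).mul hfc.norm).pow 2
    have i5 : Integrable fun ζ => κ / 4 * (th ρ p M ε ζ * rr σ ζ ^ σ * ‖Cv c h ζ‖) ^ 2 := by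
      refine i4.mono' (icont.const_mul _).aestronglyMeasurable (Filter.Eventually.of_forall fun ζ => ?_)
      rw [Real.norm_of_nonneg (by positivity)]
      exact hJ ζ
    have i6 := integral_mono i5 i4 hJ
    have e1 := integral_add (i1.add i2) i3
    have e2 := integral_add i1 i2
    have e3 := integral_sub (g1.const_mul a₀) g2
    have e4 : ∫ ζ, 1 / 2 * J ζ = 0 := by rw [integral_const_mul, hJ0, mul_zero]
    have e5 := i6.trans (e1.trans (congrArg₂ (· + ·) (e2.trans (congrArg₂ (· + ·) e4 e3)) rfl)).le
    rw [integral_const_mul, integral_const_mul, integral_const_mul, zero_add] at e5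
    refine ⟨(i5.const_mul (4 / κ)).congr (Filter.Eventually.of_forall fun ζ => ?_), ?_⟩
    · simp only; field_simp
    · have e6 : κ / 4 * ∫ ζ, (th ρ p M ε ζ * rr σ ζ ^ σ * ‖Cv c h ζ‖) ^ 2 ≤
          CC * ∫ ζ, (H ζ ^ 2 + H2 ζ ^ 2 + H3 ζ ^ 2) := by
        refine e5.trans ?_
        have := g3
        simp only [Pi.add_apply]
        linarith
      have e7 := mul_le_mul_of_nonneg_left e6 (by positivity : 0 ≤ 4 / κ)
      refine le_trans (le_of_eq ?_) e7
      field_simp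

end HE

namespace HE
open scoped FourierTransform

/-- the localised solution lies in the weighted space, for all sufficiently decaying cutoffs -/
def Kn (h : Z n → ℂ) (U : Set (ℝ × E n)) (W : Z n → ℝ) : Prop :=
  ∃ k : ℝ, ∀ c, Cl U k c → MemLp (fun ζ => W ζ * ‖Cv c h ζ‖) 2

lemma Kn.mono {h : Z n → ℂ} {U : Set (ℝ × E n)} {W W' : Z n → ℝ} (H : Kn h U W) (hh : GI h)
    (hc : Continuous W') (h0 : ∀ ζ, 0 ≤ W' ζ) (hle : ∀ ζ, W' ζ ≤ W ζ) : Kn h U W' := by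
  obtain ⟨k, hk⟩ := H
  refine ⟨max k (2 * n + 3), fun c hcl => ?_⟩
  refine (hk c (hcl.mono (le_max_left _ _))).mono
    (hc.mul (cv_cont hcl.1 (le_max_right _ _) hh).norm).aestronglyMeasurable
    (Filter.Eventually.of_forall fun ζ => ?_)
  have hx := norm_nonneg (Cv c h ζ)
  rw [Real.norm_of_nonneg (mul_nonneg (h0 ζ) hx), Real.norm_of_nonneg (mul_nonneg ((h0 ζ).trans (hle ζ)) hx)]
  exact mul_le_mul_of_nonneg_right (hle ζ) hx

lemma Kn.energy {σ : ℝ} {w : E n → ℝ} {a : Z n → ℝ} {a₀ s : ℝ} {h : Z n → ℂ} {U : Set (ℝ × E n)}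
    (D : Dat σ w a a₀ s h U) {ρ p : ℝ} (hρ : ρ ≤ s) (hρp : ρ + p ≤ s + σ / (2 * σ + 1))
    (H : Kn h U (fun ζ => jb ζ ^ ρ * jm ζ ^ p * je ζ ^ (k0 σ / 2))) :
    Kn h U (fun ζ => jb ζ ^ ρ * jm ζ ^ p * rr σ ζ ^ σ) := by
  obtain ⟨k1, hk1⟩ := H
  obtain ⟨m, hm⟩ := exists_nat_ge (max k1 (2 * n + 3))
  have hm1 : k1 ≤ m := (le_max_left _ _).trans hm
  have hm2 : 2 * (n:ℝ) + 3 ≤ m := (le_max_right _ _).trans hm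
  have hm0 : (0:ℝ) ≤ m := Nat.cast_nonneg m
  refine ⟨max (k1 + 1) (2 * n + 4 + 2 * m), fun c hc => ?_⟩
  refine energy_fix D hρ hρp hc m (by linarith) (le_max_right _ _) (fun q hq => hk1 q (hq.mono (by linarith))) ?_
  refine hk1 _ (hc.tr.mono ?_)
  have := le_max_left (k1 + 1) (2 * (n:ℝ) + 4 + 2 * m)
  linarith

lemma rrr_cont {σ : ℝ} : Continuous fun ζ : Z n => rr σ ζ ^ σ :=
  (rr_cont σ).rpow_const fun ζ => Or.inl (rr_pos σ ζ).ne'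

lemma one_le_rrs {σ : ℝ} (hσ : 0 < σ) (ζ : Z n) : 1 ≤ rr σ ζ ^ σ := Real.one_le_rpow (one_le_rr hσ ζ) hσ.le

lemma jm_le_rrs {σ : ℝ} (hσ : 0 < σ) (ζ : Z n) : jm ζ ^ (σ / (2 * σ + 1)) ≤ rr σ ζ ^ σ := by
  calc _ ≤ (rr σ ζ ^ (2 * σ + 1)) ^ (σ / (2 * σ + 1)) :=
        Real.rpow_le_rpow (jm_pos ζ).le (jm_le_rr hσ ζ) (by positivity)
    _ = _ := by
      rw [← Real.rpow_mul (rr_pos σ ζ).le]; congr 1; field_simp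

lemma Kn.inner {σ : ℝ} {w : E n → ℝ} {a : Z n → ℝ} {a₀ s : ℝ} {h : Z n → ℂ} {U : Set (ℝ × E n)}
    (D : Dat σ w a a₀ s h U) {ρ : ℝ} (hρ : ρ ≤ s) (H : Kn h U (fun ζ => jb ζ ^ ρ)) :
    Kn h U (fun ζ => jb ζ ^ ρ * jm ζ ^ (s - ρ + σ / (2 * σ + 1)) * rr σ ζ ^ σ) := by
  have hσ := D.s0
  have hσ1 := D.s1
  set d2 := σ / (2 * σ + 1) with hd2
  have hd20 : 0 < d2 := by positivity
  set P := s - ρ + d2 with hP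
  set γ := min σ (1 / 2) / (2 * σ + 1) with hγ
  have hmin : 0 < min σ (1 / 2) := lt_min hσ (by norm_num)
  have hγ0 : 0 < γ := by positivity
  have hk0 : k0 σ / 2 + min σ (1 / 2) ≤ σ := by
    rw [k0]
    rcases max_cases (2 * σ - 1) 0 with h1 | h1 <;> rcases min_cases σ (1 / 2) with h2 | h2 <;> linarith [h1.1, h1.2, h2.1, h2.2]
  have hk00 : 0 ≤ k0 σ := le_max_right _ _
  have hk01 : k0 σ / 2 ≤ 1 / 2 := by
    rw [k0]
    rcases max_cases (2 * σ - 1) 0 with h1 | h1 <;> linarith [h1.1]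
  have hcont : ∀ p : ℝ, Continuous fun ζ : Z n => jb ζ ^ ρ * jm ζ ^ p * je ζ ^ (k0 σ / 2) := fun p =>
    ((jbr_cont ρ).mul (jmr_cont p)).mul (jer_cont _)
  have hnn : ∀ p : ℝ, ∀ ζ : Z n, 0 ≤ jb ζ ^ ρ * jm ζ ^ p * je ζ ^ (k0 σ / 2) := fun p ζ => by
    have := jb_pos ζ; have := jm_pos ζ; have := je_pos ζ; positivity
  have ind : ∀ j : ℕ, Kn h U (fun ζ => jb ζ ^ ρ * jm ζ ^ (min (-(1/2) + j * γ) P) * rr σ ζ ^ σ) := by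
    intro j
    induction j with
    | zero =>
      have e : min (-(1/2) + ((0:ℕ):ℝ) * γ) P = -(1/2) := by
        rw [Nat.cast_zero, zero_mul, add_zero]; exact min_eq_left (by linarith)
      rw [e]
      refine Kn.energy D hρ (by linarith) (H.mono D.gi (hcont _) (hnn _) fun ζ => ?_)
      rw [mul_assoc]
      refine mul_le_of_le_one_right (jbr_pos ζ ρ).le ?_
      calc jm ζ ^ (-(1/2) : ℝ) * je ζ ^ (k0 σ / 2) ≤ jm ζ ^ (-(1/2) : ℝ) * jm ζ ^ (1 / 2 : ℝ) := by
            refine mul_le_mul_of_nonneg_left ?_ (Real.rpow_nonneg (jm_pos ζ).le _)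
            exact (je_mono ζ hk01).trans (Real.rpow_le_rpow (je_pos ζ).le (je_le_jm ζ) (by norm_num))
        _ = 1 := by rw [← Real.rpow_add (jm_pos ζ)]; norm_num
    | succ j ih =>
      set p := min (-(1/2) + (j:ℝ) * γ) P with hp
      set p' := min (-(1/2) + ((j + 1 : ℕ):ℝ) * γ) P with hp'
      have h1 : p ≤ p' := min_le_min (by push_cast; linarith) le_rfl
      have h2 : p' ≤ p + γ := by
        have i1 : p' ≤ -(1/2) + ((j + 1 : ℕ):ℝ) * γ := min_le_left _ _
        have i2 : p' ≤ P := min_le_right _ _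
        push_cast at i1
        have : p' - γ ≤ p := le_min (by linarith) (by linarith)
        linarith
      have h3 : p' ≤ P := min_le_right _ _
      refine Kn.energy D hρ (by linarith) (ih.mono D.gi (hcont _) (hnn _) fun ζ => ?_)
      have e1 : jm ζ ^ p' = jm ζ ^ p * jm ζ ^ (p' - p) := by
        rw [← Real.rpow_add (jm_pos ζ)]; congr 1; ring
      rw [e1, ← mul_assoc (jb ζ ^ ρ), mul_assoc _ (jm ζ ^ (p' - p))]
      refine mul_le_mul_of_nonneg_left ?_ (by have := jb_pos ζ; have := jm_pos ζ; positivity)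
      have hr := rr_pos σ ζ
      calc jm ζ ^ (p' - p) * je ζ ^ (k0 σ / 2) ≤ (rr σ ζ ^ (2 * σ + 1)) ^ γ * rr σ ζ ^ (k0 σ / 2) := by
            refine mul_le_mul ?_ (Real.rpow_le_rpow (je_pos ζ).le (je_le_rr hσ ζ) (by linarith))
              (jer_pos ζ _).le (by positivity)
            exact (Real.rpow_le_rpow_of_exponent_le (one_le_jm ζ) (by linarith)).trans
              (Real.rpow_le_rpow (jm_pos ζ).le (jm_le_rr hσ ζ) hγ0.le)
        _ = rr σ ζ ^ (k0 σ / 2 + min σ (1 / 2)) := by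
            rw [← Real.rpow_mul hr.le, ← Real.rpow_add hr]; congr 1; rw [hγ]; field_simp; ring
        _ ≤ _ := Real.rpow_le_rpow_of_exponent_le (one_le_rr hσ ζ) hk0
  obtain ⟨j, hj⟩ := exists_nat_ge ((P + 1 / 2) / γ)
  have := ind j
  rw [div_le_iff₀ hγ0] at hj
  rwa [min_eq_right (by linarith)] at this

lemma jb_two {ζ : Z n} {x : ℝ} (hx : 0 < x) (h1 : |tC ζ| ≤ x) (h2 : jm ζ ≤ x) : jb ζ ≤ 2 * x := by
  refine le_of_sq_le_sq' (by linarith) ?_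
  have e : jb ζ ^ 2 = tC ζ ^ 2 + jm ζ ^ 2 := by
    rw [jb_sq, jm_sq, normsq]; ring
  rw [e, ← sq_abs (tC ζ)]
  have := pow_le_pow_left₀ (abs_nonneg _) h1 2
  have := pow_le_pow_left₀ (jm_pos ζ).le h2 2
  nlinarith

/-- pointwise weight facts for the time-direction gain -/
lemma tau_w {σ s ρ e : ℝ} (hσ : 0 < σ) (hd : ρ ≤ s) (he0 : 0 < e) (he1 : e ≤ 1)
    (he2 : e ≤ s - ρ + 2 * (σ / (2 * σ + 1))) (he3 : 2 * σ * e ≤ s - ρ + σ / (2 * σ + 1) + σ) (ζ : Z n) :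
    jb ζ ^ (ρ + e) ≤ 2 * (jb ζ ^ ρ * jm ζ ^ (s - ρ + σ / (2 * σ + 1)) * rr σ ζ ^ σ) ∨
    (jb ζ ≤ 2 * |tC ζ| ∧ jb ζ ^ (ρ + e - 1) ≤ jb ζ ^ ρ * je ζ ^ (s - ρ + σ / (2 * σ + 1) + σ - 2 * σ)) := by
  set d2 := σ / (2 * σ + 1) with hd2
  have hd20 : 0 < d2 := by positivity
  have hb := jb_pos ζ
  have h2 : (2:ℝ) ^ e ≤ 2 := by
    calc (2:ℝ) ^ e ≤ 2 ^ (1:ℝ) := Real.rpow_le_rpow_of_exponent_le (by norm_num) he1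
      _ = 2 := Real.rpow_one 2
  by_cases hA : |tC ζ| ≤ jm ζ
  · left
    have h1 := jb_two (jm_pos ζ) hA le_rfl
    have h3 : jm ζ ^ e ≤ jm ζ ^ (s - ρ + d2) * rr σ ζ ^ σ := by
      calc jm ζ ^ e ≤ jm ζ ^ (s - ρ + d2 + d2) := Real.rpow_le_rpow_of_exponent_le (one_le_jm ζ) (by linarith)
        _ = jm ζ ^ (s - ρ + d2) * jm ζ ^ d2 := Real.rpow_add (jm_pos ζ) _ _
        _ ≤ _ := mul_le_mul_of_nonneg_left (jm_le_rrs hσ ζ) (Real.rpow_nonneg (jm_pos ζ).le _)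
    rw [Real.rpow_add hb, mul_assoc, mul_left_comm]
    refine mul_le_mul_of_nonneg_left ?_ (jbr_pos ζ ρ).le
    calc jb ζ ^ e ≤ (2 * jm ζ) ^ e := Real.rpow_le_rpow hb.le h1 he0.le
      _ = 2 ^ e * jm ζ ^ e := Real.mul_rpow (by norm_num) (jm_pos ζ).le
      _ ≤ 2 * _ := mul_le_mul h2 h3 (Real.rpow_nonneg (jm_pos ζ).le _) (by norm_num)
  · push Not at hA
    have ht : 0 < |tC ζ| := (jm_pos ζ).trans hA
    have h1 := jb_two ht le_rfl hA.le
    by_cases hB : |tC ζ| ^ e ≤ je ζ ^ (s - ρ + d2 + σ)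
    · left
      rw [Real.rpow_add hb, mul_assoc, mul_left_comm]
      refine mul_le_mul_of_nonneg_left ?_ (jbr_pos ζ ρ).le
      have h3 : je ζ ^ (s - ρ + d2 + σ) ≤ jm ζ ^ (s - ρ + d2) * rr σ ζ ^ σ := by
        rw [Real.rpow_add (je_pos ζ)]
        refine mul_le_mul (Real.rpow_le_rpow (je_pos ζ).le (je_le_jm ζ) (by linarith))
          (Real.rpow_le_rpow (je_pos ζ).le (je_le_rr hσ ζ) hσ.le) (jer_pos ζ _).le (Real.rpow_nonneg (jm_pos ζ).le _)
      calc jb ζ ^ e ≤ (2 * |tC ζ|) ^ e := Real.rpow_le_rpow hb.le h1 he0.le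
        _ = 2 ^ e * |tC ζ| ^ e := Real.mul_rpow (by norm_num) ht.le
        _ ≤ 2 * _ := mul_le_mul h2 (hB.trans h3) (Real.rpow_nonneg ht.le _) (by norm_num)
    · right
      refine ⟨h1, ?_⟩
      push Not at hB
      set α := s - ρ + d2 + σ with hα
      have e1 : ρ + e - 1 = ρ + (e - 1) := by ring
      rw [e1, Real.rpow_add hb]
      refine mul_le_mul_of_nonneg_left ?_ (jbr_pos ζ ρ).le
      have h4 : |tC ζ| ≤ jb ζ := by
        have := norm_tC_le ζ
        exact this.trans (norm_le_jb ζ)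
      have h5 : je ζ ^ (α / e) ≤ |tC ζ| := by
        have := Real.rpow_le_rpow (jer_pos ζ α).le hB.le (by positivity : 0 ≤ e⁻¹)
        rwa [← Real.rpow_mul (je_pos ζ).le, ← Real.rpow_mul ht.le, mul_inv_cancel₀ he0.ne', Real.rpow_one,
          ← div_eq_mul_inv] at this
      calc jb ζ ^ (e - 1) ≤ (je ζ ^ (α / e)) ^ (e - 1) :=
            Real.rpow_le_rpow_of_nonpos (jer_pos ζ _) (h5.trans h4) (by linarith)
        _ = je ζ ^ (α - α / e) := by
            rw [← Real.rpow_mul (je_pos ζ).le]; congr 1; field_simp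
        _ ≤ _ := je_mono ζ (by
            have : 2 * σ ≤ α / e := by rw [le_div_iff₀ he0]; exact he3
            linarith)

end HE

namespace HE
open scoped FourierTransform

lemma tau_alg {f A S2 T G1 T1 : ℂ} {τ b : ℝ} (hb : b ≤ 2 * |τ|)
    (he : 2 * π * Complex.I * τ * f + T + A + S2 = G1 + T1) :
    b * ‖f‖ ≤ ‖T‖ + ‖A‖ + ‖S2‖ + ‖G1‖ + ‖T1‖ := by
  have h1 : 2 * π * Complex.I * τ * f = G1 + T1 - T - A - S2 := by rw [← he]; ring
  have h2 : ‖2 * π * Complex.I * τ * f‖ = 2 * π * |τ| * ‖f‖ := by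
    simp [abs_of_pos Real.pi_pos]
  have h3 : ‖G1 + T1 - T - A - S2‖ ≤ ‖G1‖ + ‖T1‖ + ‖T‖ + ‖A‖ + ‖S2‖ := by
    have a1 := norm_sub_le (G1 + T1 - T - A) S2
    have a2 := norm_sub_le (G1 + T1 - T) A
    have a3 := norm_sub_le (G1 + T1) T
    have a4 := norm_add_le G1 T1
    linarith
  rw [← h1, h2] at h3
  have h4 : b * ‖f‖ ≤ 2 * |τ| * ‖f‖ := mul_le_mul_of_nonneg_right hb (norm_nonneg _)
  have h5 : 2 * |τ| * ‖f‖ ≤ π * (2 * |τ| * ‖f‖) :=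
    le_mul_of_one_le_left (by positivity) (by linarith [Real.pi_gt_three])
  linarith

set_option maxHeartbeats 800000 in
lemma Kn.tau {σ : ℝ} {w : E n → ℝ} {a : Z n → ℝ} {a₀ s : ℝ} {h : Z n → ℂ} {U : Set (ℝ × E n)}
    (D : Dat σ w a a₀ s h U) {ρ e : ℝ} (hd : ρ ≤ s) (he0 : 0 < e) (he1 : e ≤ 1)
    (he2 : e ≤ s - ρ + 2 * (σ / (2 * σ + 1))) (he3 : 2 * σ * e ≤ s - ρ + σ / (2 * σ + 1) + σ)
    (H : Kn h U (fun ζ => jb ζ ^ ρ * jm ζ ^ (s - ρ + σ / (2 * σ + 1)) * rr σ ζ ^ σ)) :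
    Kn h U (fun ζ => jb ζ ^ (ρ + e)) := by
  have hσ := D.s0
  have hσ1 := D.s1
  have hn0 : (0:ℝ) ≤ n := Nat.cast_nonneg n
  have hw := fun ζ : Z n => tau_w hσ hd he0 he1 he2 he3 ζ
  set X : Z n → ℝ := fun ζ => jb ζ ^ ρ * jm ζ ^ (s - ρ + σ / (2 * σ + 1)) * rr σ ζ ^ σ with hX
  set α := s - ρ + σ / (2 * σ + 1) + σ with hα
  have hd20 : 0 < σ / (2 * σ + 1) := by positivity
  have hX0 : ∀ ζ, 0 ≤ X ζ := fun ζ => by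
    have := jb_pos ζ; have := jm_pos ζ; have := rr_pos σ ζ; positivity
  have hXρ : ∀ ζ, jb ζ ^ ρ ≤ X ζ := fun ζ => by
    simp only [hX]; rw [mul_assoc]
    exact le_mul_of_one_le_right (jbr_pos ζ ρ).le
      (one_le_mul_of_one_le_of_one_le (Real.one_le_rpow (one_le_jm ζ) (by linarith)) (one_le_rrs hσ ζ))
  have hXe : ∀ ζ, jb ζ ^ ρ * jm ζ ^ e ≤ X ζ := fun ζ => by
    simp only [hX]; rw [mul_assoc]
    refine mul_le_mul_of_nonneg_left ?_ (jbr_pos ζ ρ).le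
    calc jm ζ ^ e ≤ jm ζ ^ (s - ρ + σ / (2 * σ + 1) + σ / (2 * σ + 1)) :=
          Real.rpow_le_rpow_of_exponent_le (one_le_jm ζ) (by linarith)
      _ = jm ζ ^ (s - ρ + σ / (2 * σ + 1)) * jm ζ ^ (σ / (2 * σ + 1)) := Real.rpow_add (jm_pos ζ) _ _
      _ ≤ _ := mul_le_mul_of_nonneg_left (jm_le_rrs hσ ζ) (Real.rpow_nonneg (jm_pos ζ).le _)
  have hXα : ∀ ζ, jb ζ ^ ρ * je ζ ^ α ≤ X ζ := fun ζ => by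
    simp only [hX]; rw [mul_assoc]
    refine mul_le_mul_of_nonneg_left ?_ (jbr_pos ζ ρ).le
    rw [hα, Real.rpow_add (je_pos ζ)]
    exact mul_le_mul (Real.rpow_le_rpow (je_pos ζ).le (je_le_jm ζ) (by linarith))
      (Real.rpow_le_rpow (je_pos ζ).le (je_le_rr hσ ζ) hσ.le) (jer_pos ζ _).le (Real.rpow_nonneg (jm_pos ζ).le _)
  obtain ⟨k1, hk1⟩ := H
  obtain ⟨m, hm'⟩ := exists_nat_ge (max k1 (2 * n + 3))
  have hm1 : k1 ≤ m := (le_max_left _ _).trans hm'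
  have hm2 : 2 * (n:ℝ) + 3 ≤ m := (le_max_right _ _).trans hm'
  have hm0 : (0:ℝ) ≤ m := Nat.cast_nonneg m
  refine ⟨max (k1 + 1) (2 * n + 4 + 2 * m), fun c hc => ?_⟩
  set k := max (k1 + 1) (2 * n + 4 + 2 * (m:ℝ)) with hkd
  have hkk1 : k1 + 1 ≤ k := le_max_left _ _
  have hk : 2 * (n:ℝ) + 4 + 2 * m ≤ k := le_max_right _ _
  clear_value k
  have hm : 2 * (n:ℝ) + 3 ≤ 2 * m := by linarith
  obtain ⟨q, hq, -, G, hGm, hGL, ι, _, fl, pl, hfl, hpl, heq⟩ := EQ D hc m hm hk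
  have hW := hk1 q (hq.mono (by linarith))
  have hTm := hk1 _ (hc.tr.mono (by linarith))
  have hvm := fun i => hk1 _ ((hc.vm i).mono (by linarith : k1 ≤ k - 1))
  have hcm := hk1 c (hc.mono (by linarith))
  have hb : Bk (k - 2 * m) (fun z => c z * Pw m z) := by
    have := hc.1.mul (Pw_bk m); exact this.mono (by linarith)
  have hab : Bk (k - 2 * m) (fun z => (a z : ℂ) * (c z * Pw m z)) := (D.ha.mul hb).mono (by linarith)
  have hapl : ∀ l, Bk (k - 2 * m) (fun z => (a z : ℂ) * (c z * pl l z)) := fun l =>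
    (D.ha.mul (hc.1.mul (hpl l))).mono (by linarith)
  have hkm : 2 * (n:ℝ) + 2 ≤ k - 2 * m := by linarith
  set Y := Cv q h with hY
  have hmult : ∀ {b : Z n → ℂ} {g : Z n → ℂ} {C : ℝ}, Bk (k - 2 * m) b → 0 ≤ C → (∀ ζ, ‖g ζ‖ ≤ C * je ζ ^ (2 * σ)) →
      ∃ K, 0 ≤ K ∧ ∀ ζ, jb ζ ^ ρ * je ζ ^ (α - 2 * σ) * ‖Cv b (fun ζ => g ζ * Y ζ) ζ‖ ≤
        K * HH (fun ζ => X ζ * ‖Y ζ‖) ζ := fun {b g C} hb' hC hg => by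
    obtain ⟨K, hK, hK'⟩ := ML (ι := Unit) hb' hkm (lam := fun _ ζ => jb ζ ^ ρ * je ζ ^ (α - 2 * σ))
      ((sv_jb.rpow ρ).mul (sv_je.rpow (α - 2 * σ))).md C
    refine ⟨K, hK, fun ζ => hK' () g Y X ζ hW hX0 fun ζ' => ?_⟩
    have h1 := mul_le_mul_of_nonneg_left (hg ζ') (mul_pos (jbr_pos ζ' ρ) (jer_pos ζ' (α - 2 * σ))).le
    refine h1.trans ?_
    have h2 : je ζ' ^ α = je ζ' ^ (α - 2 * σ) * je ζ' ^ (2 * σ) := by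
      rw [← Real.rpow_add (je_pos ζ')]; congr 1; ring
    have h3 := mul_le_mul_of_nonneg_left (hXα ζ') hC
    rw [h2] at h3
    refine le_trans (le_of_eq ?_) h3
    ring
  have hje1 : ∀ ζ : Z n, 1 ≤ je ζ ^ (2 * σ) := fun ζ => Real.one_le_rpow (one_le_je ζ) (by linarith)
  obtain ⟨CF, hCF, hF⟩ := Fz_diff hσ hσ1 D.hw D.hwout D.hwin
  obtain ⟨K5, hK5, b5⟩ := hmult (g := Fz σ w) (C := CF + 1) hab (by linarith) fun ζ => by
    have h1 := norm_add_le (Fz σ w ζ - ((je ζ ^ (2 * σ) : ℝ) : ℂ)) ((je ζ ^ (2 * σ) : ℝ) : ℂ)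
    rw [sub_add_cancel, Complex.norm_real, Real.norm_of_nonneg (jer_pos ζ _).le] at h1
    have h2 := hF ζ
    have h3 := mul_le_mul_of_nonneg_left (hje1 ζ) hCF
    linarith
  have h7 : ∀ l, ∃ K, 0 ≤ K ∧ ∀ ζ, jb ζ ^ ρ * je ζ ^ (α - 2 * σ) *
      ‖Cv (fun z => (a z : ℂ) * (c z * pl l z)) (fun ζ => fl l ζ * Y ζ) ζ‖ ≤ K * HH (fun ζ => X ζ * ‖Y ζ‖) ζ := fun l => by
    obtain ⟨C, hC, hCl⟩ := (hfl l).bd0 (fun z => (jer_pos z _).le)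
    refine hmult (hapl l) hC fun ζ => (hCl ζ).trans (mul_le_mul_of_nonneg_left (je_mono ζ ?_) hC)
    exact max_le (by linarith) (by linarith)
  choose K7 hK7 b7 using h7
  obtain ⟨K8, hK8, b8⟩ := ML (ι := Unit) hc.1 (by linarith) (lam := fun _ ζ => jb ζ ^ s)
    (sv_jb.rpow s).md 1
  have hHL : MemLp (HH (fun ζ => X ζ * ‖Y ζ‖)) 2 := hh_L2 (fun ζ => mul_nonneg (hX0 ζ) (norm_nonneg _)) hW
  have hH0 : ∀ ζ, 0 ≤ HH (fun ζ => X ζ * ‖Y ζ‖) ζ := hh_nonneg (fun ζ => mul_nonneg (hX0 ζ) (norm_nonneg _))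
  have hH20 : ∀ ζ, 0 ≤ HH (fun ζ => jb ζ ^ s * ‖G ζ‖) ζ := hh_nonneg fun ζ => by
    have := jb_pos ζ; positivity
  have hH2L : MemLp (HH (fun ζ => jb ζ ^ s * ‖G ζ‖)) 2 := hh_L2 (fun ζ => by
    have := jb_pos ζ; positivity) hGL
  set H := HH (fun ζ => X ζ * ‖Y ζ‖) with hH
  set H2 := HH (fun ζ => jb ζ ^ s * ‖G ζ‖) with hH2
  have hS : MemLp (fun ζ => ∑ i, 2 * π * (X ζ * ‖Cv (fun z => c z * ((vC z i : ℝ) : ℂ)) h ζ‖)) 2 :=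
    memLp_finsetSum _ fun i _ => (hvm i).const_mul (2 * π)
  have hS0 : ∀ ζ, 0 ≤ ∑ i, 2 * π * (X ζ * ‖Cv (fun z => c z * ((vC z i : ℝ) : ℂ)) h ζ‖) := fun ζ =>
    Finset.sum_nonneg fun i _ => mul_nonneg (by positivity) (mul_nonneg (hX0 ζ) (norm_nonneg _))
  have hfc : Continuous (Cv c h) := cv_cont hc.1 (by linarith) D.gi
  have hS7 : 0 ≤ ∑ l, K7 l := Finset.sum_nonneg fun l _ => hK7 l
  have hall := (((((hcm.const_mul 2).add hS).add (hHL.const_mul K5)).add (hHL.const_mul (∑ l, K7 l))).add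
    (hH2L.const_mul K8)).add hTm
  refine hall.mono ((jbr_cont (ρ + e)).mul hfc.norm).aestronglyMeasurable (Filter.Eventually.of_forall fun ζ => ?_)
  have p0 := mul_nonneg (hX0 ζ) (norm_nonneg (Cv c h ζ))
  have p1 := hS0 ζ
  have p2 := mul_nonneg hK5 (hH0 ζ)
  have p3 := mul_nonneg hS7 (hH0 ζ)
  have p4 := mul_nonneg hK8 (hH20 ζ)
  have p5 := mul_nonneg (hX0 ζ) (norm_nonneg (Cv (Tr c) h ζ))
  rw [Real.norm_of_nonneg (mul_nonneg (jbr_pos ζ _).le (norm_nonneg _))]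
  refine le_trans ?_ (Real.le_norm_self _)
  change jb ζ ^ (ρ + e) * ‖Cv c h ζ‖ ≤ 2 * (X ζ * ‖Cv c h ζ‖) +
    (∑ i, 2 * π * (X ζ * ‖Cv (fun z => c z * ((vC z i : ℝ) : ℂ)) h ζ‖)) + K5 * H ζ + (∑ l, K7 l) * H ζ + K8 * H2 ζ +
      X ζ * ‖Cv (Tr c) h ζ‖
  rcases hw ζ with h1 | ⟨h1, h2⟩
  · have := mul_le_mul_of_nonneg_right h1 (norm_nonneg (Cv c h ζ))
    have e1 : 2 * (jb ζ ^ ρ * jm ζ ^ (s - ρ + σ / (2 * σ + 1)) * rr σ ζ ^ σ) * ‖Cv c h ζ‖ = 2 * (X ζ * ‖Cv c h ζ‖) := by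
      simp only [hX]; ring
    rw [e1] at this
    linarith
  · have h3 := tau_alg h1 (heq ζ)
    have hbp := jbr_pos ζ (ρ + e - 1)
    have h4 := mul_le_mul_of_nonneg_left h3 hbp.le
    have e1 : jb ζ ^ (ρ + e) = jb ζ ^ (ρ + e - 1) * jb ζ := by
      rw [Real.rpow_sub_one (jb_pos ζ).ne']; have := jb_pos ζ; field_simp
    have t1 : jb ζ ^ (ρ + e - 1) * ‖∑ i, 2 * π * Complex.I * (xC ζ i) *
        Cv (fun z => c z * ((vC z i : ℝ) : ℂ)) h ζ‖ ≤
        ∑ i, 2 * π * (X ζ * ‖Cv (fun z => c z * ((vC z i : ℝ) : ℂ)) h ζ‖) := by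
      refine (mul_le_mul_of_nonneg_left (norm_sum_le _ _) hbp.le).trans ?_
      rw [Finset.mul_sum]
      refine Finset.sum_le_sum fun i _ => ?_
      have e2 : ‖2 * π * Complex.I * (xC ζ i) * Cv (fun z => c z * ((vC z i : ℝ) : ℂ)) h ζ‖ =
          2 * π * (|xC ζ i| * ‖Cv (fun z => c z * ((vC z i : ℝ) : ℂ)) h ζ‖) := by
        rw [norm_mul, norm_mul, Complex.norm_real, Real.norm_eq_abs]
        have : ‖(2 * π * Complex.I : ℂ)‖ = 2 * π := by simp [abs_of_pos Real.pi_pos]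
        rw [this]; ring
      rw [e2, mul_left_comm, ← mul_assoc (jb ζ ^ (ρ + e - 1))]
      refine mul_le_mul_of_nonneg_left (mul_le_mul_of_nonneg_right ?_ (norm_nonneg _)) (by positivity)
      refine le_trans ?_ (hXe ζ)
      have hx : |xC ζ i| ≤ jm ζ := (Real.norm_eq_abs _).symm.le.trans ((PiLp.norm_apply_le _ i).trans (norm_xC_le_jm ζ))
      have e3 : jb ζ ^ (ρ + e - 1) = jb ζ ^ ρ * jb ζ ^ (e - 1) := by
        rw [← Real.rpow_add (jb_pos ζ)]; congr 1; ring
      rw [e3, mul_assoc]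
      refine mul_le_mul_of_nonneg_left ?_ (jbr_pos ζ ρ).le
      calc jb ζ ^ (e - 1) * |xC ζ i| ≤ jm ζ ^ (e - 1) * jm ζ :=
            mul_le_mul (Real.rpow_le_rpow_of_nonpos (jm_pos ζ) (jm_le_jb ζ) (by linarith)) hx (abs_nonneg _)
              (Real.rpow_nonneg (jm_pos ζ).le _)
        _ = jm ζ ^ e := by rw [Real.rpow_sub_one (jm_pos ζ).ne']; have := jm_pos ζ; field_simp
    have t2 := (mul_le_mul_of_nonneg_right h2 (norm_nonneg
      (Cv (fun z => (a z : ℂ) * (c z * Pw m z)) (fun ζ => Fz σ w ζ * Y ζ) ζ))).trans (b5 ζ)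
    have t3 : jb ζ ^ (ρ + e - 1) * ‖∑ l, Cv (fun z => (a z : ℂ) * (c z * pl l z)) (fun ζ => fl l ζ * Y ζ) ζ‖ ≤
        (∑ l, K7 l) * H ζ := by
      refine (mul_le_mul_of_nonneg_left (norm_sum_le _ _) hbp.le).trans ?_
      rw [Finset.mul_sum, Finset.sum_mul]
      exact Finset.sum_le_sum fun l _ => (mul_le_mul_of_nonneg_right h2 (norm_nonneg _)).trans (b7 l ζ)
    have t4 : jb ζ ^ (ρ + e - 1) * ‖Cv c G ζ‖ ≤ K8 * H2 ζ := by
      have e1 := b8 () (fun _ => 1) G (fun ζ => jb ζ ^ s) ζ hGL (fun ζ => (jbr_pos ζ s).le) fun ζ => by simp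
      simp only [one_mul] at e1
      exact (mul_le_mul_of_nonneg_right (Real.rpow_le_rpow_of_exponent_le (one_le_jb ζ) (by linarith))
        (norm_nonneg _)).trans e1
    have t5 : jb ζ ^ (ρ + e - 1) * ‖Cv (Tr c) h ζ‖ ≤ X ζ * ‖Cv (Tr c) h ζ‖ :=
      mul_le_mul_of_nonneg_right ((Real.rpow_le_rpow_of_exponent_le (one_le_jb ζ) (by linarith)).trans (hXρ ζ))
        (norm_nonneg _)
    rw [e1, mul_assoc]
    simp only [mul_add] at h4
    linarith

lemma Kn.final {σ : ℝ} {w : E n → ℝ} {a : Z n → ℝ} {a₀ s : ℝ} {h : Z n → ℂ} {U : Set (ℝ × E n)}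
    (D : Dat σ w a a₀ s h U) (N : ℝ) (hN : MemLp (fun ζ => jb ζ ^ (-N) * ‖h ζ‖) 2) :
    Kn h U (fun ζ => jb ζ ^ (s + 2 * σ / (2 * σ + 1))) := by
  have hσ := D.s0
  have hσ1 := D.s1
  have hd20 : 0 < σ / (2 * σ + 1) := by positivity
  have h0 : Kn h U (fun ζ => jb ζ ^ (-N)) := by
    refine ⟨2 * n + 3, fun c hc => ?_⟩
    obtain ⟨K, hK, hb⟩ := ML (ι := Unit) hc.1 (by linarith) (lam := fun _ ζ => jb ζ ^ (-N)) (sv_jb.rpow (-N)).md 1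
    have hL := hh_L2 (fun ζ => mul_nonneg (jbr_pos ζ (-N)).le (norm_nonneg _)) hN
    refine (hL.const_mul K).mono ((jbr_cont _).mul (cv_cont hc.1 le_rfl D.gi).norm).aestronglyMeasurable
      (Filter.Eventually.of_forall fun ζ => ?_)
    rw [Real.norm_of_nonneg (mul_nonneg (jbr_pos ζ _).le (norm_nonneg _))]
    refine le_trans ?_ (Real.le_norm_self _)
    have := hb () (fun _ => 1) h (fun ζ => jb ζ ^ (-N)) ζ hN (fun ζ => (jbr_pos ζ _).le) fun ζ => by simp
    simp only [one_mul] at this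
    exact this
  obtain ⟨J, hJ⟩ := exists_nat_ge (2 * (s + N))
  have ind : ∀ i : ℕ, i ≤ J → Kn h U (fun ζ => jb ζ ^ (s - J / 2 + i / 2)) := by
    intro i
    induction i with
    | zero =>
      intro _
      refine h0.mono D.gi (jbr_cont _) (fun ζ => (jbr_pos ζ _).le) fun ζ => ?_
      refine Real.rpow_le_rpow_of_exponent_le (one_le_jb ζ) ?_
      push_cast; linarith
    | succ i ih =>
      intro hi
      have h1 := ih (by omega)
      have hi' : (i:ℝ) + 1 ≤ J := by exact_mod_cast hi
      have h2 := Kn.inner D (by linarith) h1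
      have h3 := Kn.tau D (e := 1 / 2) (by linarith) (by norm_num) (by norm_num) (by linarith) (by linarith) h2
      have e1 : s - (J:ℝ) / 2 + ((i + 1 : ℕ):ℝ) / 2 = s - J / 2 + i / 2 + 1 / 2 := by push_cast; ring
      rw [e1]; exact h3
  have h1 := ind J le_rfl
  rw [sub_add_cancel] at h1
  have h2 := Kn.inner D le_rfl h1
  have e2 : 2 * σ / (2 * σ + 1) = 2 * (σ / (2 * σ + 1)) := by ring
  refine Kn.tau D le_rfl (by positivity) ?_ ?_ ?_ h2
  · rw [div_le_one (by linarith)]; linarith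
  · rw [e2]; linarith
  · have : σ / (2 * σ + 1) + σ - 2 * σ * (2 * σ / (2 * σ + 1)) = 2 * σ * (1 - σ) / (2 * σ + 1) := by
      field_simp; ring
    have h3 : 0 ≤ 2 * σ * (1 - σ) / (2 * σ + 1) := div_nonneg (mul_nonneg (by linarith) (by linarith)) (by linarith)
    linarith

end HE

/-- Corollary 1.2, local form: local hypoelliptic regularity.
The tempered distribution `u` is encoded by its function Fourier transform `h`;
the hypothesis `u ∈ H^{-N}` reads `⟨ζ⟩^{-N} h ∈ L²`; the distributions
`φ·Pu` and `φ·⟨v⟩^{-k}u` act on a test function `ψ` by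
`⟨u, P^t(φψ)⟩` and `⟨u, φ⟨v⟩^{-k}ψ⟩` respectively. -/
theorem statement1
    (n : ℕ) (hn : 1 ≤ n) (σ : ℝ) (hσ0 : 0 < σ) (hσ1 : σ < 1)
    (w : E n → ℝ) (hw : ContDiff ℝ (⊤ : ℕ∞) w)
    (hw01 : ∀ η, 0 ≤ w η ∧ w η ≤ 1)
    (hwout : ∀ η : E n, 2 ≤ ‖η‖ → w η = 1)
    (hwin : ∀ η : E n, ‖η‖ ≤ 1 → w η = 0)
    (a : Z n → ℝ) (ha : ContDiff ℝ (⊤ : ℕ∞) a)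
    (haB : ∀ k : ℕ, ∃ C : ℝ, ∀ z, ‖iteratedFDeriv ℝ k a z‖ ≤ C)
    (a₀ : ℝ) (ha₀ : 0 < a₀) (haLB : ∀ z, a₀ ≤ a z)
    (N : ℕ) (s : ℝ) (hs : 0 ≤ s) (t₀ : ℝ) (x₀ : E n)
    -- `u ∈ H^{-N}(ℝ^{2n+1})`, encoded by its Fourier transform `h`
    (h : Z n → ℂ) (hmeas : AEStronglyMeasurable h volume)
    (huHN : MemLp (fun ζ => (((1 + ‖ζ‖ ^ 2) ^ (-(N : ℝ) / 2) : ℝ) : ℂ) * h ζ) 2 volume)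
    -- `Pu ∈ H^s` locally near `(t₀,x₀)`
    (hPu : ∃ U : Set (ℝ × E n), IsOpen U ∧ (t₀, x₀) ∈ U ∧
      ∀ φ : ℝ × E n → ℝ, ContDiff ℝ (⊤ : ℕ∞) φ → HasCompactSupport φ → tsupport φ ⊆ U →
        IsHr s (fun ψ : Z n → ℂ =>
          pairing h (Ptrans σ w a (fun z => ((φ (tC z, xC z) : ℝ) : ℂ) * ψ z)))) :
    ∃ k : ℕ, 1 ≤ k ∧ ∃ V : Set (ℝ × E n), IsOpen V ∧ (t₀, x₀) ∈ V ∧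
      ∀ φ : ℝ × E n → ℝ, ContDiff ℝ (⊤ : ℕ∞) φ → HasCompactSupport φ → tsupport φ ⊆ V →
        IsHr (s + 2 * σ / (2 * σ + 1)) (fun ψ : Z n → ℂ =>
          pairing h (fun z =>
            ((φ (tC z, xC z) * (1 + ‖vC z‖ ^ 2) ^ (-(k : ℝ) / 2) : ℝ) : ℂ) * ψ z)) := by
  obtain ⟨U, hU, hmem, hP⟩ := hPu
  have hN := (HE.hr_norm huHN).2
  have hgi : HE.GI h := HE.GI.of_L2 hmeas hN
  have D : HE.Dat σ w a a₀ s h U :=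
    ⟨hσ0, hσ1, hw, hwout, hwin, HE.Bk.a ha haB, ha₀, haLB, hgi, hU, hP⟩
  obtain ⟨k1, hk1⟩ := HE.Kn.final D N hN
  obtain ⟨k, hk⟩ := exists_nat_ge (max k1 (2 * n + 3))
  have hkn : 2 * (n:ℝ) + 3 ≤ k := (le_max_right _ _).trans hk
  have hn0 : (0:ℝ) ≤ n := Nat.cast_nonneg n
  refine ⟨k, ?_, U, hU, hmem, fun φ h1 h2 h3 => ?_⟩
  · have : (1:ℝ) ≤ k := by linarith
    exact_mod_cast this
  have hcl := HE.lift_v_cl h1 h2 h3 (k := (k:ℝ)) (by linarith)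
  have hL := hk1 _ (hcl.mono ((le_max_left _ _).trans hk))
  refine ⟨HE.Cv (fun z => ((φ (tC z, xC z) * (1 + ‖vC z‖ ^ 2) ^ (-(k : ℝ) / 2) : ℝ) : ℂ)) h, ?_, fun ψ => ?_⟩
  · have hc := HE.cv_cont hcl.1 hkn hgi
    refine hL.mono ?_ (Filter.Eventually.of_forall fun ζ => ?_)
    · simp only [HE.jb_rpow]
      exact ((Complex.continuous_ofReal.comp (HE.jbr_cont _)).mul hc).aestronglyMeasurable
    · rw [HE.jb_rpow, norm_mul, norm_mul, norm_norm, Complex.norm_real]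
  · exact HE.B3 hcl.1 (by linarith) hgi ψ
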